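/- For every ε > 0 and fixed σ one has ∫₁^T |R(σ+it)|² dt ≪_ε T^{2−2σ+ε} for −1 < σ ≤ 1/2, and ∫₁^T |R(σ+it)|² dt ≪_ε T^{1+ε} for σ ≥ 1/2. -/

import Mathlib

open Complex Real MeasureTheory Set Filter

noncomputable section

/-- The multiplicity of `ρ` as a zero of the Riemann zeta function
(the order of vanishing, i.e. the least `n` with `ζ⁽ⁿ⁾(ρ) ≠ 0`). -/
def zetaMult (ρ : ℂ) : ℕ := sInf {n : ℕ | iteratedDeriv n riemannZeta ρ ≠ 0}

/-- `ρ` is a nontrivial zero of the Riemann zeta function. -/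
def IsNontrivialZero (ρ : ℂ) : Prop := riemannZeta ρ = 0 ∧ 0 < ρ.re ∧ ρ.re < 1

/-! ### Stirling's formula for `log ‖Γ‖` in the right half-plane -/

/-- The main term of Stirling's formula for `log ‖Γ z‖`. -/
def stirlingMain (z : ℂ) : ℝ := ((z - 1 / 2) * Complex.log z - z).re

lemma clog_add_ofReal {z : ℂ} (hz : 0 < z.re) {a : ℝ} (ha : 0 ≤ a) :
    Complex.log (z + a) = Complex.log z + Complex.log (1 + a / z) := by
  have hz0 : z ≠ 0 := by rintro rfl; simp at hz
  have hre : 0 < (1 + (a : ℂ) / z).re := by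
    have : 0 ≤ ((a : ℂ) / z).re := by
      rw [Complex.div_re]
      simp only [ofReal_re, ofReal_im, zero_mul, zero_div, add_zero]
      have := Complex.normSq_nonneg z
      positivity
    simp only [add_re, one_re]; linarith
  have h1 : (1 + (a : ℂ) / z) ≠ 0 := by intro h; rw [h] at hre; simp at hre
  rw [← Complex.log_mul hz0 h1]
  · congr 1; field_simp
  · have h2 := abs_lt.1 (Complex.abs_arg_lt_pi_div_two_iff.2 (Or.inl hz))
    have h3 := abs_lt.1 (Complex.abs_arg_lt_pi_div_two_iff.2 (Or.inl hre))
    constructor <;> linarith [h2.1, h2.2, h3.1, h3.2]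

lemma stirlingMain_step {z : ℂ} (hz : 0 < z.re) (hz2 : 2 ≤ ‖z‖) :
    |stirlingMain (z + 1) - stirlingMain z - Real.log ‖z‖| ≤ 2 / ‖z‖ ^ 2 := by
  have hz0 : z ≠ 0 := by rintro rfl; simp at hz
  set u : ℂ := 1 / z with hu
  have hnu : ‖u‖ = 1 / ‖z‖ := by rw [hu, norm_div, norm_one]
  have hu2 : ‖u‖ ≤ 1 / 2 := by
    rw [hnu]; exact one_div_le_one_div_of_le (by norm_num) hz2
  have hlog : Complex.log (z + 1) = Complex.log z + Complex.log (1 + u) := by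
    simpa [hu] using clog_add_ofReal hz zero_le_one
  have hT := Complex.norm_log_sub_logTaylor_le 2 (z := u) (by linarith)
  have hTay : Complex.logTaylor (2 + 1) u = u - u ^ 2 / 2 := by
    simp [Complex.logTaylor, Finset.sum_range_succ]; ring
  rw [hTay] at hT
  set d := Complex.log (1 + u) - (u - u ^ 2 / 2) with hd
  have hdn : ‖d‖ ≤ ‖u‖ ^ 3 := by
    refine hT.trans ?_
    have : (1 - ‖u‖)⁻¹ ≤ 2 := by
      rw [inv_le_comm₀ (by linarith) (by norm_num)]; linarith
    have h3 : 0 ≤ ‖u‖ ^ 3 := by positivity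
    norm_num
    nlinarith
  have key : stirlingMain (z + 1) - stirlingMain z - Real.log ‖z‖
      = ((z + 1 / 2) * d - u ^ 2 / 4).re := by
    rw [← Complex.log_re z, stirlingMain, stirlingMain, ← Complex.sub_re, ← Complex.sub_re, hlog]
    congr 1
    have hl : Complex.log (1 + u) = d + (u - u ^ 2 / 2) := by rw [hd]; ring
    have hzu : z * u = 1 := by rw [hu]; field_simp
    rw [hl]
    linear_combination (1 - u / 2) * hzu
  rw [key]
  refine (Complex.abs_re_le_norm _).trans ?_
  have hzn : 0 < ‖z‖ := by linarith
  have e1 : ‖(z + 1 / 2) * d - u ^ 2 / 4‖ ≤ (‖z‖ + 1 / 2) * ‖u‖ ^ 3 + ‖u‖ ^ 2 / 4 := by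
    refine (norm_sub_le _ _).trans ?_
    rw [norm_mul, norm_div, norm_pow]
    have : ‖z + 1 / 2‖ ≤ ‖z‖ + 1 / 2 := (norm_add_le _ _).trans (by norm_num)
    norm_num at this ⊢
    gcongr
  refine e1.trans ?_
  have e2 : ‖z‖ * ‖u‖ = 1 := by rw [hnu]; field_simp
  have e3 : 2 / ‖z‖ ^ 2 = 2 * ‖u‖ ^ 2 := by rw [hnu]; field_simp
  rw [e3]
  have e4 : (‖z‖ + 1 / 2) * ‖u‖ ^ 3 + ‖u‖ ^ 2 / 4 = (‖z‖ * ‖u‖) * ‖u‖ ^ 2 + ‖u‖ / 2 * ‖u‖ ^ 2 + ‖u‖ ^ 2 / 4 := by ring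
  rw [e4, e2]
  nlinarith [sq_nonneg ‖u‖]

lemma sum_two_div_norm_add_sq_le {z : ℂ} (hz : 0 < z.re) (hz2 : 2 ≤ ‖z‖) (N : ℕ) :
    ∑ j ∈ Finset.range N, 2 / ‖z + j‖ ^ 2 ≤ 8 / ‖z‖ := by
  have hstep : ∀ j : ℕ, 2 / ‖z + j‖ ^ 2 ≤ 4 * (1 / (‖z‖ + j - 1) - 1 / (‖z‖ + (j + 1 : ℕ) - 1)) := by
    intro j
    have hj : (0 : ℝ) ≤ j := Nat.cast_nonneg j
    have h1 : (‖z‖ + j) ^ 2 ≤ 2 * ‖z + j‖ ^ 2 := by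
      have a1 : ‖z + j‖ ^ 2 = ‖z‖ ^ 2 + 2 * z.re * j + j ^ 2 := by
        rw [Complex.sq_norm, Complex.sq_norm, Complex.normSq_apply, Complex.normSq_apply]
        simp; ring
      rw [a1]
      nlinarith [sq_nonneg (‖z‖ - j), mul_nonneg hz.le hj]
    have hp : 0 < ‖z‖ + j - 1 := by linarith
    have hp2 : 0 < ‖z‖ + j := by linarith
    have h2 : 2 / ‖z + j‖ ^ 2 ≤ 4 / (‖z‖ + j) ^ 2 := by
      have : 0 < ‖z + j‖ ^ 2 := by nlinarith
      rw [div_le_div_iff₀ this (by positivity)]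
      linarith
    refine h2.trans ?_
    have h3 : 1 / (‖z‖ + j - 1) - 1 / (‖z‖ + (j + 1 : ℕ) - 1) = 1 / ((‖z‖ + j - 1) * (‖z‖ + j)) := by
      push_cast
      rw [show ‖z‖ + (j + 1 : ℝ) - 1 = ‖z‖ + j by ring]
      field_simp; ring
    rw [h3, mul_one_div]
    apply div_le_div_of_nonneg_left (by norm_num) (by positivity)
    nlinarith
  calc _ ≤ ∑ j ∈ Finset.range N, 4 * (1 / (‖z‖ + j - 1) - 1 / (‖z‖ + (j + 1 : ℕ) - 1)) :=
        Finset.sum_le_sum fun j _ => hstep j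
    _ = 4 * (1 / (‖z‖ - 1) - 1 / (‖z‖ + N - 1)) := by
        rw [← Finset.mul_sum, Finset.sum_range_sub' (fun j : ℕ => 1 / (‖z‖ + j - 1))]
        simp
    _ ≤ 4 * (1 / (‖z‖ - 1)) := by
        have : 0 ≤ 1 / (‖z‖ + N - 1) := by
          have : (0 : ℝ) ≤ N := Nat.cast_nonneg N
          apply div_nonneg zero_le_one; linarith
        linarith
    _ ≤ 8 / ‖z‖ := by
        rw [mul_one_div, div_le_div_iff₀ (by linarith) (by linarith)]; linarith

/-- The remainder in Stirling's formula. -/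
def stirlingRem (z : ℂ) : ℝ := Real.log ‖Complex.Gamma z‖ - stirlingMain z

lemma abs_stirlingRem_sub_le {z : ℂ} (hz : 0 < z.re) (hz2 : 2 ≤ ‖z‖) (N : ℕ) :
    |stirlingRem z - stirlingRem (z + N)| ≤ 8 / ‖z‖ := by
  refine le_trans ?_ (sum_two_div_norm_add_sq_le hz hz2 N)
  induction N with
  | zero => simp
  | succ n ih =>
    rw [Finset.sum_range_succ]
    have hre : 0 < (z + n).re := by
      simp only [add_re, natCast_re]; positivity
    have hn2 : 2 ≤ ‖z + n‖ := by
      refine hz2.trans ?_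
      rw [← abs_norm z, ← abs_norm (z + n)]
      apply sq_le_sq.1
      rw [Complex.sq_norm, Complex.sq_norm, Complex.normSq_apply, Complex.normSq_apply]
      simp
      nlinarith [mul_nonneg hz.le (Nat.cast_nonneg (α := ℝ) n)]
    have hstep := stirlingMain_step hre hn2
    have h0 : z + n ≠ 0 := by intro h; rw [h] at hre; simp at hre
    have hG : Real.log ‖Complex.Gamma (z + n + 1)‖ = Real.log ‖z + n‖ + Real.log ‖Complex.Gamma (z + n)‖ := by
      rw [Complex.Gamma_add_one _ h0, norm_mul, Real.log_mul (norm_ne_zero_iff.2 h0)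
        (norm_ne_zero_iff.2 (Complex.Gamma_ne_zero_of_re_pos hre))]
    have e : stirlingRem z - stirlingRem (z + (n + 1 : ℕ)) = (stirlingRem z - stirlingRem (z + n))
        + (stirlingMain (z + n + 1) - stirlingMain (z + n) - Real.log ‖z + n‖) := by
      push_cast
      rw [← add_assoc]
      simp only [stirlingRem, hG]; ring
    rw [e]
    exact (abs_add_le _ _).trans (add_le_add ih hstep)

lemma Gamma_mul_prod_range {z : ℂ} (hz : 0 < z.re) (n : ℕ) :
    Complex.Gamma (z + n) = Complex.Gamma z * ∏ j ∈ Finset.range n, (z + j) := by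
  induction n with
  | zero => simp
  | succ n ih =>
    have h0 : z + n ≠ 0 := by
      intro h
      have : 0 < (z + n).re := by simp only [add_re, natCast_re]; positivity
      rw [h] at this; simp at this
    rw [Finset.prod_range_succ, ← mul_assoc, ← ih]
    push_cast
    rw [← add_assoc, Complex.Gamma_add_one _ h0, mul_comm]

lemma tendsto_log_Gamma_add_nat {z : ℂ} (hz : 0 < z.re) :
    Tendsto (fun n : ℕ => Real.log ‖Complex.Gamma (z + (n + 1 : ℕ))‖ - z.re * Real.log n
      - Real.log n.factorial) atTop (nhds 0) := by
  have hG0 := Complex.Gamma_ne_zero_of_re_pos hz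
  have h1 := ((Complex.GammaSeq_tendsto_Gamma z).norm.log (norm_ne_zero_iff.2 hG0))
  have h2 := (tendsto_const_nhds (x := Real.log ‖Complex.Gamma z‖)).sub h1
  rw [sub_self] at h2
  refine h2.congr' ?_
  filter_upwards [eventually_gt_atTop 0] with n hn
  have hn0 : (0 : ℝ) < n := by exact_mod_cast hn
  rw [Gamma_mul_prod_range hz, Complex.GammaSeq]
  have hP : ∏ j ∈ Finset.range (n + 1), (z + j) ≠ 0 := by
    rw [Finset.prod_ne_zero_iff]
    intro j _ h
    have : 0 < (z + j).re := by simp only [add_re, natCast_re]; positivity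
    rw [h] at this; simp at this
  have hc : ‖(n : ℂ) ^ z‖ = (n : ℝ) ^ z.re := by
    rw [Complex.norm_natCast_cpow_of_pos hn]
  rw [norm_mul, norm_div, norm_mul, hc, Real.log_mul (norm_ne_zero_iff.2 hG0) (norm_ne_zero_iff.2 hP),
    Real.log_div (by rw [Complex.norm_natCast]; positivity) (norm_ne_zero_iff.2 hP),
    Real.log_mul (by positivity) (by rw [Complex.norm_natCast]; positivity),
    Real.log_rpow hn0, Complex.norm_natCast]
  ring

lemma tendsto_mul_log_one_add_div (a b : ℂ) :
    Tendsto (fun n : ℕ => (n + a) * Complex.log (1 + b / n)) atTop (nhds b) := by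
  have hb : Tendsto (fun n : ℕ => b / (n : ℂ)) atTop (nhds 0) := by
    simpa [div_eq_mul_inv] using (tendsto_inv_atTop_nhds_zero_nat (𝕜 := ℂ)).const_mul b
  have h1 : Tendsto (fun n : ℕ => (n : ℂ) * Complex.log (1 + b / n)) atTop (nhds b) := by
    have := Complex.tendsto_nat_mul_log_one_add_of_tendsto (g := fun n : ℕ => b / n) (t := b) ?_
    · exact this
    · refine tendsto_const_nhds.congr' ?_
      filter_upwards [eventually_gt_atTop 0] with n hn
      have : (n : ℂ) ≠ 0 := by exact_mod_cast hn.ne'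
      field_simp
  have h2 : Tendsto (fun n : ℕ => a * Complex.log (1 + b / n)) atTop (nhds 0) := by
    have h3 : Tendsto (fun n : ℕ => Complex.log (1 + b / n)) atTop (nhds 0) := by
      have h4 : Tendsto (fun n : ℕ => 1 + b / (n : ℂ)) atTop (nhds 1) := by
        simpa using tendsto_const_nhds.add hb
      have := (continuousAt_clog (x := 1) (by simp)).tendsto.comp h4
      simpa [Function.comp_def] using this
    simpa using h3.const_mul a
  simpa [add_mul] using h1.add h2

lemma tendsto_stirlingRem_add_nat {z : ℂ} (hz : 0 < z.re) :
    Tendsto (fun n : ℕ => stirlingRem (z + (n + 1 : ℕ))) atTop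
      (nhds (Real.log √π + Real.log 2 / 2)) := by
  have hS := Stirling.tendsto_stirlingSeq_sqrt_pi.log (by positivity)
  have hG := tendsto_log_Gamma_add_nat hz
  have hL := (Complex.continuous_re.tendsto _).comp (tendsto_mul_log_one_add_div (z + 1 / 2) (z + 1))
  have h := ((hG.add hS).sub hL).add_const (Real.log 2 / 2 + (z + 1).re)
  have e : (0 + Real.log √π - (z + 1).re + (Real.log 2 / 2 + (z + 1).re)) = Real.log √π + Real.log 2 / 2 := by ring
  rw [e] at h
  refine h.congr' ?_
  filter_upwards [eventually_gt_atTop 0] with n hn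
  have hn0 : (0 : ℝ) < n := by exact_mod_cast hn
  have hnc : (n : ℂ) ≠ 0 := by exact_mod_cast hn.ne'
  have hne : 1 + (z + 1) / (n : ℂ) ≠ 0 := by
    intro h
    have h' : z + 1 + n = 0 := by field_simp at h; linear_combination h
    have : 0 < (z + 1 + n).re := by simp only [add_re, natCast_re, one_re]; positivity
    rw [h'] at this; simp at this
  have hlog : Complex.log (z + (n + 1 : ℕ)) = (Real.log n : ℂ) + Complex.log (1 + (z + 1) / n) := by
    rw [← Complex.log_ofReal_mul hn0 hne]
    congr 1; push_cast; field_simp; ring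
  rw [Stirling.log_stirlingSeq_formula, Real.log_mul (by norm_num) hn0.ne',
    Real.log_div hn0.ne' (Real.exp_pos 1).ne', Real.log_exp]
  simp only [stirlingRem, stirlingMain, hlog, Function.comp]
  have : ((z + (n + 1 : ℕ) - 1 / 2) * ((Real.log n : ℂ) + Complex.log (1 + (z + 1) / n)) - (z + (n + 1 : ℕ))).re
      = (z.re + n + 1 / 2) * Real.log n + (((n : ℂ) + (z + 1 / 2)) * Complex.log (1 + (z + 1) / n)).re
        - (z.re + n + 1) := by
    have : ((z + (n + 1 : ℕ) - 1 / 2) * ((Real.log n : ℂ) + Complex.log (1 + (z + 1) / n)) - (z + (n + 1 : ℕ)))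
      = (z + n + 1 / 2) * (Real.log n : ℂ) + ((n : ℂ) + (z + 1 / 2)) * Complex.log (1 + (z + 1) / n)
        - (z + n + 1) := by push_cast; ring
    rw [this]
    simp only [Complex.sub_re, Complex.add_re, Complex.re_mul_ofReal, Complex.natCast_re, Complex.one_re]
    norm_num
  rw [this]
  simp only [add_re, one_re]
  ring

/-- **Stirling's formula** for `log ‖Γ z‖` in the right half-plane. -/
lemma abs_stirlingRem_sub_const_le {z : ℂ} (hz : 0 < z.re) (hz2 : 2 ≤ ‖z‖) :
    |stirlingRem z - (Real.log √π + Real.log 2 / 2)| ≤ 8 / ‖z‖ := by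
  refine le_of_tendsto (((tendsto_const_nhds (x := stirlingRem z)).sub
    (tendsto_stirlingRem_add_nat hz)).abs) ?_
  exact Eventually.of_forall fun n => abs_stirlingRem_sub_le hz hz2 (n + 1)

/-! ### Bounds for the Riemann zeta function -/

lemma norm_riemannZeta_sub_one_le {s : ℂ} (hs : 2 ≤ s.re) :
    ‖riemannZeta s - 1‖ ≤ 2.7 * (2 : ℝ) ^ (-s.re) := by
  have hs1 : 1 < s.re := by linarith
  have hsum : HasSum (fun n : ℕ => 1 / (n + 1 : ℂ) ^ s) (riemannZeta s) := by
    rw [zeta_eq_tsum_one_div_nat_add_one_cpow hs1]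
    apply Summable.hasSum
    have := (summable_nat_add_iff 1).2 (Complex.summable_one_div_nat_cpow.2 hs1)
    simpa using this
  have h1 : HasSum (fun n : ℕ => 1 / ((n + 2 : ℕ) : ℂ) ^ s) (riemannZeta s - 1) := by
    have := (hasSum_nat_add_iff' 1).2 hsum
    simp only [Finset.range_one, Finset.sum_singleton, Nat.cast_zero, zero_add, one_cpow, div_one] at this
    have e : ∀ n : ℕ, ((n + 2 : ℕ) : ℂ) = ((n + 1 : ℕ) : ℂ) + 1 := fun n => by push_cast; ring
    simp only [e]
    exact this
  have hz2 : HasSum (fun n : ℕ => 4 * (2 : ℝ) ^ (-s.re) * (1 / ((n + 2 : ℕ) : ℝ) ^ 2))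
      (4 * (2 : ℝ) ^ (-s.re) * (π ^ 2 / 6 - 1)) := by
    apply HasSum.mul_left
    have := (hasSum_nat_add_iff' 2).2 hasSum_zeta_two
    simpa [Finset.sum_range_succ] using this
  have hb : ‖riemannZeta s - 1‖ ≤ 4 * (2 : ℝ) ^ (-s.re) * (π ^ 2 / 6 - 1) := by
    rw [← h1.tsum_eq]
    refine tsum_of_norm_bounded hz2 fun n => ?_
    have hp : 0 < n + 2 := by omega
    rw [norm_div, norm_one, Complex.norm_natCast_cpow_of_pos hp]
    have hn2 : (2 : ℝ) ≤ ((n + 2 : ℕ) : ℝ) := by push_cast; linarith [Nat.cast_nonneg (α := ℝ) n]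
    have hpos : (0 : ℝ) < ((n + 2 : ℕ) : ℝ) := by positivity
    have e1 : ((n + 2 : ℕ) : ℝ) ^ s.re = ((n + 2 : ℕ) : ℝ) ^ 2 * ((n + 2 : ℕ) : ℝ) ^ (s.re - 2) := by
      rw [← Real.rpow_natCast, ← Real.rpow_add hpos]; congr 1; push_cast; ring
    have e2 : 4 * (2 : ℝ) ^ (-s.re) = ((2 : ℝ) ^ (s.re - 2))⁻¹ := by
      rw [← Real.rpow_neg (by norm_num), show (4 : ℝ) = 2 ^ (2 : ℝ) by norm_num,
        ← Real.rpow_add (by norm_num)]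
      congr 1; ring
    rw [e1, e2, one_div, mul_inv, mul_comm, one_div]
    gcongr
  refine hb.trans ?_
  have hpi : π ^ 2 / 6 - 1 ≤ 0.66 := by
    have := Real.pi_lt_d2; have := Real.pi_pos
    nlinarith
  have h2 : 0 < (2 : ℝ) ^ (-s.re) := by positivity
  nlinarith

lemma abs_log_norm_riemannZeta_le {s : ℂ} (hs : 2 ≤ s.re) :
    |Real.log ‖riemannZeta s‖| ≤ 10 * (2 : ℝ) ^ (-s.re) := by
  have h := norm_riemannZeta_sub_one_le hs
  set w := ‖riemannZeta s - 1‖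
  have h4 : (2 : ℝ) ^ (-s.re) ≤ 1 / 4 := by
    calc (2 : ℝ) ^ (-s.re) ≤ 2 ^ (-2 : ℝ) := by
          apply Real.rpow_le_rpow_of_exponent_le (by norm_num); linarith
      _ = 1 / 4 := by rw [Real.rpow_neg (by norm_num)]; norm_num
  have hw0 : 0 ≤ w := norm_nonneg _
  have hw : w ≤ 0.7 := by nlinarith
  have hu : ‖riemannZeta s‖ ≤ 1 + w := by
    have := norm_add_le (1 : ℂ) (riemannZeta s - 1)
    simpa using this
  have hl : 1 - w ≤ ‖riemannZeta s‖ := by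
    have := norm_sub_norm_le (1 : ℂ) (1 - riemannZeta s)
    rw [norm_one, sub_sub_cancel, norm_sub_rev] at this
    exact this
  have hpos : 0 < ‖riemannZeta s‖ := by linarith
  rw [abs_le]
  constructor
  · have h1 := Real.one_sub_inv_le_log_of_pos hpos
    have h2 : ‖riemannZeta s‖⁻¹ ≤ (1 - w)⁻¹ := by gcongr; linarith
    have h3 : (1 - w)⁻¹ ≤ 1 + w * 3.4 := by
      rw [inv_le_iff_one_le_mul₀ (by linarith)]
      nlinarith
    nlinarith
  · have := Real.log_le_sub_one_of_pos hpos
    nlinarith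

lemma norm_ofReal_cpow_sub_le {s : ℂ} (hs : 0 < s.re) {a v : ℝ} (ha : 0 < a) (hv : a ≤ v)
    (hv1 : v ≤ a + 1) : ‖(a : ℂ) ^ (-s) - (v : ℂ) ^ (-s)‖ ≤ ‖s‖ * a ^ (-s.re - 1) := by
  have hd : ∀ y ∈ Icc a v, HasDerivWithinAt (fun y : ℝ => (y : ℂ) ^ (-s)) (-s * (y : ℂ) ^ (-s - 1)) (Icc a v) y := by
    intro y hy
    have hs0 : -s ≠ 0 := by intro h; rw [neg_eq_zero] at h; simp [h] at hs
    have := hasDerivAt_ofReal_cpow_const' (x := y) (by linarith [hy.1]) (r := -s - 1) (by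
      intro h; apply hs0; linear_combination h)
    have h2 := (this.const_mul (-s)).hasDerivWithinAt (s := Icc a v)
    refine h2.congr_of_mem (fun z hz => ?_) hy
    have hs1 : s ≠ 0 := by simpa using hs0
    rw [sub_add_cancel]; field_simp
  have := (convex_Icc a v).norm_image_sub_le_of_norm_hasDerivWithin_le (C := ‖s‖ * a ^ (-s.re - 1)) hd ?_
    (right_mem_Icc.2 hv) (left_mem_Icc.2 hv)
  · refine this.trans ?_
    have h1 : ‖a - v‖ ≤ 1 := by rw [Real.norm_eq_abs, abs_le]; constructor <;> linarith
    have h2 : 0 ≤ ‖s‖ * a ^ (-s.re - 1) := by positivity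
    nlinarith
  · intro y hy
    have hy0 : 0 < y := lt_of_lt_of_le ha hy.1
    rw [norm_mul, norm_neg, Complex.norm_cpow_eq_rpow_re_of_pos hy0]
    simp only [sub_re, neg_re, one_re]
    gcongr ‖s‖ * ?_
    exact Real.rpow_le_rpow_of_nonpos ha hy.1 (by linarith)

/-- The difference between the `n`-th term of the zeta series and the corresponding integral. -/
def zetaDiffTerm (n : ℕ) (s : ℂ) : ℂ :=
  1 / (n + 1 : ℂ) ^ s - (((n + 2 : ℝ) : ℂ) ^ (1 - s) - ((n + 1 : ℝ) : ℂ) ^ (1 - s)) / (1 - s)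

lemma norm_zetaDiffTerm_le {s : ℂ} (hs : 0 < s.re) (hs1 : s ≠ 1) (n : ℕ) :
    ‖zetaDiffTerm n s‖ ≤ ‖s‖ * (n + 1 : ℝ) ^ (-s.re - 1) := by
  set a : ℝ := n + 1 with ha
  have ha0 : 0 < a := by positivity
  have h1s : 1 - s ≠ 0 := sub_ne_zero.2 hs1.symm
  have hd : ∀ y ∈ Icc a (a + 1), HasDerivWithinAt
      (fun y : ℝ => (y : ℂ) * (a : ℂ) ^ (-s) - (y : ℂ) ^ (1 - s) / (1 - s))
      ((a : ℂ) ^ (-s) - (y : ℂ) ^ (-s)) (Icc a (a + 1)) y := by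
    intro y hy
    have h := hasDerivAt_ofReal_cpow_const' (x := y) (by linarith [hy.1]) (r := -s) (by
      intro h; apply hs1; linear_combination -h)
    have h2 := ((hasDerivAt_id y).ofReal_comp.mul_const ((a : ℂ) ^ (-s))).fun_sub h
    rw [show (-s + 1) = 1 - s by ring] at h2
    simpa using h2.hasDerivWithinAt
  have := (convex_Icc a (a + 1)).norm_image_sub_le_of_norm_hasDerivWithin_le
    (C := ‖s‖ * a ^ (-s.re - 1)) hd
    (fun y hy => norm_ofReal_cpow_sub_le hs ha0 hy.1 hy.2)
    (left_mem_Icc.2 (by linarith)) (right_mem_Icc.2 (by linarith))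
  rw [add_sub_cancel_left, norm_one, mul_one] at this
  refine le_trans (le_of_eq ?_) this
  congr 1
  rw [zetaDiffTerm, show ((n : ℝ) + 2) = a + 1 by rw [ha]; ring, ← ha,
    show ((n : ℂ) + 1) = (a : ℂ) by rw [ha]; push_cast; rfl, one_div, ← Complex.cpow_neg]
  push_cast
  ring

lemma summable_add_one_rpow {p : ℝ} (hp : p < -1) : Summable (fun n : ℕ => (n + 1 : ℝ) ^ p) := by
  have := (summable_nat_add_iff 1).2 (Real.summable_nat_rpow.2 hp)
  simpa using this

lemma riemannZeta_eq_tsum_zetaDiffTerm_of_one_lt {s : ℂ} (hs : 1 < s.re) :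
    riemannZeta s = 1 / (s - 1) + ∑' n, zetaDiffTerm n s := by
  have hs1 : s ≠ 1 := by rintro rfl; simp at hs
  have h1s : 1 - s ≠ 0 := sub_ne_zero.2 hs1.symm
  have hsum : HasSum (fun n : ℕ => 1 / (n + 1 : ℂ) ^ s) (riemannZeta s) := by
    rw [zeta_eq_tsum_one_div_nat_add_one_cpow hs]
    apply Summable.hasSum
    have := (summable_nat_add_iff 1).2 (Complex.summable_one_div_nat_cpow.2 hs)
    simpa using this
  have hD : Summable (fun n => zetaDiffTerm n s) := by
    refine Summable.of_norm_bounded ((summable_add_one_rpow (p := -s.re - 1) (by linarith)).mul_left ‖s‖)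
      fun n => norm_zetaDiffTerm_le (by linarith) hs1 n
  have hI := hsum.sub hD.hasSum
  have ht := hI.tendsto_sum_nat
  have hpart : ∀ N : ℕ, ∑ n ∈ Finset.range N, (1 / (n + 1 : ℂ) ^ s - zetaDiffTerm n s)
      = ((N + 1 : ℝ) : ℂ) ^ (1 - s) / (1 - s) - 1 / (1 - s) := by
    intro N
    have := Finset.sum_range_sub (fun n : ℕ => ((n + 1 : ℝ) : ℂ) ^ (1 - s) / (1 - s)) N
    simp only [Nat.cast_zero, zero_add, ofReal_one, one_cpow] at this
    rw [← this]
    refine Finset.sum_congr rfl fun n _ => ?_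
    rw [zetaDiffTerm]
    push_cast
    rw [show (n : ℂ) + 1 + 1 = n + 2 by ring]
    ring
  have hz : Tendsto (fun N : ℕ => ((N + 1 : ℝ) : ℂ) ^ (1 - s) / (1 - s) - 1 / (1 - s)) atTop
      (nhds (0 / (1 - s) - 1 / (1 - s))) := by
    refine Tendsto.sub_const (Tendsto.div_const ?_ _) _
    rw [tendsto_zero_iff_norm_tendsto_zero]
    have h2 : Tendsto (fun N : ℕ => ((N + 1 : ℝ)) ^ (-(s.re - 1))) atTop (nhds 0) :=
      (tendsto_rpow_neg_atTop (by linarith)).comp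
        (tendsto_atTop_add_const_right _ _ tendsto_natCast_atTop_atTop)
    refine h2.congr fun N => ?_
    rw [Complex.norm_cpow_eq_rpow_re_of_pos (by positivity)]
    simp
  have := tendsto_nhds_unique ht (hz.congr fun N => (hpart N).symm)
  have e : (1 : ℂ) / (s - 1) = 0 / (1 - s) - 1 / (1 - s) := by
    have : s - 1 ≠ 0 := sub_ne_zero.2 hs1
    field_simp; ring
  rw [e, ← this]; ring

lemma riemannZeta_eq_tsum_zetaDiffTerm {s : ℂ} (hs : 1 / 2 ≤ s.re) (him : 0 < s.im) :
    riemannZeta s = 1 / (s - 1) + ∑' n, zetaDiffTerm n s := by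
  set U : Set ℂ := {z | 1 / 4 < z.re} ∩ {z | 0 < z.im} ∩ Metric.ball 0 (‖s‖ + 4) with hU
  have hUo : IsOpen U := by
    refine ((isOpen_lt continuous_const Complex.continuous_re).inter
      (isOpen_lt continuous_const Complex.continuous_im)).inter Metric.isOpen_ball
  have hUc : IsPreconnected U :=
    (((convex_halfSpace_re_gt _).inter (convex_halfSpace_im_gt _)).inter (convex_ball _ _)).isPreconnected
  have hU1 : ∀ z ∈ U, z ≠ 1 := by
    rintro z ⟨⟨_, hz⟩, _⟩ rfl; simp at hz
  have hf : AnalyticOnNhd ℂ riemannZeta U :=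
    DifferentiableOn.analyticOnNhd (fun z hz =>
      (differentiableAt_riemannZeta (hU1 z hz)).differentiableWithinAt) hUo
  have hg : AnalyticOnNhd ℂ (fun z => 1 / (z - 1) + ∑' n, zetaDiffTerm n z) U := by
    apply DifferentiableOn.analyticOnNhd _ hUo
    refine DifferentiableOn.fun_add (f := fun z : ℂ => 1 / (z - 1))
      (g := fun z => ∑' n, zetaDiffTerm n z) ?_ ?_
    · intro z hz
      have : z - 1 ≠ 0 := sub_ne_zero.2 (hU1 z hz)
      have hd : DifferentiableAt ℂ (fun z : ℂ => z - 1) z := differentiableAt_id.sub_const 1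
      exact ((differentiableAt_const (1 : ℂ)).fun_div hd this).differentiableWithinAt
    · refine differentiableOn_tsum_of_summable_norm (u := fun n : ℕ => (‖s‖ + 4) * (n + 1 : ℝ) ^ (-5/4 : ℝ))
        ((summable_add_one_rpow (by norm_num)).mul_left _) ?_ hUo ?_
      · intro n z hz
        have h1 : 1 - z ≠ 0 := sub_ne_zero.2 (hU1 z hz).symm
        have h2 : (n + 1 : ℂ) ≠ 0 := by exact_mod_cast Nat.succ_ne_zero n
        have h3 : ((n + 2 : ℝ) : ℂ) ≠ 0 := by
          rw [Complex.ofReal_ne_zero]; positivity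
        have h4 : ((n + 1 : ℝ) : ℂ) ≠ 0 := by
          rw [Complex.ofReal_ne_zero]; positivity
        have h5 : (n + 1 : ℂ) ^ z ≠ 0 := by rw [Complex.cpow_ne_zero_iff]; exact Or.inl h2
        refine DifferentiableAt.differentiableWithinAt ?_
        unfold zetaDiffTerm
        refine DifferentiableAt.sub (DifferentiableAt.div (by fun_prop)
          (DifferentiableAt.const_cpow (by fun_prop) (Or.inl h2)) h5)
          (DifferentiableAt.div (DifferentiableAt.sub
          (DifferentiableAt.const_cpow (by fun_prop) (Or.inl h3))
          (DifferentiableAt.const_cpow (by fun_prop) (Or.inl h4))) (by fun_prop) h1)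
      · intro n z hz
        have hre : 1 / 4 < z.re := hz.1.1
        refine (norm_zetaDiffTerm_le (by linarith) (hU1 z hz) n).trans ?_
        have hn : ‖z‖ ≤ ‖s‖ + 4 := by simpa using (Metric.mem_ball.1 hz.2).le
        gcongr
        · have : (0 : ℝ) ≤ n := Nat.cast_nonneg n
          linarith
        · linarith
  have hw : s + 2 ∈ U := by
    refine ⟨⟨?_, ?_⟩, ?_⟩
    · simp; linarith
    · simpa using him
    · have := norm_add_le s 2
      simp only [Metric.mem_ball, dist_zero_right]
      norm_num at this ⊢
      linarith
  have hev : riemannZeta =ᶠ[nhds (s + 2)] (fun z => 1 / (z - 1) + ∑' n, zetaDiffTerm n z) := by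
    have : {z : ℂ | 1 < z.re} ∈ nhds (s + 2) :=
      (isOpen_lt continuous_const Complex.continuous_re).mem_nhds (by simp; linarith)
    filter_upwards [this] with z hz using riemannZeta_eq_tsum_zetaDiffTerm_of_one_lt hz
  refine hf.eqOn_of_preconnected_of_eventuallyEq hg hUc hw hev ⟨⟨?_, him⟩, ?_⟩
  · simp only [mem_ofPred_eq]; linarith
  · simp

lemma exists_norm_riemannZeta_le : ∃ K : ℝ, 1 ≤ K ∧ ∀ s : ℂ, 1 / 2 ≤ s.re → 1 ≤ |s.im| →
    ‖riemannZeta s‖ ≤ K * ‖s‖ := by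
  set S := ∑' n : ℕ, (n + 1 : ℝ) ^ (-3/2 : ℝ)
  have hsm : Summable (fun n : ℕ => (n + 1 : ℝ) ^ (-3/2 : ℝ)) := summable_add_one_rpow (by norm_num)
  have hS : 0 ≤ S := tsum_nonneg fun n => by positivity
  have key : ∀ s : ℂ, 1 / 2 ≤ s.re → 1 ≤ s.im → ‖riemannZeta s‖ ≤ (1 + S) * ‖s‖ := by
    intro s hs him
    have hs1 : s ≠ 1 := by rintro rfl; norm_num at him
    rw [riemannZeta_eq_tsum_zetaDiffTerm hs (by linarith)]
    have hn1 : 1 ≤ ‖s‖ := by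
      have := Complex.abs_im_le_norm s
      rw [abs_of_pos (by linarith)] at this; linarith
    have hn2 : 1 ≤ ‖s - 1‖ := by
      have := Complex.abs_im_le_norm (s - 1)
      simp only [sub_im, one_im, sub_zero] at this
      rw [abs_of_pos (by linarith)] at this; linarith
    refine (norm_add_le _ _).trans ?_
    have h1 : ‖1 / (s - 1)‖ ≤ ‖s‖ := by
      rw [norm_div, norm_one]
      exact ((div_le_one (by linarith)).2 hn2).trans hn1
    have h2 : ‖∑' n, zetaDiffTerm n s‖ ≤ ‖s‖ * S := by
      refine tsum_of_norm_bounded (hsm.hasSum.mul_left ‖s‖) fun n => ?_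
      refine (norm_zetaDiffTerm_le (by linarith) hs1 n).trans ?_
      gcongr
      · have : (0 : ℝ) ≤ n := Nat.cast_nonneg n
        linarith
      · linarith
    nlinarith
  refine ⟨1 + S, by linarith, fun s hs him => ?_⟩
  rcases le_total 0 s.im with h | h
  · rw [abs_of_nonneg h] at him; exact key s hs him
  · rw [abs_of_nonpos h] at him
    have := key (starRingEnd ℂ s) (by simpa using hs) (by simpa using him)
    rwa [riemannZeta_conj, RCLike.norm_conj, RCLike.norm_conj] at this

/-! ### The Riemann xi function and Jensen's formula -/

/-- The entire function `s (s - 1) Λ(s)`, where `Λ` is the completed Riemann zeta function. -/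
def riemannXi (s : ℂ) : ℂ := s * (s - 1) * completedRiemannZeta₀ s + 1

lemma differentiable_riemannXi : Differentiable ℂ riemannXi := by
  have := differentiable_completedZeta₀
  unfold riemannXi
  fun_prop

lemma analyticOnNhd_riemannXi (S : Set ℂ) : AnalyticOnNhd ℂ riemannXi S :=
  fun z _ => differentiable_riemannXi.analyticAt z

lemma riemannXi_one_sub (s : ℂ) : riemannXi (1 - s) = riemannXi s := by
  rw [riemannXi, riemannXi, completedRiemannZeta₀_one_sub]; ring

lemma riemannXi_zero : riemannXi 0 = 1 := by simp [riemannXi]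

lemma riemannXi_eq_of_re_pos {s : ℂ} (hs : 0 < s.re) (hs1 : s ≠ 1) :
    riemannXi s = s * (s - 1) * Gammaℝ s * riemannZeta s := by
  have h0 : s ≠ 0 := by rintro rfl; simp at hs
  have h1 : 1 - s ≠ 0 := sub_ne_zero.2 hs1.symm
  rw [riemannZeta_def_of_ne_zero h0, completedRiemannZeta_eq, riemannXi]
  have := Gammaℝ_ne_zero_of_re_pos hs
  field_simp
  ring

lemma riemannXi_ne_zero_of_one_le_re {s : ℂ} (hs : 1 ≤ s.re) : riemannXi s ≠ 0 := by
  by_cases h1 : s = 1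
  · simp [h1, riemannXi]
  rw [riemannXi_eq_of_re_pos (by linarith) h1]
  have h0 : s ≠ 0 := by rintro rfl; norm_num at hs
  exact mul_ne_zero (mul_ne_zero (mul_ne_zero h0 (sub_ne_zero.2 h1))
    (Gammaℝ_ne_zero_of_re_pos (by linarith))) (riemannZeta_ne_zero_of_one_le_re hs)

lemma riemannXi_eq_zero_iff {s : ℂ} : riemannXi s = 0 ↔ IsNontrivialZero s := by
  constructor
  · intro h
    have h1 : s.re < 1 := by
      by_contra! hc; exact riemannXi_ne_zero_of_one_le_re hc h
    have h0 : 0 < s.re := by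
      by_contra! hc
      refine riemannXi_ne_zero_of_one_le_re (s := 1 - s) (by simpa using hc) ?_
      rw [riemannXi_one_sub, h]
    have hs1 : s ≠ 1 := by rintro rfl; simp at h1
    refine ⟨?_, h0, h1⟩
    rw [riemannXi_eq_of_re_pos h0 hs1] at h
    have hs0 : s ≠ 0 := by rintro rfl; simp at h0
    simpa [hs0, sub_ne_zero.2 hs1, Gammaℝ_ne_zero_of_re_pos h0] using h
  · rintro ⟨h, h0, h1⟩
    rw [riemannXi_eq_of_re_pos h0 (by rintro rfl; simp at h1), h, mul_zero]

lemma analyticOrderAt_riemannXi_ne_top (s : ℂ) : analyticOrderAt riemannXi s ≠ ⊤ := by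
  have h := (analyticOnNhd_riemannXi univ).exists_analyticOrderAt_ne_top_iff_forall isConnected_univ
  refine h.1 ⟨⟨0, mem_univ _⟩, ?_⟩ ⟨s, mem_univ _⟩
  rw [(differentiable_riemannXi.analyticAt _).analyticOrderAt_eq_zero.2
    (by rw [riemannXi_zero]; exact one_ne_zero)]
  simp

lemma analyticOrderAt_riemannXi {s : ℂ} (h0 : 0 < s.re) (h1 : s ≠ 1) :
    analyticOrderAt riemannXi s = analyticOrderAt riemannZeta s := by
  have hev : riemannXi =ᶠ[nhds s] (fun z => z * (z - 1) * Gammaℝ z) * riemannZeta := by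
    have e1 : {z : ℂ | 0 < z.re} ∈ nhds s :=
      (isOpen_lt continuous_const Complex.continuous_re).mem_nhds h0
    filter_upwards [e1, isOpen_ne.mem_nhds h1] with z hz hz1
    exact riemannXi_eq_of_re_pos hz hz1
  have hs0 : s ≠ 0 := by rintro rfl; simp at h0
  have hz : AnalyticAt ℂ riemannZeta s := analyticOn_riemannZeta s h1
  have hg : AnalyticAt ℂ (fun z => z * (z - 1) * Gammaℝ z) s := by
    apply DifferentiableOn.analyticAt (s := {z : ℂ | 0 < z.re})
    · intro z hz
      have : DifferentiableAt ℂ Gammaℝ z := by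
        have := (differentiable_Gammaℝ_inv z).fun_inv (inv_ne_zero (Gammaℝ_ne_zero_of_re_pos hz))
        simpa using this
      exact (DifferentiableAt.fun_mul (by fun_prop) this).differentiableWithinAt
    · exact (isOpen_lt continuous_const Complex.continuous_re).mem_nhds h0
  rw [analyticOrderAt_congr hev, analyticOrderAt_mul hg hz, hg.analyticOrderAt_eq_zero.2, zero_add]
  exact mul_ne_zero (mul_ne_zero hs0 (sub_ne_zero.2 h1)) (Gammaℝ_ne_zero_of_re_pos h0)

lemma natCast_zetaMult_eq {ρ : ℂ} (h0 : 0 < ρ.re) (h1 : ρ ≠ 1) :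
    (zetaMult ρ : ℕ∞) = analyticOrderAt riemannXi ρ := by
  have htop := analyticOrderAt_riemannXi_ne_top ρ
  obtain ⟨k, hk⟩ := ENat.ne_top_iff_exists.1 htop
  have hz : AnalyticAt ℂ riemannZeta ρ := analyticOn_riemannZeta ρ h1
  have hkz : analyticOrderAt riemannZeta ρ = k := by rw [← analyticOrderAt_riemannXi h0 h1, hk]
  have hle : ∀ i < k, iteratedDeriv i riemannZeta ρ = 0 :=
    (natCast_le_analyticOrderAt_iff_iteratedDeriv_eq_zero hz).1 hkz.ge
  have hex : ∃ i < k + 1, iteratedDeriv i riemannZeta ρ ≠ 0 := by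
    by_contra! hc
    have := (natCast_le_analyticOrderAt_iff_iteratedDeriv_eq_zero hz).2 hc
    rw [hkz] at this
    have := Nat.cast_le.1 this
    omega
  rw [← hk, Nat.cast_inj]
  obtain ⟨i, hi, hne⟩ := hex
  apply le_antisymm
  · exact (Nat.sInf_le hne).trans (by omega)
  · have := Nat.sInf_mem (s := {n : ℕ | iteratedDeriv n riemannZeta ρ ≠ 0}) ⟨i, hne⟩
    by_contra! hc
    exact this (hle _ hc)

lemma IsNontrivialZero.ne_one {ρ : ℂ} (h : IsNontrivialZero ρ) : ρ ≠ 1 := by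
  rintro rfl; simpa using h.2.2

lemma IsNontrivialZero.norm_pos {ρ : ℂ} (h : IsNontrivialZero ρ) : 0 < ‖ρ‖ := by
  rw [norm_pos_iff]; rintro rfl; simpa using h.2.1

lemma finite_isNontrivialZero_norm_le (x : ℝ) : {ρ : ℂ | IsNontrivialZero ρ ∧ ‖ρ‖ ≤ x}.Finite := by
  refine ((isCompact_closedBall (0 : ℂ) x).inter_riemannZetaZeros_finite).subset ?_
  rintro ρ ⟨h, hx⟩
  exact ⟨by simpa using hx, h.1⟩

/-- Jensen's weighted count of the nontrivial zeros of the zeta function in a disc. -/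
def zetaZeroLogSum (x : ℝ) : ℝ :=
  ∑' ρ : {ρ : ℂ // IsNontrivialZero ρ}, (zetaMult ρ.1 : ℝ) * max 0 (Real.log x - Real.log ‖ρ.1‖)

lemma zetaZeroLogSum_eq_circleAverage {x : ℝ} (hx : 0 < x) :
    zetaZeroLogSum x = circleAverage (fun z => Real.log ‖riemannXi z‖) 0 x := by
  rw [(analyticOnNhd_riemannXi _).circleAverage_log_norm hx.ne' (by rw [riemannXi_zero]; exact one_ne_zero),
    riemannXi_zero, norm_one, Real.log_one, add_zero, zetaZeroLogSum]
  have h1 := tsum_subtype {ρ : ℂ | IsNontrivialZero ρ}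
    (fun ρ : ℂ => (zetaMult ρ : ℝ) * max 0 (Real.log x - Real.log ‖ρ‖))
  refine h1.trans ?_
  rw [tsum_eq_finsum]
  · refine finsum_congr fun u => ?_
    have hlog : IsNontrivialZero u → Real.log (x * ‖0 - u‖⁻¹) = Real.log x - Real.log ‖u‖ := fun h => by
      rw [zero_sub, norm_neg, Real.log_mul hx.ne' (inv_ne_zero h.norm_pos.ne'), Real.log_inv]; ring
    by_cases hu : u ∈ Metric.closedBall (0 : ℂ) |x|
    · rw [MeromorphicOn.AnalyticOnNhd.divisor_apply (analyticOnNhd_riemannXi _) hu]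
      by_cases hz : IsNontrivialZero u
      · rw [indicator_of_mem (show u ∈ {ρ : ℂ | IsNontrivialZero ρ} from hz), ← natCast_zetaMult_eq hz.2.1 hz.ne_one, hlog hz, max_eq_right]
        · simp
        · rw [sub_nonneg]
          exact Real.log_le_log hz.norm_pos (by simpa [abs_of_pos hx] using hu)
      · rw [indicator_of_notMem (show u ∉ {ρ : ℂ | IsNontrivialZero ρ} from hz), (differentiable_riemannXi.analyticAt _).analyticOrderAt_eq_zero.2
          (fun h => hz (riemannXi_eq_zero_iff.1 h))]
        simp
    · rw [Function.locallyFinsuppWithin.apply_eq_zero_of_notMem _ hu]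
      by_cases hz : IsNontrivialZero u
      · rw [indicator_of_mem (show u ∈ {ρ : ℂ | IsNontrivialZero ρ} from hz), max_eq_left]
        · simp
        · rw [sub_nonpos]
          refine Real.log_le_log hx ?_
          simpa [abs_of_pos hx] using (not_le.1 (by simpa using hu) : |x| < ‖u‖).le
      · rw [indicator_of_notMem (show u ∉ {ρ : ℂ | IsNontrivialZero ρ} from hz)]; simp
  · refine (finite_isNontrivialZero_norm_le x).subset fun u hu => ?_
    rw [Function.mem_support] at hu
    have hz : IsNontrivialZero u := by
      by_contra hz; exact hu (indicator_of_notMem (show u ∉ {ρ : ℂ | IsNontrivialZero ρ} from hz) _)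
    refine ⟨hz, ?_⟩
    rw [indicator_of_mem (show u ∈ {ρ : ℂ | IsNontrivialZero ρ} from hz)] at hu
    by_contra! hc
    apply hu
    rw [max_eq_left, mul_zero]
    rw [sub_nonpos]
    exact Real.log_le_log hx hc.le

/-! ### Asymptotics of the xi function -/

lemma abs_im_mul_arg_sub_le {w : ℂ} (hw : 0 ≤ w.re) :
    |w.im * arg w - π / 2 * (|w.im|)| ≤ π / 2 * w.re := by
  have harg : |arg w| ≤ π / 2 := Complex.abs_arg_le_pi_div_two_iff.2 hw
  have e1 : w.im * arg w = |w.im| * |arg w| := by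
    rw [← abs_mul, abs_of_nonneg]
    rcases le_or_gt 0 w.im with h | h
    · exact mul_nonneg h (Complex.arg_nonneg_iff.2 h)
    · exact mul_nonneg_of_nonpos_of_nonpos h.le (Complex.arg_neg_iff.2 h).le
  have hj := Real.mul_le_sin (x := π / 2 - |arg w|) (by linarith) (by linarith [abs_nonneg (arg w)])
  rw [Real.sin_pi_div_two_sub, Real.cos_abs] at hj
  have hj2 : π / 2 - |arg w| ≤ π / 2 * Real.cos (arg w) := by
    have hpi := Real.pi_pos
    calc π / 2 - |arg w| = π / 2 * (2 / π * (π / 2 - |arg w|)) := by field_simp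
      _ ≤ _ := by gcongr
  have hc : 0 ≤ Real.cos (arg w) := Real.cos_nonneg_of_mem_Icc (abs_le.1 harg)
  have hre : ‖w‖ * Real.cos (arg w) = w.re := Complex.norm_mul_cos_arg w
  have him := Complex.abs_im_le_norm w
  rw [e1, abs_sub_comm, abs_of_nonneg (by nlinarith [abs_nonneg w.im])]
  calc π / 2 * |w.im| - |w.im| * |arg w| = |w.im| * (π / 2 - |arg w|) := by ring
    _ ≤ ‖w‖ * (π / 2 * Real.cos (arg w)) := by gcongr
    _ = π / 2 * w.re := by rw [← hre]; ring

/-- The entire even function `ξ(w) ξ(1 + w)`. -/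
def xiProd (w : ℂ) : ℂ := riemannXi w * riemannXi (1 + w)

lemma differentiable_xiProd : Differentiable ℂ xiProd := by
  have := differentiable_riemannXi
  unfold xiProd
  fun_prop

/-- The main term in the asymptotic expansion of `log ‖ξ(w) ξ(1 + w)‖` to the right. -/
def xiMain (w : ℂ) : ℝ := (w * Complex.log w).re - (1 + Real.log (2 * π)) * w.re
  + 7 / 2 * Real.log ‖w‖ + (Real.log 2 + (Real.log √π + Real.log 2 / 2))

lemma xiProd_eq {w : ℂ} (hw : 0 < w.re) (hw1 : w ≠ 1) :
    xiProd w = w ^ 2 * (w ^ 2 - 1) * (2 * (2 * (π : ℂ)) ^ (-w) * Complex.Gamma w)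
      * riemannZeta w * riemannZeta (1 + w) := by
  have h2 : 1 + w ≠ 1 := by
    intro h; have : w = 0 := by linear_combination h
    simp [this] at hw
  rw [xiProd, riemannXi_eq_of_re_pos hw hw1, riemannXi_eq_of_re_pos (by simp; linarith) h2,
    ← Complex.Gammaℂ_def, ← Complex.Gammaℝ_mul_Gammaℝ_add_one, add_comm 1 w]
  ring

lemma log_norm_xiProd_eq {w : ℂ} (hw : 2 ≤ w.re) :
    Real.log ‖xiProd w‖ = 2 * Real.log ‖w‖ + Real.log ‖w ^ 2 - 1‖ + Real.log 2
      - w.re * Real.log (2 * π) + Real.log ‖Complex.Gamma w‖ + Real.log ‖riemannZeta w‖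
      + Real.log ‖riemannZeta (1 + w)‖ := by
  have hw1 : w ≠ 1 := by rintro rfl; norm_num at hw
  have hw0 : w ≠ 0 := by rintro rfl; norm_num at hw
  have hn : ‖w‖ ≠ 0 := norm_ne_zero_iff.2 hw0
  have hwm : w + 1 ≠ 0 := by
    intro h; have := congrArg Complex.re h; simp at this; linarith
  have h2 : ‖w ^ 2 - 1‖ ≠ 0 := by
    rw [norm_ne_zero_iff, show w ^ 2 - 1 = (w - 1) * (w + 1) by ring]
    exact mul_ne_zero (sub_ne_zero.2 hw1) hwm
  have hG : ‖Complex.Gamma w‖ ≠ 0 := norm_ne_zero_iff.2 (Complex.Gamma_ne_zero_of_re_pos (by linarith))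
  have hz1 : ‖riemannZeta w‖ ≠ 0 := norm_ne_zero_iff.2 (riemannZeta_ne_zero_of_one_le_re (by linarith))
  have hz2 : ‖riemannZeta (1 + w)‖ ≠ 0 :=
    norm_ne_zero_iff.2 (riemannZeta_ne_zero_of_one_le_re (by simp; linarith))
  have hp : ‖(2 * (π : ℂ)) ^ (-w)‖ = (2 * π) ^ (-w.re) := by
    have := Complex.norm_cpow_eq_rpow_re_of_pos (x := 2 * π) (by positivity) (-w)
    rw [← Complex.neg_re, ← this]; push_cast; rfl
  have hp0 : (2 * π) ^ (-w.re) ≠ 0 := by positivity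
  rw [xiProd_eq (by linarith) hw1]
  simp only [norm_mul, norm_pow, hp, Complex.norm_ofNat]
  rw [Real.log_mul (by positivity) hz2, Real.log_mul (by positivity) hz1,
    Real.log_mul (by positivity) (by positivity), Real.log_mul (by positivity) h2,
    Real.log_mul (by positivity) hG, Real.log_mul (by norm_num) hp0, Real.log_pow,
    Real.log_rpow (by positivity)]
  push_cast
  ring

lemma abs_log_norm_one_sub_le {u : ℂ} (hu : ‖u‖ ≤ 1 / 2) : |Real.log ‖1 - u‖| ≤ 2 * ‖u‖ := by
  have h1 : ‖1 - u‖ ≤ 1 + ‖u‖ := by simpa using norm_sub_le (1 : ℂ) u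
  have h2 : 1 - ‖u‖ ≤ ‖1 - u‖ := by simpa using norm_sub_norm_le (1 : ℂ) u
  have h0 := norm_nonneg u
  have hpos : 0 < ‖1 - u‖ := by linarith
  rw [abs_le]
  constructor
  · have h3 := Real.one_sub_inv_le_log_of_pos hpos
    have h4 : ‖1 - u‖⁻¹ ≤ 1 + 2 * ‖u‖ := by
      rw [inv_le_iff_one_le_mul₀ hpos]
      nlinarith
    linarith
  · linarith [Real.log_le_sub_one_of_pos hpos]

lemma abs_log_norm_xiProd_sub_xiMain_le {w : ℂ} (hw : 2 ≤ w.re) :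
    |Real.log ‖xiProd w‖ - xiMain w| ≤ 9 / ‖w‖ + 20 * (2 : ℝ) ^ (-w.re) := by
  have hw0 : w ≠ 0 := by rintro rfl; norm_num at hw
  have hn2 : 2 ≤ ‖w‖ := hw.trans ((le_abs_self _).trans (Complex.abs_re_le_norm w))
  have hn0 : 0 < ‖w‖ := by linarith
  have hst := abs_stirlingRem_sub_const_le (z := w) (by linarith) hn2
  have hz1 := abs_log_norm_riemannZeta_le hw
  have hz2 := abs_log_norm_riemannZeta_le (s := 1 + w) (by simp; linarith)
  have hz3 : (2 : ℝ) ^ (-(1 + w).re) ≤ 2 ^ (-w.re) := by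
    apply Real.rpow_le_rpow_of_exponent_le (by norm_num); simp
  have hu : ‖(w ^ 2)⁻¹‖ ≤ 1 / 2 / ‖w‖ := by
    rw [norm_inv, norm_pow, pow_two, mul_inv, div_eq_mul_inv (1 / 2)]
    gcongr
    rw [inv_le_comm₀ hn0 (by norm_num)]; linarith
  have hu2 : ‖(w ^ 2)⁻¹‖ ≤ 1 / 2 := hu.trans (div_le_self (by norm_num) (by linarith))
  have hq := abs_log_norm_one_sub_le hu2
  have hq2 : Real.log ‖w ^ 2 - 1‖ = 2 * Real.log ‖w‖ + Real.log ‖1 - (w ^ 2)⁻¹‖ := by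
    have hne : ‖1 - (w ^ 2)⁻¹‖ ≠ 0 := by
      have := norm_sub_norm_le (1 : ℂ) (w ^ 2)⁻¹
      rw [norm_one] at this
      have : 0 < ‖1 - (w ^ 2)⁻¹‖ := by linarith
      exact this.ne'
    have : w ^ 2 - 1 = w ^ 2 * (1 - (w ^ 2)⁻¹) := by field_simp
    rw [this, norm_mul, Real.log_mul (norm_ne_zero_iff.2 (pow_ne_zero 2 hw0)) hne, norm_pow, Real.log_pow]
    push_cast; ring
  have hmain : Real.log ‖xiProd w‖ - xiMain w = (stirlingRem w - (Real.log √π + Real.log 2 / 2))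
      + Real.log ‖1 - (w ^ 2)⁻¹‖ + Real.log ‖riemannZeta w‖ + Real.log ‖riemannZeta (1 + w)‖ := by
    rw [log_norm_xiProd_eq hw, hq2, stirlingRem, stirlingMain, xiMain]
    have : ((w - 1 / 2) * Complex.log w - w).re = (w * Complex.log w).re - 1 / 2 * Real.log ‖w‖ - w.re := by
      rw [sub_mul, sub_re, sub_re, ← Complex.log_re w, show (1 / 2 : ℂ) = ((1 / 2 : ℝ) : ℂ) by norm_num,
        re_ofReal_mul]
    rw [this]; ring
  rw [hmain]
  have h9 : 9 / ‖w‖ = 8 / ‖w‖ + 2 * (1 / 2 / ‖w‖) := by ring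
  rw [h9]
  rw [abs_le] at *
  constructor <;> linarith

lemma exists_norm_riemannXi_le : ∃ K : ℝ, 0 ≤ K ∧ ∀ s : ℂ, -9 ≤ s.re → s.re ≤ 10 → 4 ≤ |s.im| →
    ‖riemannXi s‖ ≤ Real.exp (-(π / 4) * |s.im| + K * Real.log |s.im|) := by
  obtain ⟨Z, hZ1, hZ⟩ := exists_norm_riemannZeta_le
  set c := Real.log √π + Real.log 2 / 2 with hc
  set K : ℝ := 16 + |Real.log 2 + Real.log Z + c + 12| with hK
  have key : ∀ s : ℂ, 1 / 2 ≤ s.re → s.re ≤ 10 → 4 ≤ |s.im| →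
      ‖riemannXi s‖ ≤ Real.exp (-(π / 4) * |s.im| + K * Real.log |s.im|) := by
    intro s h1 h2 h3
    have hs1 : s ≠ 1 := by rintro rfl; norm_num at h3
    have hre0 : 0 < (s / 2).re := by simp; linarith
    have hns : 4 ≤ ‖s‖ := h3.trans (Complex.abs_im_le_norm s)
    have hn2 : 2 ≤ ‖s / 2‖ := by rw [norm_div]; norm_num; linarith
    have hlog0 : 1 ≤ Real.log |s.im| := by
      rw [Real.le_log_iff_exp_le (by linarith)]
      linarith [Real.exp_one_lt_d9]
    have hns2 : ‖s‖ ≤ |s.im| * |s.im| := by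
      have := Complex.norm_le_abs_re_add_abs_im s
      rw [abs_of_pos (by linarith : (0 : ℝ) < s.re)] at this
      nlinarith
    have hlogs : Real.log ‖s‖ ≤ 2 * Real.log |s.im| := by
      have := Real.log_le_log (by linarith) hns2
      rw [Real.log_mul (by positivity) (by positivity)] at this
      linarith
    have hst := abs_stirlingRem_sub_const_le hre0 hn2
    have h8 : 8 / ‖s / 2‖ ≤ 4 := by
      rw [div_le_iff₀ (by linarith)]; linarith
    have harg := abs_im_mul_arg_sub_le hre0.le
    have him : (s / 2).im = s.im / 2 := by simp
    have hre : (s / 2).re = s.re / 2 := by simp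
    rw [him, hre, abs_div, abs_two] at harg
    have hmain : stirlingMain (s / 2) ≤ 5 * Real.log ‖s‖ - π / 4 * |s.im| + 8 := by
      rw [stirlingMain, sub_re, mul_re, Complex.log_re, Complex.log_im, sub_re, sub_im, him, hre]
      have e : ((1 : ℂ) / 2).re = 1 / 2 ∧ ((1 : ℂ) / 2).im = 0 := by norm_num
      rw [e.1, e.2, sub_zero]
      have hl : Real.log ‖s / 2‖ ≤ Real.log ‖s‖ := by
        apply Real.log_le_log (by linarith); rw [norm_div]; norm_num
      have hl0 : 0 ≤ Real.log ‖s / 2‖ := Real.log_nonneg (by linarith)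
      have hp1 := Real.pi_lt_d2
      have hpi := Real.pi_pos
      have := (abs_le.1 harg).1
      nlinarith
    have hG0 : Complex.Gamma (s / 2) ≠ 0 := Complex.Gamma_ne_zero_of_re_pos hre0
    have hG : Real.log ‖Complex.Gamma (s / 2)‖ ≤ 5 * Real.log ‖s‖ - π / 4 * |s.im| + c + 12 := by
      have := (abs_le.1 hst).2
      rw [stirlingRem] at this
      linarith
    have hGe : ‖Complex.Gamma (s / 2)‖ ≤ Real.exp (5 * Real.log ‖s‖ - π / 4 * |s.im| + c + 12) := by
      rwa [← Real.log_le_iff_le_exp (norm_pos_iff.2 hG0)]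
    have hpi1 : ‖(π : ℂ) ^ (-s / 2)‖ ≤ 1 := by
      rw [Complex.norm_cpow_eq_rpow_re_of_pos Real.pi_pos]
      apply Real.rpow_le_one_of_one_le_of_nonpos (by linarith [Real.pi_gt_three])
      have : (-s / 2).re = - (s / 2).re := by rw [← Complex.neg_re]; congr 1; ring
      linarith
    have hsm : ‖s - 1‖ ≤ 2 * ‖s‖ := by
      have := norm_sub_le s 1
      rw [norm_one] at this; linarith
    have hexp : Real.exp (Real.log ‖s‖) = ‖s‖ := Real.exp_log (by linarith)
    have hexpZ : Real.exp (Real.log Z) = Z := Real.exp_log (by linarith)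
    rw [riemannXi_eq_of_re_pos (by linarith) hs1, Gammaℝ_def, norm_mul, norm_mul, norm_mul, norm_mul]
    calc ‖s‖ * ‖s - 1‖ * (‖(π : ℂ) ^ (-s / 2)‖ * ‖Complex.Gamma (s / 2)‖) * ‖riemannZeta s‖
        ≤ ‖s‖ * (2 * ‖s‖) * (1 * Real.exp (5 * Real.log ‖s‖ - π / 4 * |s.im| + c + 12)) * (Z * ‖s‖) := by
          gcongr
          exact hZ s h1 (by linarith)
      _ = Real.exp (8 * Real.log ‖s‖ + (Real.log 2 + Real.log Z + c + 12) - π / 4 * |s.im|) := by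
          rw [show 8 * Real.log ‖s‖ + (Real.log 2 + Real.log Z + c + 12) - π / 4 * |s.im|
            = Real.log ‖s‖ + Real.log ‖s‖ + Real.log ‖s‖ + Real.log 2 + Real.log Z +
              (5 * Real.log ‖s‖ - π / 4 * |s.im| + c + 12) by ring,
            Real.exp_add _ (5 * Real.log ‖s‖ - π / 4 * |s.im| + c + 12), Real.exp_add _ (Real.log Z),
            Real.exp_add _ (Real.log 2), Real.exp_add _ (Real.log ‖s‖), Real.exp_add (Real.log ‖s‖), hexp, hexpZ,
            Real.exp_log (by norm_num)]
          ring
      _ ≤ _ := by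
          apply Real.exp_le_exp.2
          have h5 := le_abs_self (Real.log 2 + Real.log Z + c + 12)
          have h6 := abs_nonneg (Real.log 2 + Real.log Z + c + 12)
          rw [hK]
          nlinarith
  refine ⟨K, by positivity, fun s h1 h2 h3 => ?_⟩
  rcases le_total (1 / 2) s.re with h | h
  · exact key s h h2 h3
  · have := key (1 - s) (by simp; linarith) (by simp; linarith) (by simpa using h3)
    simpa [riemannXi_one_sub] using this

lemma exists_norm_xiProd_le : ∃ K : ℝ, 0 ≤ K ∧ ∀ w : ℂ, |w.re| ≤ 9 → 4 ≤ |w.im| →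
    ‖xiProd w‖ ≤ Real.exp (-(π / 2) * |w.im| + K * Real.log |w.im|) := by
  obtain ⟨K, hK0, hK⟩ := exists_norm_riemannXi_le
  refine ⟨2 * K, by positivity, fun w h1 h2 => ?_⟩
  rw [abs_le] at h1
  have e1 := hK w (by linarith) (by linarith) h2
  have e2 := hK (1 + w) (by simp; linarith) (by simp; linarith) (by simpa using h2)
  simp only [add_im, one_im, zero_add] at e2
  rw [xiProd, norm_mul]
  refine (mul_le_mul e1 e2 (norm_nonneg _) (Real.exp_pos _).le).trans ?_
  rw [← Real.exp_add]
  apply Real.exp_le_exp.2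
  linarith

lemma exists_abs_xiMain_le : ∃ K : ℝ, 0 ≤ K ∧ ∀ w : ℂ, 0 ≤ w.re → w.re ≤ 9 → 4 ≤ |w.im| →
    |xiMain w + π / 2 * (|w.im|)| ≤ K * Real.log |w.im| := by
  set c := Real.log 2 + (Real.log √π + Real.log 2 / 2) with hc
  refine ⟨26 + (14.2 + 9 * |1 + Real.log (2 * π)| + |c|), by positivity, fun w h1 h2 h3 => ?_⟩
  have harg := abs_im_mul_arg_sub_le h1
  have hns : 4 ≤ ‖w‖ := h3.trans (Complex.abs_im_le_norm w)
  have hlog0 : 1 ≤ Real.log |w.im| := by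
    rw [Real.le_log_iff_exp_le (by linarith)]
    linarith [Real.exp_one_lt_d9]
  have hns2 : ‖w‖ ≤ |w.im| * |w.im| := by
    have := Complex.norm_le_abs_re_add_abs_im w
    rw [abs_of_nonneg h1] at this
    nlinarith
  have hlogs : Real.log ‖w‖ ≤ 2 * Real.log |w.im| := by
    have := Real.log_le_log (by linarith) hns2
    rw [Real.log_mul (by positivity) (by positivity)] at this
    linarith
  have hlogp : 0 ≤ Real.log ‖w‖ := Real.log_nonneg (by linarith)
  have e : xiMain w + π / 2 * (|w.im|) = w.re * Real.log ‖w‖ - (w.im * arg w - π / 2 * (|w.im|))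
      - (1 + Real.log (2 * π)) * w.re + 7 / 2 * Real.log ‖w‖ + c := by
    rw [xiMain, mul_re, Complex.log_re, Complex.log_im]; ring
  have hpi := Real.pi_lt_d2
  have hpi0 := Real.pi_pos
  have b1 : |w.re * Real.log ‖w‖| ≤ 18 * Real.log |w.im| := by
    rw [abs_of_nonneg (by positivity)]; nlinarith
  have b2 : |(1 + Real.log (2 * π)) * w.re| ≤ 9 * |1 + Real.log (2 * π)| := by
    rw [abs_mul, abs_of_nonneg h1, mul_comm]; gcongr
  have b3 : |7 / 2 * Real.log ‖w‖| ≤ 7 * Real.log |w.im| := by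
    rw [abs_of_nonneg (by positivity)]; linarith
  have b4 : |w.im * arg w - π / 2 * (|w.im|)| ≤ 14.2 := harg.trans (by nlinarith)
  have b5 := neg_abs_le c
  have b6 := le_abs_self c
  have hcs : 14.2 + 9 * |1 + Real.log (2 * π)| + |c| ≤
      (14.2 + 9 * |1 + Real.log (2 * π)| + |c|) * Real.log |w.im| := by
    apply le_mul_of_one_le_right (by positivity) hlog0
  rw [e]
  generalize 9 * |1 + Real.log (2 * π)| = q at *
  generalize |c| = q' at *
  have hb := abs_le.1 b1
  have hb2 := abs_le.1 b2
  have hb3 := abs_le.1 b3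
  have hb4 := abs_le.1 b4
  rw [abs_le]
  constructor <;> linarith

/-! ### Jensen's formula as an integral over a quarter circle -/

lemma countable_isNontrivialZero : {ρ : ℂ | IsNontrivialZero ρ}.Countable := by
  have : {ρ : ℂ | IsNontrivialZero ρ} = ⋃ n : ℕ, {ρ : ℂ | IsNontrivialZero ρ ∧ ‖ρ‖ ≤ n} := by
    ext ρ
    simp only [mem_ofPred_eq, mem_iUnion]
    exact ⟨fun h => (exists_nat_ge ‖ρ‖).imp fun n hn => ⟨h, hn⟩, fun ⟨n, h⟩ => h.1⟩
  rw [this]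
  exact countable_iUnion fun n => (finite_isNontrivialZero_norm_le n).countable

lemma countable_xiProd_eq_zero : {w : ℂ | xiProd w = 0}.Countable := by
  have h1 := countable_isNontrivialZero
  have h2 : {w : ℂ | IsNontrivialZero (1 + w)}.Countable := h1.preimage (add_right_injective 1)
  refine (h1.union h2).mono fun w hw => ?_
  rcases mul_eq_zero.1 hw with h | h
  · exact Or.inl (riemannXi_eq_zero_iff.1 h)
  · exact Or.inr (riemannXi_eq_zero_iff.1 h)

lemma ae_xiProd_circleMap_ne_zero (c : ℂ) {r : ℝ} (hr : r ≠ 0) :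
    ∀ᵐ θ : ℝ, xiProd (circleMap c r θ) ≠ 0 := by
  have := (countable_xiProd_eq_zero.preimage_circleMap c hr).ae_notMem volume
  filter_upwards [this] with θ hθ h using hθ h

lemma intervalIntegrable_log_norm_circleMap {f : ℂ → ℂ} (hf : Differentiable ℂ f) (c : ℂ) (r a b : ℝ) :
    IntervalIntegrable (fun θ => Real.log ‖f (circleMap c r θ)‖) volume a b := by
  have h : CircleIntegrable (fun z => Real.log ‖f z‖) c r :=
    AnalyticOnNhd.meromorphicOn (fun z _ => hf.analyticAt z) |>.circleIntegrable_log_norm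
  have hp : Function.Periodic (fun θ => Real.log ‖f (circleMap c r θ)‖) (2 * π) := fun θ => by
    simp only [periodic_circleMap c r θ]
  refine hp.intervalIntegrable (t := 0) Real.two_pi_pos.ne' ?_ a b
  rw [zero_add]
  exact h

lemma norm_riemannXi_conj {s : ℂ} (hs : 0 < s.re) (hs1 : s ≠ 1) :
    ‖riemannXi (starRingEnd ℂ s)‖ = ‖riemannXi s‖ := by
  have h1 : starRingEnd ℂ s ≠ 1 := by
    intro h; apply hs1; rw [← Complex.conj_conj s, h, map_one]
  rw [riemannXi_eq_of_re_pos (by simpa using hs) h1, riemannXi_eq_of_re_pos hs hs1, riemannZeta_conj,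
    Gammaℝ_def, Gammaℝ_def]
  have e1 : starRingEnd ℂ s / 2 = starRingEnd ℂ (s / 2) := by
    rw [map_div₀, Complex.conj_ofNat]
  have e2 : starRingEnd ℂ s - 1 = starRingEnd ℂ (s - 1) := by simp
  simp only [norm_mul, e1, e2, Complex.Gamma_conj, RCLike.norm_conj,
    Complex.norm_cpow_eq_rpow_re_of_pos Real.pi_pos]
  simp

lemma norm_xiProd_conj {s : ℂ} (hs : 0 < s.re) (hs1 : s ≠ 1) :
    ‖xiProd (starRingEnd ℂ s)‖ = ‖xiProd s‖ := by
  have e : 1 + starRingEnd ℂ s = starRingEnd ℂ (1 + s) := by simp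
  have h2 : 1 + s ≠ 1 := by
    intro h; have : s = 0 := by linear_combination h
    simp [this] at hs
  rw [xiProd, xiProd, norm_mul, norm_mul, e, norm_riemannXi_conj hs hs1,
    norm_riemannXi_conj (by simp; linarith) h2]

lemma zetaZeroLogSum_eq_integral {r : ℝ} (hr : 1 < r) :
    π * zetaZeroLogSum r = ∫ θ in (0 : ℝ)..(π / 2), Real.log ‖xiProd (circleMap 0 r θ)‖ := by
  have hr0 : 0 < r := by linarith
  set a : ℝ → ℝ := fun θ => Real.log ‖riemannXi (circleMap 0 r θ)‖ with ha
  have hai : ∀ u v, IntervalIntegrable a volume u v :=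
    intervalIntegrable_log_norm_circleMap differentiable_riemannXi 0 r
  have hper : Function.Periodic a (2 * π) := fun θ => by
    simp only [ha, periodic_circleMap (0 : ℂ) r θ]
  set f : ℝ → ℝ := fun θ => Real.log ‖xiProd (circleMap 0 r θ)‖ with hf
  have hfi : ∀ u v, IntervalIntegrable f volume u v :=
    intervalIntegrable_log_norm_circleMap differentiable_xiProd 0 r
  have h1 : 2 * π * zetaZeroLogSum r = ∫ θ in (0 : ℝ)..(2 * π), a θ := by
    rw [zetaZeroLogSum_eq_circleAverage hr0, circleAverage_def, smul_eq_mul]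
    have := Real.two_pi_pos.ne'
    field_simp
    rfl
  have h2 : ∫ θ in (0 : ℝ)..(2 * π), a θ = ∫ θ in (-(π / 2))..(-(π / 2) + 2 * π), a θ := by
    have := hper.intervalIntegral_add_eq 0 (-(π / 2))
    rwa [zero_add] at this
  have hneg : ∀ θ, a (θ + π) = Real.log ‖riemannXi (1 + circleMap 0 r θ)‖ := by
    intro θ
    have : circleMap 0 r (θ + π) = 1 - (1 + circleMap 0 r θ) := by
      simp [circleMap, add_mul, Complex.exp_add]
    rw [ha]
    simp only [this, riemannXi_one_sub]
  have h3 : ∫ θ in (-(π / 2))..(-(π / 2) + 2 * π), a θ = ∫ θ in (-(π / 2))..(π / 2), f θ := by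
    rw [← intervalIntegral.integral_add_adjacent_intervals (hai _ (π / 2)) (hai _ _)]
    have e1 : ∫ θ in (π / 2)..(-(π / 2) + 2 * π), a θ = ∫ θ in (-(π / 2))..(π / 2), a (θ + π) := by
      rw [intervalIntegral.integral_comp_add_right]
      congr 1 <;> ring
    have hInt : IntervalIntegrable (fun θ => a (θ + π)) volume (-(π / 2)) (π / 2) := by
      have := (hai (-(π / 2) + π) (π / 2 + π)).comp_add_right π
      simpa using this
    rw [e1, ← intervalIntegral.integral_add (hai _ _) hInt]
    refine intervalIntegral.integral_congr_ae ?_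
    filter_upwards [ae_xiProd_circleMap_ne_zero 0 hr0.ne'] with θ hθ _
    rw [hneg, ha, hf]
    simp only [xiProd, norm_mul]
    rw [Real.log_mul (norm_ne_zero_iff.2 (left_ne_zero_of_mul hθ))
      (norm_ne_zero_iff.2 (right_ne_zero_of_mul hθ))]
  have hev : ∫ θ in (-(π / 2))..0, f θ = ∫ θ in (0 : ℝ)..(π / 2), f θ := by
    have := intervalIntegral.integral_comp_neg (a := 0) (b := π / 2) f
    rw [neg_zero] at this
    rw [← this]
    have hle : (0 : ℝ) ≤ π / 2 := by positivity
    refine intervalIntegral.integral_congr_ae ?_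
    have hne : ∀ᵐ θ : ℝ, θ ≠ π / 2 := by simp [ae_iff]
    filter_upwards [hne] with θ hne hθ
    rw [uIoc_of_le hle] at hθ
    have hlt : θ < π / 2 := lt_of_le_of_ne hθ.2 hne
    have hc : 0 < Real.cos θ := Real.cos_pos_of_mem_Ioo ⟨by linarith [hθ.1], hlt⟩
    have e : circleMap 0 r (-θ) = starRingEnd ℂ (circleMap 0 r θ) := by
      apply Complex.ext <;> simp [circleMap_zero_re, circleMap_zero_im]
    rw [hf]
    simp only [e]
    rw [norm_xiProd_conj]
    · rw [circleMap_zero_re]; positivity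
    · intro h
      have := congrArg norm h
      rw [norm_circleMap_zero, norm_one, abs_of_pos hr0] at this
      linarith
  have h4 : ∫ θ in (-(π / 2))..(π / 2), f θ = 2 * ∫ θ in (0 : ℝ)..(π / 2), f θ := by
    rw [← intervalIntegral.integral_add_adjacent_intervals (hfi _ 0) (hfi _ _), hev]; ring
  have := h1.trans (h2.trans (h3.trans h4))
  linarith

/-! ### Upper bound in the asymptotic formula for Jensen's sum -/

/-- The constant term of `xiMain`. -/
def xiMainConst : ℝ := Real.log 2 + (Real.log √π + Real.log 2 / 2)

/-- The main term in the asymptotic expansion of `zetaZeroLogSum`. -/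
def zetaZeroLogMain (x : ℝ) : ℝ := (1 / π) * (x * Real.log x) - ((2 + Real.log (2 * π)) / π) * x
  + 7 / 4 * Real.log x + xiMainConst / 2

lemma xiMain_circleMap {r : ℝ} (hr : 0 < r) {θ : ℝ} (hθ : θ ∈ Icc 0 (π / 2)) :
    xiMain (circleMap 0 r θ) = r * Real.log r * Real.cos θ - r * (θ * Real.sin θ)
      - (1 + Real.log (2 * π)) * r * Real.cos θ + (7 / 2 * Real.log r + xiMainConst) := by
  have hpi := Real.pi_pos
  have hlog : Complex.log (circleMap 0 r θ) = Real.log r + θ * I := by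
    rw [circleMap, zero_add, Complex.log_ofReal_mul hr (Complex.exp_ne_zero _), Complex.log_exp]
    · simp; linarith [hθ.1]
    · simp; linarith [hθ.2]
  rw [xiMain, hlog, mul_re, circleMap_zero_re, circleMap_zero_im, norm_circleMap_zero, abs_of_pos hr,
    xiMainConst]
  simp
  ring

lemma continuousOn_xiMain_circleMap {r : ℝ} (hr : 0 < r) :
    ContinuousOn (fun θ => xiMain (circleMap 0 r θ)) (Icc 0 (π / 2)) := by
  refine ContinuousOn.congr (f := fun θ => r * Real.log r * Real.cos θ - r * (θ * Real.sin θ)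
      - (1 + Real.log (2 * π)) * r * Real.cos θ + (7 / 2 * Real.log r + xiMainConst)) ?_
    fun θ hθ => xiMain_circleMap hr hθ
  fun_prop

lemma intervalIntegrable_xiMain {r : ℝ} (hr : 0 < r) :
    IntervalIntegrable (fun θ => xiMain (circleMap 0 r θ)) volume 0 (π / 2) := by
  apply ContinuousOn.intervalIntegrable
  rw [uIcc_of_le (by positivity)]
  exact continuousOn_xiMain_circleMap hr

lemma integral_xiMain {r : ℝ} (hr : 0 < r) :
    ∫ θ in (0 : ℝ)..(π / 2), xiMain (circleMap 0 r θ) = π * zetaZeroLogMain r := by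
  have hpi := Real.pi_pos
  have hle : (0 : ℝ) ≤ π / 2 := by positivity
  set F : ℝ → ℝ := fun θ => r * Real.log r * Real.sin θ - r * (Real.sin θ - θ * Real.cos θ)
    - (1 + Real.log (2 * π)) * r * Real.sin θ + (7 / 2 * Real.log r + xiMainConst) * θ with hF
  have hd : ∀ θ ∈ uIcc 0 (π / 2), HasDerivAt F (xiMain (circleMap 0 r θ)) θ := by
    intro θ hθ
    rw [uIcc_of_le hle] at hθ
    rw [xiMain_circleMap hr hθ]
    have h1 := Real.hasDerivAt_sin θ
    have h2 := Real.hasDerivAt_cos θ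
    have h3 := hasDerivAt_id θ
    have := (((h1.const_mul (r * Real.log r)).sub ((h1.sub (h3.mul h2)).const_mul r)).sub
      (h1.const_mul ((1 + Real.log (2 * π)) * r))).add (h3.const_mul (7 / 2 * Real.log r + xiMainConst))
    refine this.congr_deriv ?_
    simp only [id]
    ring
  rw [intervalIntegral.integral_eq_sub_of_hasDerivAt hd (intervalIntegrable_xiMain hr), hF, zetaZeroLogMain]
  simp
  field_simp
  ring

lemma integral_two_rpow_neg_cos_le {r : ℝ} (hr : 0 < r) :
    ∫ θ in (0 : ℝ)..(π / 2), (2 : ℝ) ^ (-(r * Real.cos θ)) ≤ 3 / r := by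
  have hpi := Real.pi_pos
  have hle : (0 : ℝ) ≤ π / 2 := by positivity
  have hl2 := Real.log_two_gt_d9
  set k : ℝ := 2 * Real.log 2 * r / π with hk
  have hk0 : 0 < k := by positivity
  have hInt : ∫ θ in (0 : ℝ)..(π / 2), Real.exp (-(Real.log 2 * r) + k * θ) ≤ 1 / k := by
    have hd : ∀ θ ∈ uIcc 0 (π / 2), HasDerivAt (fun θ => Real.exp (-(Real.log 2 * r) + k * θ) / k)
        (Real.exp (-(Real.log 2 * r) + k * θ)) θ := by
      intro θ _
      have h1 := ((((hasDerivAt_id θ).const_mul k).const_add (-(Real.log 2 * r))).exp).div_const k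
      refine h1.congr_deriv ?_
      simp only [id]
      field_simp
    rw [intervalIntegral.integral_eq_sub_of_hasDerivAt hd (by
      apply Continuous.intervalIntegrable; fun_prop)]
    have e1 : -(Real.log 2 * r) + k * (π / 2) = 0 := by rw [hk]; field_simp; ring
    rw [e1, Real.exp_zero]
    have : 0 ≤ Real.exp (-(Real.log 2 * r) + k * 0) / k := by positivity
    linarith
  have hmono : ∫ θ in (0 : ℝ)..(π / 2), (2 : ℝ) ^ (-(r * Real.cos θ)) ≤
      ∫ θ in (0 : ℝ)..(π / 2), Real.exp (-(Real.log 2 * r) + k * θ) := by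
    refine intervalIntegral.integral_mono_on hle (by
      apply Continuous.intervalIntegrable
      exact Continuous.rpow (by fun_prop) (by fun_prop) (fun _ => Or.inl (by norm_num))) (by
      apply Continuous.intervalIntegrable; fun_prop) fun θ hθ => ?_
    rw [Real.rpow_def_of_pos (by norm_num)]
    apply Real.exp_le_exp.2
    have hj := Real.mul_le_sin (x := π / 2 - θ) (by linarith [hθ.2]) (by linarith [hθ.1])
    rw [Real.sin_pi_div_two_sub] at hj
    have e : -(Real.log 2 * r) + k * θ = Real.log 2 * (-(r * (2 / π * (π / 2 - θ)))) := by
      rw [hk]; field_simp; ring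
    rw [e]
    gcongr
  refine hmono.trans (hInt.trans ?_)
  rw [hk, one_div_div, div_le_div_iff₀ (by positivity) hr]
  have := Real.pi_lt_d2
  nlinarith

lemma norm_sub_two_le_abs_im {w : ℂ} (h0 : 0 ≤ w.re) (h2 : w.re < 2) :
    ‖w‖ - 2 ≤ |w.im| := by
  have h := Complex.norm_le_abs_re_add_abs_im w
  rw [abs_of_nonneg h0] at h
  linarith

lemma exists_log_norm_xiProd_sub_xiMain_le : ∃ K : ℝ, 0 ≤ K ∧ ∀ w : ℂ, 10 ≤ ‖w‖ → 0 ≤ w.re →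
    xiProd w ≠ 0 → Real.log ‖xiProd w‖ - xiMain w ≤
      K / ‖w‖ + K * (Real.log ‖w‖ * (2 : ℝ) ^ (-w.re)) := by
  obtain ⟨K1, hK1, h1⟩ := exists_norm_xiProd_le
  obtain ⟨K2, hK2, h2⟩ := exists_abs_xiMain_le
  refine ⟨20 + 4 * (K1 + K2), by positivity, fun w hn h0 hne => ?_⟩
  have hlog : 1 ≤ Real.log ‖w‖ := by
    rw [Real.le_log_iff_exp_le (by linarith)]
    linarith [Real.exp_one_lt_d9]
  have hp : 0 < (2 : ℝ) ^ (-w.re) := by positivity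
  rcases le_or_gt 2 w.re with hre | hre
  · have h := (abs_le.1 (abs_log_norm_xiProd_sub_xiMain_le hre)).2
    have e1 : 9 / ‖w‖ ≤ (20 + 4 * (K1 + K2)) / ‖w‖ := by gcongr; linarith
    have e2 : (2 : ℝ) ^ (-w.re) ≤ Real.log ‖w‖ * 2 ^ (-w.re) := le_mul_of_one_le_left hp.le hlog
    nlinarith
  · have him := norm_sub_two_le_abs_im h0 hre
    have a1 := h1 w (by rw [abs_of_nonneg h0]; linarith) (by linarith)
    have a2 := (abs_le.1 (h2 w h0 (by linarith) (by linarith))).1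
    rw [← Real.log_le_iff_le_exp (norm_pos_iff.2 hne)] at a1
    have hl : Real.log |w.im| ≤ Real.log ‖w‖ :=
      Real.log_le_log (by linarith) (Complex.abs_im_le_norm w)
    have hq : 1 / 4 ≤ (2 : ℝ) ^ (-w.re) := by
      calc (1 / 4 : ℝ) = 2 ^ (-2 : ℝ) := by rw [Real.rpow_neg (by norm_num)]; norm_num
        _ ≤ _ := by apply Real.rpow_le_rpow_of_exponent_le (by norm_num); linarith
    have e0 : 0 ≤ (20 + 4 * (K1 + K2)) / ‖w‖ := by positivity
    have e3 : Real.log ‖w‖ ≤ 4 * (Real.log ‖w‖ * 2 ^ (-w.re)) := by nlinarith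
    calc Real.log ‖xiProd w‖ - xiMain w ≤ (K1 + K2) * Real.log |w.im| := by linarith
      _ ≤ (K1 + K2) * (4 * (Real.log ‖w‖ * 2 ^ (-w.re))) := by gcongr; exact hl.trans e3
      _ ≤ _ := by
        have : 0 ≤ Real.log ‖w‖ * 2 ^ (-w.re) := by positivity
        nlinarith

lemma intervalIntegrable_two_rpow_neg_cos (r a b : ℝ) :
    IntervalIntegrable (fun θ => (2 : ℝ) ^ (-(r * Real.cos θ))) volume a b := by
  apply Continuous.intervalIntegrable
  exact Continuous.rpow (by fun_prop) (by fun_prop) (fun _ => Or.inl (by norm_num))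

lemma integral_error_le {K r : ℝ} (hK : 0 ≤ K) (hr : 10 ≤ r) :
    ∫ θ in (0 : ℝ)..(π / 2), (K / r + K * (Real.log r * (2 : ℝ) ^ (-(r * Real.cos θ))))
      ≤ 5 * K * (Real.log r / r) := by
  have hlog : 1 ≤ Real.log r := by
    rw [Real.le_log_iff_exp_le (by linarith)]
    linarith [Real.exp_one_lt_d9]
  rw [intervalIntegral.integral_add (by simp)
    (((intervalIntegrable_two_rpow_neg_cos r 0 (π / 2)).const_mul _).const_mul _),
    intervalIntegral.integral_const_mul, intervalIntegral.integral_const_mul,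
    intervalIntegral.integral_const, smul_eq_mul, sub_zero]
  have h := integral_two_rpow_neg_cos_le (r := r) (by linarith)
  have e1 : K * (Real.log r * ∫ θ in (0 : ℝ)..(π / 2), (2 : ℝ) ^ (-(r * Real.cos θ)))
      ≤ K * (Real.log r * (3 / r)) := by gcongr
  have e2 : π / 2 * (K / r) ≤ 2 * (K * Real.log r / r) := by
    have := Real.pi_lt_d2
    have h1 : K / r ≤ K * Real.log r / r := by gcongr; exact le_mul_of_one_le_right hK hlog
    have h0 : 0 ≤ K / r := by apply div_nonneg hK; linarith
    nlinarith
  calc _ ≤ 2 * (K * Real.log r / r) + K * (Real.log r * (3 / r)) := add_le_add e2 e1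
    _ = _ := by ring

lemma exists_zetaZeroLogSum_le : ∃ K : ℝ, 0 ≤ K ∧ ∀ x : ℝ, 10 ≤ x →
    zetaZeroLogSum x ≤ zetaZeroLogMain x + K * (Real.log x / x) := by
  obtain ⟨K, hK, h⟩ := exists_log_norm_xiProd_sub_xiMain_le
  have hpi := Real.pi_pos
  refine ⟨5 * K / π, by positivity, fun x hx => ?_⟩
  have hx0 : 0 < x := by linarith
  have hle : (0 : ℝ) ≤ π / 2 := by positivity
  have hi1 := intervalIntegrable_log_norm_circleMap differentiable_xiProd 0 x 0 (π / 2)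
  have hi2 := intervalIntegrable_xiMain hx0
  have hi3 : IntervalIntegrable (fun θ => K / x + K * (Real.log x * (2 : ℝ) ^ (-(x * Real.cos θ))))
      volume 0 (π / 2) := IntervalIntegrable.add (by simp)
    (((intervalIntegrable_two_rpow_neg_cos x 0 (π / 2)).const_mul _).const_mul _)
  have hmono := intervalIntegral.integral_mono_ae_restrict hle (hi1.sub hi2) hi3 (by
    filter_upwards [ae_restrict_of_ae (ae_xiProd_circleMap_ne_zero 0 hx0.ne'),
      ae_restrict_mem measurableSet_Icc] with θ hne hθ
    have := h (circleMap 0 x θ) (by rw [norm_circleMap_zero, abs_of_pos hx0]; exact hx) (by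
      rw [circleMap_zero_re]
      exact mul_nonneg hx0.le (Real.cos_nonneg_of_mem_Icc ⟨by linarith [hθ.1], hθ.2⟩)) hne
    rwa [norm_circleMap_zero, abs_of_pos hx0, circleMap_zero_re] at this)
  rw [intervalIntegral.integral_sub hi1 hi2, ← zetaZeroLogSum_eq_integral (by linarith),
    integral_xiMain hx0] at hmono
  have := hmono.trans (integral_error_le hK hx)
  have e : π * (zetaZeroLogSum x - zetaZeroLogMain x) ≤ π * (5 * K / π * (Real.log x / x)) := by
    calc _ = π * zetaZeroLogSum x - π * zetaZeroLogMain x := by ring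
      _ ≤ _ := this
      _ = _ := by field_simp
  have := le_of_mul_le_mul_left e hpi
  linarith

/-! ### Lower bound in the asymptotic formula for Jensen's sum -/

lemma log_norm_le_circleAverage {f : ℂ → ℂ} (hf : Differentiable ℂ f) {c : ℂ} (hc : f c ≠ 0) {r : ℝ}
    (hr : 0 < r) : Real.log ‖f c‖ ≤ circleAverage (fun z => Real.log ‖f z‖) c r := by
  have hA : AnalyticOnNhd ℂ f (Metric.closedBall c |r|) := fun z _ => hf.analyticAt z
  rw [hA.circleAverage_log_norm hr.ne' hc]
  have : 0 ≤ ∑ᶠ u, (MeromorphicOn.divisor f (Metric.closedBall c |r|) u : ℝ)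
      * Real.log (r * ‖c - u‖⁻¹) := by
    refine finsum_nonneg fun u => ?_
    by_cases hu : u ∈ Metric.closedBall c |r|
    · apply mul_nonneg
      · exact_mod_cast MeromorphicOn.AnalyticOnNhd.divisor_nonneg hA u
      · rcases eq_or_ne u c with rfl | hne
        · simp
        · apply Real.log_nonneg
          have h0 : 0 < ‖c - u‖ := norm_pos_iff.2 (sub_ne_zero.2 hne.symm)
          rw [← div_eq_mul_inv, le_div_iff₀ h0, one_mul]
          rwa [mem_closedBall_iff_norm', abs_of_pos hr] at hu
    · rw [Function.locallyFinsuppWithin.apply_eq_zero_of_notMem _ hu]; simp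
  linarith

lemma lintegral_circleMap_le {Q r : ℝ} {c : ℂ} (hc : xiProd c ≠ 0) (hr : 0 < r)
    (hQ : ∀ θ, ‖xiProd (circleMap c r θ)‖ ≤ Real.exp Q) :
    ∫⁻ θ in Ioo (-π) π, ENNReal.ofReal (Q - Real.log ‖xiProd (circleMap c r θ)‖)
      ≤ ENNReal.ofReal (2 * π * (Q - Real.log ‖xiProd c‖)) := by
  have hpi := Real.pi_pos
  have hle : -π ≤ π := by linarith
  have hi := intervalIntegrable_log_norm_circleMap differentiable_xiProd c r (-π) π
  have hi2 : IntervalIntegrable (fun θ => Q - Real.log ‖xiProd (circleMap c r θ)‖) volume (-π) π :=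
    IntervalIntegrable.sub (by simp) hi
  have hi3 := (intervalIntegrable_iff_integrableOn_Ioo_of_le hle).1 hi2
  rw [← ofReal_integral_eq_lintegral_ofReal hi3]
  · apply ENNReal.ofReal_le_ofReal
    rw [← integral_Ioc_eq_integral_Ioo, ← intervalIntegral.integral_of_le hle,
      intervalIntegral.integral_sub (by simp) hi, intervalIntegral.integral_const, smul_eq_mul]
    have h1 := log_norm_le_circleAverage differentiable_xiProd hc hr
    rw [circleAverage_def, smul_eq_mul] at h1
    have hp : Function.Periodic (fun θ => Real.log ‖xiProd (circleMap c r θ)‖) (2 * π) := fun θ => by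
      simp only [periodic_circleMap c r θ]
    have h2 := hp.intervalIntegral_add_eq 0 (-π)
    rw [zero_add, show -π + 2 * π = π by ring] at h2
    rw [h2, ← div_eq_inv_mul, le_div_iff₀ (by positivity)] at h1
    linarith
  · filter_upwards [ae_restrict_of_ae (ae_xiProd_circleMap_ne_zero c hr.ne')] with θ hθ
    have := (Real.log_le_iff_le_exp (norm_pos_iff.2 hθ)).2 (hQ θ)
    simpa using this

lemma measurable_log_norm_xiProd : Measurable (fun z => Real.log ‖xiProd z‖) :=
  Real.measurable_log.comp differentiable_xiProd.continuous.norm.measurable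

lemma complex_lintegral_eq_polar {f : ℂ → ENNReal} (hf : Measurable f) (c : ℂ) :
    ∫⁻ z, f z = ∫⁻ r in Ioi (0 : ℝ), ∫⁻ θ in Ioo (-π) π,
      ENNReal.ofReal r * f (circleMap c r θ) := by
  have hcm : ∀ p : ℝ × ℝ, c + Complex.polarCoord.symm p = circleMap c p.1 p.2 := by
    intro p
    rw [Complex.polarCoord_symm_apply, circleMap, Complex.exp_mul_I]
    simp
  rw [← lintegral_add_left_eq_self f c, ← Complex.lintegral_comp_polarCoord_symm, polarCoord_target,
    Measure.volume_eq_prod, ← Measure.prod_restrict]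
  simp only [hcm, smul_eq_mul]
  rw [lintegral_prod]
  have hm : Measurable (fun p : ℝ × ℝ => circleMap c p.1 p.2) := by
    unfold circleMap; fun_prop
  exact (Measurable.mul (by fun_prop) (hf.comp hm)).aemeasurable

lemma lintegral_ball_le {Q R : ℝ} {c : ℂ} (hc : xiProd c ≠ 0) (hR : 0 < R)
    (hQ : ∀ z ∈ Metric.ball c R, ‖xiProd z‖ ≤ Real.exp Q) :
    ∫⁻ z, (Metric.ball c R).indicator (fun z => ENNReal.ofReal (Q - Real.log ‖xiProd z‖)) z
      ≤ ENNReal.ofReal (R * (R * (2 * π * (Q - Real.log ‖xiProd c‖)))) := by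
  have hm : Measurable (fun z => ENNReal.ofReal (Q - Real.log ‖xiProd z‖)) :=
    (measurable_const.sub measurable_log_norm_xiProd).ennreal_ofReal
  rw [complex_lintegral_eq_polar (hm.indicator Metric.isOpen_ball.measurableSet) c]
  have hb : ∀ r ∈ Ioi (0 : ℝ), ∫⁻ θ in Ioo (-π) π, ENNReal.ofReal r *
      (Metric.ball c R).indicator (fun z => ENNReal.ofReal (Q - Real.log ‖xiProd z‖)) (circleMap c r θ)
      ≤ (Ioo 0 R).indicator
        (fun _ => ENNReal.ofReal (R * (2 * π * (Q - Real.log ‖xiProd c‖)))) r := by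
    intro r hr
    have hr0 : 0 < r := hr
    by_cases hrR : r < R
    · rw [indicator_of_mem (show r ∈ Ioo 0 R from ⟨hr, hrR⟩)]
      have hmem : ∀ θ, circleMap c r θ ∈ Metric.ball c R := fun θ => by
        rw [Metric.mem_ball, dist_eq_norm, circleMap_sub_center, norm_circleMap_zero, abs_of_pos hr0]
        exact hrR
      simp only [indicator_of_mem (hmem _)]
      rw [lintegral_const_mul', ENNReal.ofReal_mul hR.le]
      · gcongr
        exact lintegral_circleMap_le hc hr0 fun θ => hQ _ (hmem θ)
      · exact ENNReal.ofReal_ne_top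
    · have hmem : ∀ θ, circleMap c r θ ∉ Metric.ball c R := fun θ => by
        rw [Metric.mem_ball, dist_eq_norm, circleMap_sub_center, norm_circleMap_zero, abs_of_pos hr0]
        exact hrR
      simp only [indicator_of_notMem (hmem _), mul_zero, lintegral_zero]
      exact zero_le
  calc _ ≤ ∫⁻ r in Ioi (0 : ℝ), (Ioo 0 R).indicator
        (fun _ => ENNReal.ofReal (R * (2 * π * (Q - Real.log ‖xiProd c‖)))) r :=
        setLIntegral_mono' measurableSet_Ioi hb
    _ ≤ ∫⁻ r, (Ioo 0 R).indicator
        (fun _ => ENNReal.ofReal (R * (2 * π * (Q - Real.log ‖xiProd c‖)))) r :=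
        setLIntegral_le_lintegral _ _
    _ = _ := by
        rw [lintegral_indicator measurableSet_Ioo, setLIntegral_const, Real.volume_Ioo, sub_zero,
          mul_comm, ← ENNReal.ofReal_mul hR.le]

/-- The contribution of the part of the circle of radius `r` in the strip `Re z < 2`. -/
def stripLIntegral (Q r : ℝ) : ENNReal :=
  ∫⁻ θ in Ioo 0 (π / 2), {z : ℂ | z.re < 2}.indicator
    (fun z => ENNReal.ofReal (Q - Real.log ‖xiProd z‖)) (circleMap 0 r θ)

lemma measurable_strip_integrand (Q : ℝ) : Measurable ({z : ℂ | z.re < 2}.indicator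
    (fun z => ENNReal.ofReal (Q - Real.log ‖xiProd z‖))) := by
  refine Measurable.indicator ?_ (measurableSet_lt Complex.measurable_re measurable_const)
  exact (measurable_const.sub measurable_log_norm_xiProd).ennreal_ofReal

lemma measurable_stripLIntegral (Q : ℝ) : Measurable (stripLIntegral Q) := by
  unfold stripLIntegral
  have hm : Measurable (fun p : ℝ × ℝ => circleMap 0 p.1 p.2) := by
    unfold circleMap; fun_prop
  exact Measurable.lintegral_prod_right' (f := fun p : ℝ × ℝ => {z : ℂ | z.re < 2}.indicator
    (fun z => ENNReal.ofReal (Q - Real.log ‖xiProd z‖)) (circleMap 0 p.1 p.2))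
    ((measurable_strip_integrand Q).comp hm)

lemma circleMap_mem_ball {x r θ : ℝ} (hx : 10 ≤ x) (hr : r ∈ Ioo x (x + 1)) (hθ : θ ∈ Ioo 0 (π / 2))
    (h2 : (circleMap 0 r θ).re < 2) : circleMap 0 r θ ∈ Metric.ball (2 + x * I) 5 := by
  have hpi := Real.pi_pos
  have hr0 : 0 < r := by linarith [hr.1]
  have hre : 0 ≤ (circleMap 0 r θ).re := by
    rw [circleMap_zero_re]
    exact mul_nonneg hr0.le (Real.cos_nonneg_of_mem_Icc ⟨by linarith [hθ.1], hθ.2.le⟩)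
  have him : 0 ≤ (circleMap 0 r θ).im := by
    rw [circleMap_zero_im]
    exact mul_nonneg hr0.le (Real.sin_nonneg_of_nonneg_of_le_pi hθ.1.le (by linarith [hθ.2]))
  have h3 := norm_sub_two_le_abs_im hre h2
  have h4 := Complex.abs_im_le_norm (circleMap 0 r θ)
  rw [norm_circleMap_zero, abs_of_pos hr0] at h3 h4
  rw [abs_of_nonneg him] at h3 h4
  rw [Metric.mem_ball, dist_eq_norm]
  refine (Complex.norm_le_abs_re_add_abs_im _).trans_lt ?_
  simp only [sub_re, sub_im, add_re, add_im, mul_re, mul_im, I_re, I_im, ofReal_re, ofReal_im, re_ofNat,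
    im_ofNat]
  have a1 : |(circleMap 0 r θ).re - (2 + (x * 0 - 0 * 1))| ≤ 2 := by
    rw [abs_le]; constructor <;> linarith
  have a2 : |(circleMap 0 r θ).im - (0 + (x * 1 + 0 * 0))| ≤ 2 := by
    rw [abs_le]; constructor <;> linarith [hr.1, hr.2]
  linarith

lemma lintegral_stripLIntegral_le {x Q : ℝ} (hx : 10 ≤ x) :
    ENNReal.ofReal x * ∫⁻ r in Ioo x (x + 1), stripLIntegral Q r ≤
      ∫⁻ z, (Metric.ball (2 + x * I) 5).indicator
        (fun z => ENNReal.ofReal (Q - Real.log ‖xiProd z‖)) z := by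
  have hpi := Real.pi_pos
  have hm : Measurable (fun z => ENNReal.ofReal (Q - Real.log ‖xiProd z‖)) :=
    (measurable_const.sub measurable_log_norm_xiProd).ennreal_ofReal
  rw [complex_lintegral_eq_polar (hm.indicator Metric.isOpen_ball.measurableSet) 0,
    ← lintegral_const_mul' _ _ ENNReal.ofReal_ne_top]
  have hb : ∀ r ∈ Ioo x (x + 1), ENNReal.ofReal x * stripLIntegral Q r ≤
      ∫⁻ θ in Ioo (-π) π, ENNReal.ofReal r * (Metric.ball (2 + x * I) 5).indicator
        (fun z => ENNReal.ofReal (Q - Real.log ‖xiProd z‖)) (circleMap 0 r θ) := by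
    intro r hr
    rw [lintegral_const_mul' _ _ ENNReal.ofReal_ne_top]
    refine mul_le_mul' (ENNReal.ofReal_le_ofReal hr.1.le) ?_
    calc stripLIntegral Q r ≤ ∫⁻ θ in Ioo 0 (π / 2), (Metric.ball (2 + x * I) 5).indicator
            (fun z => ENNReal.ofReal (Q - Real.log ‖xiProd z‖)) (circleMap 0 r θ) := by
          refine setLIntegral_mono' measurableSet_Ioo fun θ hθ => ?_
          by_cases h2 : (circleMap 0 r θ).re < 2
          · rw [indicator_of_mem (circleMap_mem_ball hx hr hθ h2),
              indicator_of_mem (show circleMap 0 r θ ∈ {z : ℂ | z.re < 2} from h2)]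
          · rw [indicator_of_notMem (show circleMap 0 r θ ∉ {z : ℂ | z.re < 2} from h2)]
            exact zero_le
      _ ≤ _ := by
          apply lintegral_mono_set
          exact Ioo_subset_Ioo (by linarith) (by linarith)
  refine (setLIntegral_mono' measurableSet_Ioo hb).trans ?_
  apply lintegral_mono_set
  intro r hr
  exact lt_trans (by linarith) hr.1

lemma exists_stripLIntegral_le : ∃ K₀ K : ℝ, 0 ≤ K₀ ∧ 0 ≤ K ∧ ∀ x : ℝ, 20 ≤ x →
    ∃ r ∈ Ioo x (x + 1), stripLIntegral (-(π / 2) * x + K₀ * Real.log x) r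
      ≤ ENNReal.ofReal (K * (Real.log x / x)) := by
  obtain ⟨K₁, hK₁, h1⟩ := exists_norm_xiProd_le
  obtain ⟨K₂, hK₂, h2⟩ := exists_abs_xiMain_le
  have hpi := Real.pi_pos
  have hpi4 := Real.pi_lt_four
  refine ⟨2 * K₁ + 10, 5 * (5 * (2 * π * (2 * K₁ + 10 + K₂ + 14))), by positivity, by positivity,
    fun x hx => ?_⟩
  have hx0 : 0 < x := by linarith
  have hlog : 1 ≤ Real.log x := by
    rw [Real.le_log_iff_exp_le hx0]; linarith [Real.exp_one_lt_d9]
  set Q := -(π / 2) * x + (2 * K₁ + 10) * Real.log x with hQdef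
  set c : ℂ := 2 + x * I with hc
  have hcre : c.re = 2 := by simp [hc]
  have hcim : c.im = x := by simp [hc]
  have hne : xiProd c ≠ 0 := by
    refine mul_ne_zero ?_ ?_ <;> apply riemannXi_ne_zero_of_one_le_re <;> simp [hcre]
  have hQ : ∀ z ∈ Metric.ball c 5, ‖xiProd z‖ ≤ Real.exp Q := by
    intro z hz
    rw [Metric.mem_ball, dist_eq_norm] at hz
    have e1 := (Complex.abs_re_le_norm (z - c)).trans_lt hz
    have e2 := (Complex.abs_im_le_norm (z - c)).trans_lt hz
    rw [sub_re, hcre, abs_lt] at e1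
    rw [sub_im, hcim, abs_lt] at e2
    have him : |z.im| = z.im := abs_of_nonneg (by linarith [e2.1])
    refine (h1 z (abs_le.2 ⟨by linarith, by linarith⟩) (by rw [him]; linarith)).trans ?_
    apply Real.exp_le_exp.2
    rw [him]
    have l1 : Real.log z.im ≤ 2 * Real.log x := by
      rw [← Real.log_rpow hx0]
      apply Real.log_le_log (by linarith)
      rw [Real.rpow_two]; nlinarith
    have l2 : K₁ * Real.log z.im ≤ K₁ * (2 * Real.log x) := by gcongr
    have l3 : -(π / 2) * z.im ≤ -(π / 2) * (x - 5) := by nlinarith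
    rw [hQdef]
    nlinarith
  have hcb : Q - Real.log ‖xiProd c‖ ≤ (2 * K₁ + 10 + K₂ + 14) * Real.log x := by
    have a1 := abs_log_norm_xiProd_sub_xiMain_le (w := c) (by rw [hcre])
    have a2 := h2 c (by rw [hcre]; norm_num) (by rw [hcre]; norm_num)
      (by rw [hcim, abs_of_pos hx0]; linarith)
    rw [hcim, abs_of_pos hx0] at a2
    have a3 : 9 / ‖c‖ ≤ 9 := by
      apply div_le_self (by norm_num)
      have := Complex.abs_im_le_norm c
      rw [hcim, abs_of_pos hx0] at this
      linarith
    have a4 : (2 : ℝ) ^ (-c.re) = 1 / 4 := by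
      rw [hcre, Real.rpow_neg (by norm_num)]; norm_num
    rw [a4] at a1
    have a5 := (abs_le.1 a1).1
    have a6 := (abs_le.1 a2).1
    rw [hQdef]
    nlinarith
  have hmain : ENNReal.ofReal x * ∫⁻ r in Ioo x (x + 1), stripLIntegral Q r ≤
      ENNReal.ofReal (5 * (5 * (2 * π * ((2 * K₁ + 10 + K₂ + 14) * Real.log x)))) :=
    (lintegral_stripLIntegral_le (by linarith)).trans
      ((lintegral_ball_le hne (by norm_num) hQ).trans (ENNReal.ofReal_le_ofReal (by gcongr)))
  have hvol : volume (Ioo x (x + 1)) = 1 := by rw [Real.volume_Ioo]; simp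
  obtain ⟨r, hr, hrle⟩ := exists_le_setLAverage (μ := volume) (s := Ioo x (x + 1))
    (f := stripLIntegral Q) (by rw [hvol]; simp) (by rw [hvol]; simp)
    (measurable_stripLIntegral Q).aemeasurable
  refine ⟨r, hr, ?_⟩
  rw [setLAverage_eq, hvol, div_one] at hrle
  have h3 : stripLIntegral Q r * ENNReal.ofReal x ≤
      ENNReal.ofReal (5 * (5 * (2 * π * ((2 * K₁ + 10 + K₂ + 14) * Real.log x)))) := by
    rw [mul_comm]
    exact (mul_le_mul_right hrle _).trans hmain
  rw [← ENNReal.le_div_iff_mul_le (by simp [hx0]) (by simp), ← ENNReal.ofReal_div_of_pos hx0] at h3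
  refine h3.trans (le_of_eq ?_)
  congr 1
  ring

lemma exists_zetaZeroLogMain_le_near : ∃ K : ℝ, 0 ≤ K ∧ ∀ x : ℝ, 20 ≤ x →
    ∃ r ∈ Ioo x (x + 1), zetaZeroLogMain r - K * (Real.log x / x) ≤ zetaZeroLogSum r := by
  obtain ⟨K₀, K₁, hK₀, hK₁, h1⟩ := exists_stripLIntegral_le
  obtain ⟨K₂, hK₂, h2⟩ := exists_abs_xiMain_le
  have hpi := Real.pi_pos
  have hpi4 := Real.pi_lt_four
  refine ⟨(10 * (4 * K₂ + 36) + K₁) / π, by positivity, fun x hx => ?_⟩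
  obtain ⟨r, hr, hrle⟩ := h1 x hx
  refine ⟨r, hr, ?_⟩
  have hx0 : 0 < x := by linarith
  have hr0 : 0 < r := by linarith [hr.1]
  have hr20 : 20 ≤ r := by linarith [hr.1]
  have hlogx : 1 ≤ Real.log x := by
    rw [Real.le_log_iff_exp_le hx0]; linarith [Real.exp_one_lt_d9]
  have hlogr : 1 ≤ Real.log r := hlogx.trans (Real.log_le_log hx0 hr.1.le)
  set Q := -(π / 2) * x + K₀ * Real.log x with hQ
  set K := 4 * K₂ + 36 with hK
  have hKpos : 0 ≤ K := by positivity
  have hle : (0 : ℝ) ≤ π / 2 := by positivity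
  set g : ℝ → ENNReal := fun θ => {z : ℂ | z.re < 2}.indicator
    (fun z => ENNReal.ofReal (Q - Real.log ‖xiProd z‖)) (circleMap 0 r θ) with hg
  have hgm : Measurable g := (measurable_strip_integrand Q).comp (by unfold circleMap; fun_prop)
  have hglt : ∀ θ, g θ < ⊤ := fun θ => by
    by_cases h : circleMap 0 r θ ∈ {z : ℂ | z.re < 2}
    · simp only [hg, indicator_of_mem h, ENNReal.ofReal_lt_top]
    · simp [hg, indicator_of_notMem h]
  have hgs : ∫⁻ θ in Ioc 0 (π / 2), g θ = stripLIntegral Q r := by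
    rw [setLIntegral_congr Ioo_ae_eq_Ioc.symm, stripLIntegral]
  have hi1 := intervalIntegrable_log_norm_circleMap differentiable_xiProd 0 r 0 (π / 2)
  have hi2 := intervalIntegrable_xiMain hr0
  have hi3 : IntervalIntegrable (fun θ => K / r + K * (Real.log r * (2 : ℝ) ^ (-(r * Real.cos θ))))
      volume 0 (π / 2) := IntervalIntegrable.add (by simp)
    (((intervalIntegrable_two_rpow_neg_cos r 0 (π / 2)).const_mul _).const_mul _)
  have hi4 : IntervalIntegrable (fun θ => (g θ).toReal) volume 0 (π / 2) := by
    rw [intervalIntegrable_iff_integrableOn_Ioc_of_le hle]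
    refine integrable_toReal_of_lintegral_ne_top hgm.aemeasurable ?_
    rw [hgs]
    exact (hrle.trans_lt ENNReal.ofReal_lt_top).ne
  have hg4 : ∫ θ in 0..π / 2, (g θ).toReal ≤ K₁ * (Real.log x / x) := by
    rw [intervalIntegral.integral_of_le hle, integral_toReal hgm.aemeasurable
      (Eventually.of_forall hglt), hgs]
    exact ENNReal.toReal_le_of_le_ofReal (by positivity) hrle
  have hmono := intervalIntegral.integral_mono_ae_restrict hle (hi2.sub hi1) (hi3.add hi4) (by
    filter_upwards [ae_restrict_mem measurableSet_Icc] with θ hθ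
    have hcos : 0 ≤ Real.cos θ := Real.cos_nonneg_of_mem_Icc ⟨by linarith [hθ.1], hθ.2⟩
    set z := circleMap 0 r θ with hz
    have hnorm : ‖z‖ = r := by rw [hz, norm_circleMap_zero, abs_of_pos hr0]
    have hre : z.re = r * Real.cos θ := by rw [hz, circleMap_zero_re]
    have hre0 : 0 ≤ z.re := by rw [hre]; positivity
    show xiMain z - Real.log ‖xiProd z‖ ≤
      K / r + K * (Real.log r * (2 : ℝ) ^ (-(r * Real.cos θ))) + (g θ).toReal
    rw [← hre]
    have hp : 0 < (2 : ℝ) ^ (-z.re) := by positivity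
    have hKr : 0 ≤ K / r := by positivity
    by_cases hlt : z.re < 2
    · have hgz : (g θ).toReal = max (Q - Real.log ‖xiProd z‖) 0 := by
        have hmem : circleMap 0 r θ ∈ {z : ℂ | z.re < 2} := hlt
        simp only [hg, indicator_of_mem hmem, ENNReal.toReal_ofReal']
        rfl
      have b1 := norm_sub_two_le_abs_im hre0 hlt
      rw [hnorm] at b1
      have b2 := Complex.abs_im_le_norm z
      rw [hnorm] at b2
      have b3 := (abs_le.1 (h2 z hre0 (by linarith) (by linarith))).2
      have b4 : K₂ * Real.log |z.im| ≤ K₂ * Real.log r := by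
        gcongr
        linarith
      have b5 : (1 / 4 : ℝ) ≤ (2 : ℝ) ^ (-z.re) := by
        have : (2 : ℝ) ^ (-2 : ℝ) = 1 / 4 := by rw [Real.rpow_neg (by norm_num)]; norm_num
        rw [← this]
        exact Real.rpow_le_rpow_of_exponent_le (by norm_num) (by linarith)
      have b6 : K * (Real.log r * (1 / 4)) ≤ K * (Real.log r * (2 : ℝ) ^ (-z.re)) := by gcongr
      have b7 := le_max_left (Q - Real.log ‖xiProd z‖) 0
      have b8 : π / 2 * (x - 2) ≤ π / 2 * (|z.im|) := by
        gcongr; linarith [hr.1]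
      have b9 : 0 ≤ K₀ * Real.log x := by positivity
      rw [hgz]
      rw [hK] at b6 hKr ⊢
      linarith
    · have c1 := (abs_le.1 (abs_log_norm_xiProd_sub_xiMain_le (not_lt.1 hlt))).1
      rw [hnorm] at c1
      have c2 : 9 / r ≤ K / r := by gcongr; linarith
      have c3 : 20 * (2 : ℝ) ^ (-z.re) ≤ K * (Real.log r * (2 : ℝ) ^ (-z.re)) := by
        rw [← mul_assoc]; gcongr; nlinarith
      have c4 : 0 ≤ (g θ).toReal := ENNReal.toReal_nonneg
      linarith)
  have e0 : ∫ θ in 0..π / 2, (K / r + K * (Real.log r * (2 : ℝ) ^ (-(r * Real.cos θ))) + (g θ).toReal)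
      ≤ 5 * K * (Real.log r / r) + K₁ * (Real.log x / x) := by
    rw [intervalIntegral.integral_add hi3 hi4]
    exact add_le_add (integral_error_le hKpos (by linarith)) hg4
  have e1 : Real.log r / r ≤ 2 * (Real.log x / x) := by
    have : Real.log r ≤ 2 * Real.log x := by
      rw [← Real.log_rpow hx0]
      apply Real.log_le_log hr0
      rw [Real.rpow_two]; nlinarith [hr.2]
    calc Real.log r / r ≤ 2 * Real.log x / x := by
          gcongr
          exact hr.1.le
      _ = _ := by ring
  have e2 : 5 * K * (Real.log r / r) ≤ 5 * K * (2 * (Real.log x / x)) := by gcongr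
  rw [intervalIntegral.integral_sub hi2 hi1, ← zetaZeroLogSum_eq_integral (by linarith),
    integral_xiMain hr0] at hmono
  have e3 : π * (zetaZeroLogMain r - zetaZeroLogSum r) ≤ π * ((10 * K + K₁) / π * (Real.log x / x)) := by
    calc _ = π * zetaZeroLogMain r - π * zetaZeroLogSum r := by ring
      _ ≤ _ := hmono
      _ ≤ _ := e0
      _ ≤ 10 * K * (Real.log x / x) + K₁ * (Real.log x / x) := by linarith
      _ = _ := by field_simp
  have := le_of_mul_le_mul_left e3 hpi
  linarith

/-! ### Weighted sequences and their counting functions -/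

/-- A sequence of reals, each with a multiplicity, with finitely many terms below any bound. -/
structure WeightedSeq (ι : Type*) where
  /-- the terms -/
  lam : ι → ℝ
  /-- the multiplicities -/
  mult : ι → ℕ
  finite_le : ∀ u, {i | lam i ≤ u}.Finite

namespace WeightedSeq

variable {ι : Type*} (W : WeightedSeq ι)

/-- The indices of the terms not exceeding `u`. -/
def level (u : ℝ) : Finset ι := (W.finite_le u).toFinset

/-- The number of terms not exceeding `u`, with multiplicity. -/
def count (u : ℝ) : ℝ := ∑ i ∈ W.level u, (W.mult i : ℝ)

/-- The integral of the counting function. -/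
def jensen (u : ℝ) : ℝ := ∑' i, (W.mult i : ℝ) * max 0 (u - W.lam i)

variable {W}

@[simp] lemma mem_level {u : ℝ} {i : ι} : i ∈ W.level u ↔ W.lam i ≤ u := by simp [level]

lemma level_mono {u v : ℝ} (h : u ≤ v) : W.level u ⊆ W.level v := fun i hi => by
  rw [mem_level] at hi ⊢; linarith

lemma jensen_eq_sum {u v : ℝ} (h : u ≤ v) :
    W.jensen u = ∑ i ∈ W.level v, (W.mult i : ℝ) * max 0 (u - W.lam i) := by
  refine tsum_eq_sum fun i hi => ?_
  rw [mem_level, not_le] at hi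
  rw [max_eq_left (by linarith), mul_zero]

lemma jensen_nonneg (u : ℝ) : 0 ≤ W.jensen u :=
  tsum_nonneg fun i => by positivity

lemma jensen_mono {u v : ℝ} (h : u ≤ v) : W.jensen u ≤ W.jensen v := by
  rw [jensen_eq_sum h, jensen_eq_sum le_rfl]
  gcongr

lemma two_mul_jensen_le {u h : ℝ} (hh : 0 ≤ h) :
    2 * W.jensen u ≤ W.jensen (u + h) + W.jensen (u - h) := by
  rw [jensen_eq_sum (show u ≤ u + h by linarith), jensen_eq_sum (le_refl (u + h)),
    jensen_eq_sum (show u - h ≤ u + h by linarith), Finset.mul_sum, ← Finset.sum_add_distrib]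
  refine Finset.sum_le_sum fun i _ => ?_
  rw [← mul_add, ← mul_left_comm]
  gcongr
  rcases max_cases 0 (u - W.lam i) with hm | hm <;>
    linarith [le_max_left 0 (u + h - W.lam i), le_max_right 0 (u + h - W.lam i),
      le_max_left 0 (u - h - W.lam i), le_max_right 0 (u - h - W.lam i)]

lemma count_eq_sum_ite {u v : ℝ} (h : u ≤ v) :
    W.count u = ∑ i ∈ W.level v, (W.mult i : ℝ) * (if W.lam i ≤ u then 1 else 0) := by
  rw [count, ← Finset.sum_subset (level_mono h)]
  · refine Finset.sum_congr rfl fun i hi => ?_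
    rw [if_pos (mem_level.1 hi), mul_one]
  · intro i _ hi
    rw [if_neg (by simpa using hi), mul_zero]

lemma mul_count_le {u h : ℝ} (hh : 0 ≤ h) : h * W.count u ≤ W.jensen (u + h) - W.jensen u := by
  rw [count_eq_sum_ite (show u ≤ u + h by linarith), jensen_eq_sum (le_refl (u + h)),
    jensen_eq_sum (show u ≤ u + h by linarith), Finset.mul_sum, ← Finset.sum_sub_distrib]
  refine Finset.sum_le_sum fun i _ => ?_
  rw [← mul_sub, mul_left_comm]
  gcongr
  split_ifs with hi
  · rw [max_eq_right (by linarith), max_eq_right (by linarith)]; linarith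
  · rw [mul_zero, sub_nonneg]; gcongr; linarith

lemma jensen_sub_le {u h : ℝ} (hh : 0 ≤ h) : W.jensen u - W.jensen (u - h) ≤ h * W.count u := by
  rw [count, jensen_eq_sum (le_refl u), jensen_eq_sum (show u - h ≤ u by linarith), Finset.mul_sum,
    ← Finset.sum_sub_distrib]
  refine Finset.sum_le_sum fun i hi => ?_
  rw [mem_level] at hi
  rw [← mul_sub, mul_comm h]
  gcongr
  rw [max_eq_right (by linarith)]
  linarith [le_max_right 0 (u - h - W.lam i)]

lemma count_nonneg (u : ℝ) : 0 ≤ W.count u := Finset.sum_nonneg fun _ _ => by positivity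

end WeightedSeq

/-- The logarithms of the absolute values of the nontrivial zeros of the zeta function. -/
def zetaSeq : WeightedSeq {ρ : ℂ // IsNontrivialZero ρ} where
  lam ρ := Real.log ‖ρ.1‖
  mult ρ := zetaMult ρ.1
  finite_le u := by
    refine Set.Finite.of_finite_image (f := Subtype.val)
      ((finite_isNontrivialZero_norm_le (Real.exp u)).subset ?_) Subtype.val_injective.injOn
    rintro _ ⟨ρ, hρ, rfl⟩
    exact ⟨ρ.2, (Real.log_le_iff_le_exp ρ.2.norm_pos).1 hρ⟩

lemma zetaSeq_jensen_log (x : ℝ) : zetaSeq.jensen (Real.log x) = zetaZeroLogSum x := rfl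

lemma zetaZeroLogMain_second_difference {x δ : ℝ} (hx : 0 < x) (hδ : 0 < δ) :
    2 * zetaZeroLogMain (x * (1 + δ)) - zetaZeroLogMain (x * (1 + δ) ^ 2) - zetaZeroLogMain x =
      x * (-(1 / π * Real.log x - (2 + Real.log (2 * π)) / π) * δ ^ 2
        - 2 * (1 / π) * Real.log (1 + δ) * δ * (1 + δ)) := by
  simp only [zetaZeroLogMain]
  rw [Real.log_mul hx.ne' (by positivity), Real.log_mul hx.ne' (by positivity), Real.log_pow]
  push_cast
  ring

lemma exists_abs_zetaZeroLogSum_sub_le : ∃ K : ℝ, 0 ≤ K ∧ ∀ x : ℝ, 20 ≤ x →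
    |zetaZeroLogSum x - zetaZeroLogMain x| ≤ K * (Real.log x / x) := by
  obtain ⟨K₁, hK₁, h1⟩ := exists_zetaZeroLogSum_le
  obtain ⟨K₂, hK₂, h2⟩ := exists_zetaZeroLogMain_le_near
  have hpi := Real.pi_pos
  have hpi3 := Real.pi_gt_three
  set B := (2 + Real.log (2 * π)) / π with hB
  have hB0 : 0 ≤ B := by
    have := Real.log_nonneg (show 1 ≤ 2 * π by linarith)
    positivity
  have hA : 1 / π ≤ 1 := by rw [div_le_one hpi]; linarith
  have hA0 : 0 ≤ 1 / π := by positivity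
  refine ⟨2 * K₂ + 2 * K₁ + 5 + K₁, by positivity, fun x hx => ?_⟩
  have hx0 : 0 < x := by linarith
  have hlog : 1 ≤ Real.log x := by
    rw [Real.le_log_iff_exp_le hx0]; linarith [Real.exp_one_lt_d9]
  have hlx : 0 ≤ Real.log x / x := by positivity
  obtain ⟨r, hr, hrle⟩ := h2 x hx
  set δ := r / x - 1 with hδ
  have hrx : r = x * (1 + δ) := by rw [hδ]; field_simp; ring
  have hδ0 : 0 < δ := by rw [hδ, sub_pos, one_lt_div hx0]; exact hr.1
  have hδ1 : δ ≤ 1 / x := by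
    rw [hδ, sub_le_iff_le_add, div_le_iff₀ hx0]
    have : (1 / x + 1) * x = 1 + x := by field_simp
    rw [this]; linarith [hr.2]
  have hδx : x * δ ≤ 1 := by
    calc x * δ ≤ x * (1 / x) := by gcongr
      _ = 1 := by field_simp
  have hδ2 : δ ≤ 1 := by nlinarith
  have hh : 0 ≤ Real.log (1 + δ) := Real.log_nonneg (by linarith)
  have hhδ : Real.log (1 + δ) ≤ δ := by
    have := Real.log_le_sub_one_of_pos (show 0 < 1 + δ by linarith); linarith
  have hconv := zetaSeq.two_mul_jensen_le (u := Real.log r) hh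
  have e1 : Real.log r + Real.log (1 + δ) = Real.log (x * (1 + δ) ^ 2) := by
    rw [hrx, ← Real.log_mul (by positivity) (by positivity)]; ring_nf
  have e2 : Real.log r - Real.log (1 + δ) = Real.log x := by
    rw [hrx, Real.log_mul (by positivity) (by positivity)]; ring
  rw [e1, e2, zetaSeq_jensen_log, zetaSeq_jensen_log, zetaSeq_jensen_log] at hconv
  set y := x * (1 + δ) ^ 2 with hy
  have hxy : x ≤ y := by rw [hy]; nlinarith [mul_pos hx0 hδ0, mul_pos (mul_pos hx0 hδ0) hδ0]
  have hy2 : y ≤ x ^ 2 := by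
    have : (1 + δ) ^ 2 ≤ 4 := by nlinarith
    rw [hy]; nlinarith
  have h3 := h1 y (by linarith)
  have h4 : Real.log y / y ≤ 2 * (Real.log x / x) := by
    have : Real.log y ≤ 2 * Real.log x := by
      have := Real.log_le_log (by linarith) hy2
      rwa [Real.log_pow] at this
    calc Real.log y / y ≤ 2 * Real.log x / x := by gcongr
      _ = _ := by ring
  have h5 : K₁ * (Real.log y / y) ≤ K₁ * (2 * (Real.log x / x)) := by gcongr
  have h6 := zetaZeroLogMain_second_difference hx0 hδ0
  rw [← hrx, ← hy, ← hB] at h6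
  have h7 : x * δ ^ 2 ≤ 1 / x := by
    calc x * δ ^ 2 = x * δ * δ := by ring
      _ ≤ 1 * (1 / x) := by gcongr
      _ = _ := by ring
  have h8 : -(5 * (Real.log x / x)) ≤ x * (-(1 / π * Real.log x - B) * δ ^ 2
        - 2 * (1 / π) * Real.log (1 + δ) * δ * (1 + δ)) := by
    have a1 : 2 * (1 / π) * Real.log (1 + δ) * δ * (1 + δ) ≤ 2 * 1 * δ * δ * (1 + 1) := by gcongr
    have a2 : (1 / π * Real.log x - B) * δ ^ 2 ≤ (1 * Real.log x) * δ ^ 2 := by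
      gcongr
      have : 1 / π * Real.log x ≤ 1 * Real.log x := by gcongr
      linarith
    have a3 : (Real.log x + 4) * (x * δ ^ 2) ≤ (Real.log x + 4 * Real.log x) * (1 / x) := by
      gcongr; linarith
    have a4 : (Real.log x + 4 * Real.log x) * (1 / x) = 5 * (Real.log x / x) := by ring
    nlinarith
  have h9 := h1 x (by linarith)
  rw [abs_le]
  constructor
  · linarith [mul_nonneg hK₁ hlx]
  · linarith [mul_nonneg hK₁ hlx, mul_nonneg hK₂ hlx]

namespace WeightedSeq

variable {ι : Type*}

/-- The main term for the integrated counting function. -/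
def mainTerm (A B C D u : ℝ) : ℝ := (A * u + B) * Real.exp u + C * u + D

/-- The main term for the counting function. -/
def countMain (A B C u : ℝ) : ℝ := (A * u + (A + B)) * Real.exp u + C

/-- The integrated counting function is approximated by the main term with parameters `A B C D`, up to
an error smaller than the main term by a factor of almost `exp (2 * u)`. -/
def HasMainTerm (W : WeightedSeq ι) (A B C D : ℝ) : Prop :=
  ∀ ε : ℝ, 0 < ε → ∃ K : ℝ, 0 ≤ K ∧ ∀ u : ℝ, -1 ≤ u →
    |W.jensen u - mainTerm A B C D u| ≤ K * Real.exp ((ε - 1) * u)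

lemma le_exp_mul_div {ε : ℝ} (hε : 0 < ε) (u : ℝ) : u ≤ Real.exp (ε * u) / ε := by
  rw [le_div_iff₀ hε]
  linarith [Real.add_one_le_exp (ε * u)]

lemma abs_mainTerm_add_sub_le {A B C D u h : ℝ} (hu : 0 ≤ u) (hh : |h| ≤ 1) :
    |mainTerm A B C D (u + h) - mainTerm A B C D u - h * countMain A B C u|
      ≤ Real.exp u * h ^ 2 * (|A| * u + |B| + 2 * |A|) := by
  have h1 := Real.abs_exp_sub_one_sub_id_le hh
  have h2 := Real.abs_exp_sub_one_le hh
  have e : mainTerm A B C D (u + h) - mainTerm A B C D u - h * countMain A B C u =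
      Real.exp u * ((A * u + B) * (Real.exp h - 1 - h) + A * h * (Real.exp h - 1)) := by
    simp only [mainTerm, countMain, Real.exp_add]; ring
  rw [e, abs_mul, abs_of_pos (Real.exp_pos u), mul_assoc (Real.exp u)]
  refine mul_le_mul_of_nonneg_left ?_ (Real.exp_pos u).le
  calc _ ≤ |(A * u + B) * (Real.exp h - 1 - h)| + |A * h * (Real.exp h - 1)| := abs_add_le _ _
    _ = |A * u + B| * |Real.exp h - 1 - h| + |A| * |h| * |Real.exp h - 1| := by
        rw [abs_mul, abs_mul, abs_mul]
    _ ≤ (|A| * u + |B|) * h ^ 2 + |A| * |h| * (2 * |h|) := by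
        gcongr
        calc |A * u + B| ≤ |A * u| + |B| := abs_add_le _ _
          _ = _ := by rw [abs_mul, abs_of_nonneg hu]
    _ = (|A| * u + |B|) * |h| ^ 2 + |A| * |h| * (2 * |h|) := by rw [sq_abs]
    _ = |h| ^ 2 * (|A| * u + |B| + 2 * |A|) := by ring
    _ = _ := by rw [sq_abs]

lemma HasMainTerm.exists_abs_count_sub_le {W : WeightedSeq ι} {A B C D : ℝ}
    (hW : W.HasMainTerm A B C D) {ε : ℝ} (hε : 0 < ε) : ∃ K : ℝ, 0 ≤ K ∧ ∀ u : ℝ, 0 ≤ u →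
    |W.count u - countMain A B C u| ≤ K * Real.exp (ε * u) := by
  obtain ⟨K, hK, hj⟩ := hW ε hε
  refine ⟨|A| / ε + |B| + 2 * |A| + K * (1 + Real.exp (ε + 1)), by positivity, fun u hu => ?_⟩
  set h := Real.exp (-u) with hh
  have hh0 : 0 < h := Real.exp_pos _
  have hh1 : h ≤ 1 := by rw [hh]; exact Real.exp_le_one_iff.2 (by linarith)
  have heu : Real.exp u * h = 1 := by rw [hh, ← Real.exp_add]; simp
  set E := Real.exp (ε * u) with hE
  have hE1 : 1 ≤ E := Real.one_le_exp (by positivity)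
  have hEh : Real.exp ((ε - 1) * u) = E * h := by rw [hE, hh, ← Real.exp_add]; ring_nf
  have key : ∀ k : ℝ, |k| ≤ 1 → -1 ≤ u + k → Real.exp ((ε - 1) * (u + k)) ≤ Real.exp (ε + 1) * (E * h) := by
    intro k hk _
    rw [mul_add, Real.exp_add, hEh, mul_comm]
    gcongr
    obtain ⟨k1, k2⟩ := abs_le.1 hk
    nlinarith
  have j0 := hj u (by linarith)
  rw [hEh] at j0
  have j1 := (hj (u + h) (by linarith)).trans (mul_le_mul_of_nonneg_left
    (key h (by rwa [abs_of_pos hh0]) (by linarith)) hK)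
  have j2 := (hj (u - h) (by linarith)).trans (mul_le_mul_of_nonneg_left
    (key (-h) (by rwa [abs_neg, abs_of_pos hh0]) (by linarith)) hK)
  have m1 := abs_mainTerm_add_sub_le (A := A) (B := B) (C := C) (D := D) hu
    (show |h| ≤ 1 by rwa [abs_of_pos hh0])
  have m2 := abs_mainTerm_add_sub_le (A := A) (B := B) (C := C) (D := D) hu
    (show |-h| ≤ 1 by rwa [abs_neg, abs_of_pos hh0])
  have hP : Real.exp u * h ^ 2 * (|A| * u + |B| + 2 * |A|) ≤
      h * ((|A| / ε + |B| + 2 * |A|) * E) := by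
    calc _ = (Real.exp u * h) * h * (|A| * u + |B| + 2 * |A|) := by ring
      _ = h * (|A| * u + |B| + 2 * |A|) := by rw [heu, one_mul]
      _ ≤ h * (|A| * (E / ε) + |B| * E + (2 * |A|) * E) := by
          refine mul_le_mul_of_nonneg_left (add_le_add (add_le_add ?_ ?_) ?_) hh0.le
          · exact mul_le_mul_of_nonneg_left (le_exp_mul_div hε u) (abs_nonneg _)
          · exact le_mul_of_one_le_right (abs_nonneg _) hE1
          · exact le_mul_of_one_le_right (by positivity) hE1
      _ = _ := by ring
  rw [neg_sq] at m2
  have c1 := mul_count_le (W := W) (u := u) hh0.le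
  have c2 := jensen_sub_le (W := W) (u := u) hh0.le
  rw [abs_le] at j0 j1 j2 m1 m2
  rw [← sub_eq_add_neg] at m2
  have d1 : h * (W.count u - countMain A B C u) ≤
      h * ((|A| / ε + |B| + 2 * |A| + K * (1 + Real.exp (ε + 1))) * E) := by
    linarith [j0.1, j1.2, m1.2]
  have d2 : h * (-((|A| / ε + |B| + 2 * |A| + K * (1 + Real.exp (ε + 1))) * E)) ≤
      h * (W.count u - countMain A B C u) := by
    linarith [j0.1, j2.2, m2.2]
  exact abs_le.2 ⟨le_of_mul_le_mul_left d2 hh0, le_of_mul_le_mul_left d1 hh0⟩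

end WeightedSeq

lemma zetaSeq_hasMainTerm : zetaSeq.HasMainTerm (1 / π) (-((2 + Real.log (2 * π)) / π)) (7 / 4)
    (xiMainConst / 2) := by
  intro ε hε
  obtain ⟨K, hK, h⟩ := exists_abs_zetaZeroLogSum_sub_le
  set M := WeightedSeq.mainTerm (1 / π) (-((2 + Real.log (2 * π)) / π)) (7 / 4) (xiMainConst / 2)
    with hM
  have hMc : Continuous M := by
    rw [hM]; unfold WeightedSeq.mainTerm; fun_prop
  have hc : Continuous fun u => (zetaSeq.jensen (Real.log 20) + |M u|) * Real.exp (-((ε - 1) * u)) := by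
    fun_prop
  obtain ⟨K', hK'⟩ := (isCompact_Icc (a := (-1 : ℝ)) (b := Real.log 20)).bddAbove_image hc.continuousOn
  refine ⟨K / ε + |K'|, by positivity, fun u hu => ?_⟩
  rcases le_or_gt (Real.log 20) u with h20 | h20
  · have hx : 20 ≤ Real.exp u := (Real.log_le_iff_le_exp (by norm_num)).1 h20
    have h1 := h _ hx
    rw [← zetaSeq_jensen_log, Real.log_exp] at h1
    have e : zetaZeroLogMain (Real.exp u) = M u := by
      simp only [zetaZeroLogMain, hM, WeightedSeq.mainTerm, Real.log_exp]; ring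
    rw [e] at h1
    refine h1.trans ?_
    calc K * (u / Real.exp u) ≤ K * ((Real.exp (ε * u) / ε) / Real.exp u) := by
          gcongr; exact WeightedSeq.le_exp_mul_div hε u
      _ = K / ε * Real.exp ((ε - 1) * u) := by
          rw [sub_mul, one_mul, Real.exp_sub]; ring
      _ ≤ _ := by gcongr; linarith [abs_nonneg K']
  · have h1 := hK' (mem_image_of_mem _ (show u ∈ Icc (-1) (Real.log 20) from ⟨hu, h20.le⟩))
    rw [Real.exp_neg, ← div_eq_mul_inv, div_le_iff₀ (Real.exp_pos _)] at h1
    have h2 := zetaSeq.jensen_mono h20.le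
    have h3 := zetaSeq.jensen_nonneg u
    calc |zetaSeq.jensen u - M u| ≤ |zetaSeq.jensen u| + |M u| := abs_sub _ _
      _ ≤ zetaSeq.jensen (Real.log 20) + |M u| := by rw [abs_of_nonneg h3]; gcongr
      _ ≤ K' * Real.exp ((ε - 1) * u) := h1
      _ ≤ _ := by
          gcongr
          have : 0 ≤ K / ε := by positivity
          have := le_abs_self K'
          linarith

/-! ### Laplace transforms -/

lemma norm_linear_mul_exp_le {w : ℂ} (hw : 0 < w.re) (p q : ℂ) {v : ℝ} (hv : 0 ≤ v) :
    ‖(p + q * v) * cexp (-w * v)‖ ≤ (‖p‖ + ‖q‖ / (w.re / 2)) * Real.exp (-(w.re / 2) * v) := by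
  have hσ : 0 < w.re / 2 := by positivity
  have h1 := WeightedSeq.le_exp_mul_div hσ v
  have hE : 1 ≤ Real.exp (w.re / 2 * v) := Real.one_le_exp (by positivity)
  have e1 : ‖cexp (-w * v)‖ = Real.exp (-(w.re / 2) * v) * Real.exp (-(w.re / 2) * v) := by
    rw [Complex.norm_exp, ← Real.exp_add]
    congr 1
    simp
    ring
  have e2 : Real.exp (w.re / 2 * v) * Real.exp (-(w.re / 2) * v) = 1 := by
    rw [← Real.exp_add]; simp
  have e3 : ‖p + q * v‖ ≤ (‖p‖ + ‖q‖ / (w.re / 2)) * Real.exp (w.re / 2 * v) := by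
    calc ‖p + q * v‖ ≤ ‖p‖ + ‖q‖ * v := by
          refine (norm_add_le _ _).trans ?_
          rw [norm_mul, Complex.norm_real, Real.norm_of_nonneg hv]
      _ ≤ ‖p‖ * Real.exp (w.re / 2 * v) + ‖q‖ * (Real.exp (w.re / 2 * v) / (w.re / 2)) := by
          gcongr
          exact le_mul_of_one_le_right (norm_nonneg _) hE
      _ = _ := by ring
  rw [norm_mul, e1]
  calc _ ≤ (‖p‖ + ‖q‖ / (w.re / 2)) * Real.exp (w.re / 2 * v)
        * (Real.exp (-(w.re / 2) * v) * Real.exp (-(w.re / 2) * v)) := by gcongr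
    _ = (‖p‖ + ‖q‖ / (w.re / 2)) * (Real.exp (w.re / 2 * v) * Real.exp (-(w.re / 2) * v))
        * Real.exp (-(w.re / 2) * v) := by ring
    _ = _ := by rw [e2, mul_one]

lemma integrableOn_linear_mul_exp {w : ℂ} (hw : 0 < w.re) (U : ℝ) (p q : ℂ) :
    IntegrableOn (fun u : ℝ => (p + q * (u - U : ℝ)) * cexp (-w * (u - U : ℝ))) (Ioi U) := by
  have hi : IntegrableOn (fun u : ℝ => (‖p‖ + ‖q‖ / (w.re / 2)) * (Real.exp (w.re / 2 * U) *
      Real.exp (-(w.re / 2) * u))) (Ioi U) :=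
    ((integrableOn_exp_mul_Ioi (by linarith : -(w.re / 2) < 0) U).const_mul _).const_mul _
  refine Integrable.mono' hi (Continuous.aestronglyMeasurable (by fun_prop)) ?_
  filter_upwards [ae_restrict_mem measurableSet_Ioi] with u hu
  refine (norm_linear_mul_exp_le hw p q (sub_nonneg.2 (le_of_lt hu))).trans (le_of_eq ?_)
  rw [← Real.exp_add]
  congr 2
  ring

lemma integral_linear_mul_exp {w : ℂ} (hw : 0 < w.re) (U : ℝ) (p q : ℂ) :
    ∫ u in Ioi U, (p + q * (u - U : ℝ)) * cexp (-w * (u - U : ℝ)) = p / w + q / w ^ 2 := by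
  have hw0 : w ≠ 0 := by rintro rfl; simp at hw
  have hd : ∀ u ∈ Ici U, HasDerivAt (fun u : ℝ => -((p / w + q / w ^ 2 + q / w * (u - U : ℝ))
      * cexp (-w * (u - U : ℝ)))) ((p + q * (u - U : ℝ)) * cexp (-w * (u - U : ℝ))) u := by
    intro u _
    have h0 : HasDerivAt (fun u : ℝ => ((u - U : ℝ) : ℂ)) 1 u :=
      ((hasDerivAt_id u).sub_const U).ofReal_comp
    have h1 := ((h0.const_mul (q / w)).const_add (p / w + q / w ^ 2)).mul (h0.const_mul (-w)).cexp
    refine h1.neg.congr_deriv ?_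
    field_simp
    ring
  have ht : Tendsto (fun u : ℝ => -((p / w + q / w ^ 2 + q / w * (u - U : ℝ))
      * cexp (-w * (u - U : ℝ)))) atTop (nhds 0) := by
    have h2 : Tendsto (fun u : ℝ => (‖p / w + q / w ^ 2‖ + ‖q / w‖ / (w.re / 2)) *
        Real.exp (-(w.re / 2) * (u - U))) atTop (nhds 0) := by
      rw [← mul_zero (‖p / w + q / w ^ 2‖ + ‖q / w‖ / (w.re / 2))]
      refine Tendsto.const_mul _ (Real.tendsto_exp_atBot.comp ?_)
      exact (tendsto_id.atTop_add (tendsto_const_nhds (x := -U))).const_mul_atTop_of_neg (by linarith)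
    refine squeeze_zero_norm' ?_ h2
    filter_upwards [eventually_ge_atTop U] with u hu
    rw [norm_neg]
    exact norm_linear_mul_exp_le hw _ _ (sub_nonneg.2 hu)
  rw [integral_Ioi_of_hasDerivAt_of_tendsto' hd (integrableOn_linear_mul_exp hw U p q) ht]
  simp

lemma linear_mul_exp_shift (s p q : ℂ) (U u : ℝ) : (p + q * (u - U : ℝ)) * cexp (-s * u) =
    cexp (-s * U) * ((p + q * (u - U : ℝ)) * cexp (-s * (u - U : ℝ))) := by
  rw [mul_left_comm, ← Complex.exp_add]
  congr 2
  push_cast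
  ring

lemma max_mul_exp_eq_indicator (s : ℂ) (l u : ℝ) : ((max 0 (u - l) : ℝ) : ℂ) * cexp (-s * u) =
    (Ioi l).indicator (fun u : ℝ => cexp (-s * l) *
      ((0 + 1 * (u - l : ℝ)) * cexp (-s * (u - l : ℝ)))) u := by
  by_cases hu : l < u
  · rw [indicator_of_mem (show u ∈ Ioi l from hu), max_eq_right (by linarith),
      ← linear_mul_exp_shift]
    ring
  · rw [indicator_of_notMem (show u ∉ Ioi l from hu), max_eq_left (by linarith)]
    simp

lemma integrableOn_max_mul_exp {s : ℂ} (hs : 0 < s.re) (l U : ℝ) :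
    IntegrableOn (fun u : ℝ => ((max 0 (u - l) : ℝ) : ℂ) * cexp (-s * u)) (Ioi U) := by
  simp only [max_mul_exp_eq_indicator]
  refine (IntegrableOn.integrable_indicator ?_ measurableSet_Ioi).integrableOn
  exact (integrableOn_linear_mul_exp hs l 0 1).const_mul _

lemma integral_max_mul_exp {s : ℂ} (hs : 0 < s.re) {l U : ℝ} (hl : U ≤ l) :
    ∫ u in Ioi U, ((max 0 (u - l) : ℝ) : ℂ) * cexp (-s * u) = cexp (-s * l) / s ^ 2 := by
  simp only [max_mul_exp_eq_indicator]
  rw [setIntegral_indicator measurableSet_Ioi, inter_eq_right.2 (Ioi_subset_Ioi hl),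
    integral_const_mul, integral_linear_mul_exp hs]
  ring

lemma integral_norm_max_mul_exp {s : ℂ} (hs : 0 < s.re) {l U : ℝ} (hl : U ≤ l) :
    ∫ u in Ioi U, ‖((max 0 (u - l) : ℝ) : ℂ) * cexp (-s * u)‖ =
      Real.exp (-s.re * l) / s.re ^ 2 := by
  have h := integral_max_mul_exp (s := (s.re : ℂ)) (by simpa using hs) hl
  have e : ∀ u : ℝ, ((max 0 (u - l) : ℝ) : ℂ) * cexp (-(s.re : ℂ) * u) =
      ((‖((max 0 (u - l) : ℝ) : ℂ) * cexp (-s * u)‖ : ℝ) : ℂ) := by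
    intro u
    rw [norm_mul, Complex.norm_real, Real.norm_of_nonneg (le_max_left _ _), Complex.norm_exp]
    push_cast
    congr 2
    simp
  simp only [e] at h
  rw [integral_complex_ofReal] at h
  have h2 : cexp (-(s.re : ℂ) * l) / (s.re : ℂ) ^ 2 = ((Real.exp (-s.re * l) / s.re ^ 2 : ℝ) : ℂ) := by
    push_cast; rfl
  rw [h2] at h
  exact_mod_cast h

namespace WeightedSeq

variable {ι : Type*} {W : WeightedSeq ι} {A B C D : ℝ}

variable (W A B C D) in
/-- The error term for the integrated counting function. -/
def err (u : ℝ) : ℝ := W.jensen u - mainTerm A B C D u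

lemma measurable_jensen : Measurable W.jensen :=
  Monotone.measurable fun _ _ h => jensen_mono h

lemma measurable_err : Measurable (W.err A B C D) := by
  refine measurable_jensen.sub ?_
  unfold mainTerm
  fun_prop

lemma norm_err_mul_exp_le {K ε : ℝ} (hK : ∀ u : ℝ, -1 ≤ u →
    |W.jensen u - mainTerm A B C D u| ≤ K * Real.exp ((ε - 1) * u)) (s : ℂ) {u : ℝ} (hu : -1 ≤ u) :
    ‖(W.err A B C D u : ℂ) * cexp (-s * u)‖ ≤ K * Real.exp ((ε - 1 - s.re) * u) := by
  rw [norm_mul, Complex.norm_real, Complex.norm_exp, sub_mul _ s.re, Real.exp_sub]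
  have : (-s * (u : ℂ)).re = -(s.re * u) := by simp
  rw [this, Real.exp_neg, ← div_eq_mul_inv, ← mul_div_assoc]
  gcongr
  exact hK u hu

lemma HasMainTerm.integrableOn_err (hW : W.HasMainTerm A B C D) {s : ℂ} (hs : -1 < s.re) {U : ℝ}
    (hU : -1 ≤ U) : IntegrableOn (fun u : ℝ => (W.err A B C D u : ℂ) * cexp (-s * u)) (Ioi U) := by
  obtain ⟨K, -, hK⟩ := hW ((1 + s.re) / 2) (by linarith)
  have hi : IntegrableOn (fun u : ℝ => K * Real.exp (((1 + s.re) / 2 - 1 - s.re) * u)) (Ioi U) :=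
    (integrableOn_exp_mul_Ioi (by linarith) U).const_mul _
  refine Integrable.mono' hi ?_ ?_
  · exact ((Complex.measurable_ofReal.comp measurable_err).mul (by fun_prop)).aestronglyMeasurable
  · filter_upwards [ae_restrict_mem measurableSet_Ioi] with u hu
    exact norm_err_mul_exp_le hK s (hU.trans (le_of_lt hu))

lemma mainTerm_mul_exp (s : ℂ) (U u : ℝ) : (mainTerm A B C D u : ℂ) * cexp (-s * u) =
    cexp (-s * U) * (cexp U * (((A * U + B : ℝ) + (A : ℂ) * (u - U : ℝ)) * cexp (-(s - 1) * (u - U : ℝ)))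
      + ((C * U + D : ℝ) + (C : ℂ) * (u - U : ℝ)) * cexp (-s * (u - U : ℝ))) := by
  have e1 : cexp (-s * U) * cexp (-s * (u - U : ℝ)) = cexp (-s * u) := by
    rw [← Complex.exp_add]; congr 1; push_cast; ring
  have e2 : cexp (-s * U) * (cexp U * cexp (-(s - 1) * (u - U : ℝ))) = cexp u * cexp (-s * u) := by
    rw [← Complex.exp_add, ← Complex.exp_add, ← Complex.exp_add]; congr 1; push_cast; ring
  calc _ = ((A * u + B : ℝ) : ℂ) * (cexp u * cexp (-s * u)) + ((C * u + D : ℝ) : ℂ) * cexp (-s * u) := by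
        simp only [mainTerm]; push_cast; ring
    _ = _ := by
        rw [← e2, ← e1]; push_cast; ring

lemma integrableOn_mainTerm {s : ℂ} (hs : 1 < s.re) (U : ℝ) :
    IntegrableOn (fun u : ℝ => (mainTerm A B C D u : ℂ) * cexp (-s * u)) (Ioi U) := by
  simp only [mainTerm_mul_exp s U]
  refine Integrable.const_mul (Integrable.add (Integrable.const_mul ?_ _) ?_) _
  · exact integrableOn_linear_mul_exp (by simpa using hs) U _ _
  · exact integrableOn_linear_mul_exp (by linarith) U _ _

lemma integral_mainTerm {s : ℂ} (hs : 1 < s.re) (U : ℝ) :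
    ∫ u in Ioi U, (mainTerm A B C D u : ℂ) * cexp (-s * u) =
      cexp (-s * U) * (cexp U * ((A * U + B : ℝ) / (s - 1) + A / (s - 1) ^ 2)
        + ((C * U + D : ℝ) / s + C / s ^ 2)) := by
  simp only [mainTerm_mul_exp s U]
  have h1 := integrableOn_linear_mul_exp (w := s - 1) (by simpa using hs) U (A * U + B : ℝ) A
  have h2 := integrableOn_linear_mul_exp (w := s) (by linarith) U (C * U + D : ℝ) C
  rw [integral_const_mul, integral_add (h1.const_mul _) h2, integral_const_mul,
    integral_linear_mul_exp (by simpa using hs), integral_linear_mul_exp (by linarith)]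

lemma HasMainTerm.integrableOn_jensen (hW : W.HasMainTerm A B C D) {s : ℂ} (hs : 1 < s.re) {U : ℝ}
    (hU : -1 ≤ U) : IntegrableOn (fun u : ℝ => (W.jensen u : ℂ) * cexp (-s * u)) (Ioi U) := by
  have h := (hW.integrableOn_err (s := s) (by linarith) hU).add
    (integrableOn_mainTerm (A := A) (B := B) (C := C) (D := D) hs U)
  refine h.congr (Eventually.of_forall fun u => ?_)
  simp only [err, Pi.add_apply]
  push_cast
  ring

lemma sum_max_le_jensen (S : Finset ι) (u : ℝ) :
    ∑ i ∈ S, (W.mult i : ℝ) * max 0 (u - W.lam i) ≤ W.jensen u := by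
  classical
  have h : W.jensen u = ∑ i ∈ S ∪ W.level u, (W.mult i : ℝ) * max 0 (u - W.lam i) := by
    refine tsum_eq_sum fun i hi => ?_
    have : u < W.lam i := by simpa using fun h => hi (Finset.mem_union_right _ (mem_level.2 h))
    rw [max_eq_left (by linarith), mul_zero]
  rw [h]
  exact Finset.sum_le_sum_of_subset_of_nonneg Finset.subset_union_left fun i _ _ => by positivity

lemma HasMainTerm.summable (hW : W.HasMainTerm A B C D) {σ : ℝ} (hσ : 1 < σ) :
    Summable fun i => (W.mult i : ℝ) * Real.exp (-σ * W.lam i) := by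
  classical
  have h0 : 0 < σ := by linarith
  set J := ∫ u in Ioi (0 : ℝ), ‖(W.jensen u : ℂ) * cexp (-(σ : ℂ) * u)‖ with hJ
  have hbound : ∀ S : Finset ι, (∀ i ∈ S, 0 ≤ W.lam i) →
      ∑ i ∈ S, (W.mult i : ℝ) * Real.exp (-σ * W.lam i) ≤ σ ^ 2 * J := by
    intro S hS
    have hInt : ∀ i ∈ S, Integrable (fun u : ℝ => (W.mult i : ℝ) *
        ‖((max 0 (u - W.lam i) : ℝ) : ℂ) * cexp (-(σ : ℂ) * u)‖) (volume.restrict (Ioi 0)) := fun i _ =>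
      (integrableOn_max_mul_exp (s := (σ : ℂ)) (by simpa using h0) (W.lam i) 0).norm.const_mul _
    calc _ = ∑ i ∈ S, σ ^ 2 * ∫ u in Ioi (0 : ℝ), (W.mult i : ℝ) *
          ‖((max 0 (u - W.lam i) : ℝ) : ℂ) * cexp (-(σ : ℂ) * u)‖ := by
          refine Finset.sum_congr rfl fun i hi => ?_
          rw [integral_const_mul, integral_norm_max_mul_exp (by simpa using h0) (hS i hi)]
          simp only [ofReal_re]
          field_simp
      _ = σ ^ 2 * ∫ u in Ioi (0 : ℝ), ∑ i ∈ S, (W.mult i : ℝ) *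
          ‖((max 0 (u - W.lam i) : ℝ) : ℂ) * cexp (-(σ : ℂ) * u)‖ := by
          rw [← Finset.mul_sum, integral_finsetSum _ hInt]
      _ ≤ _ := by
          refine mul_le_mul_of_nonneg_left ?_ (by positivity)
          refine integral_mono (integrable_finsetSum _ hInt)
            (hW.integrableOn_jensen (s := (σ : ℂ)) (by simpa using hσ) (by norm_num)).norm fun u => ?_
          simp only [norm_mul, Complex.norm_real, Real.norm_of_nonneg (le_max_left (0 : ℝ) _),
            Real.norm_of_nonneg (jensen_nonneg u), ← mul_assoc]
          rw [← Finset.sum_mul]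
          exact mul_le_mul_of_nonneg_right (sum_max_le_jensen S u) (norm_nonneg _)
  refine summable_of_sum_le (c := ∑ i ∈ W.level 0, (W.mult i : ℝ) * Real.exp (-σ * W.lam i) + σ ^ 2 * J)
    (fun i => by positivity) fun S => ?_
  rw [← Finset.sum_filter_add_sum_filter_not S (· ∈ W.level 0)]
  refine add_le_add ?_ (hbound _ fun i hi => ?_)
  · exact Finset.sum_le_sum_of_subset_of_nonneg (fun i hi => (Finset.mem_filter.1 hi).2)
      fun i _ _ => by positivity
  · have := (Finset.mem_filter.1 hi).2
    rw [mem_level, not_le] at this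
    exact this.le

lemma countable (W : WeightedSeq ι) : Countable ι := by
  rw [← Set.countable_univ_iff]
  have : (univ : Set ι) = ⋃ n : ℕ, {i | W.lam i ≤ n} := by
    ext i
    simpa using exists_nat_ge (W.lam i)
  rw [this]
  exact Set.countable_iUnion fun n => (W.finite_le n).countable

variable (W) in
/-- The part of the Dirichlet series over the terms not exceeding `U`. -/
def partialSum (U : ℝ) (s : ℂ) : ℂ := ∑ i ∈ W.level U, (W.mult i : ℂ) * cexp (-s * W.lam i)

variable (W A B C D) in
/-- The boundary terms at `U` in the truncated formula for the Dirichlet series. -/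
def boundary (U : ℝ) (s : ℂ) : ℂ :=
  ((A * U + B) * Real.exp U : ℝ) / (s - 1) + (A * Real.exp U : ℝ) * ((2 * s - 1) / (s - 1) ^ 2)
    - (W.count U - countMain A B C U : ℝ) - s * W.err A B C D U

lemma HasMainTerm.summable_complex (hW : W.HasMainTerm A B C D) {s : ℂ} (hs : 1 < s.re) :
    Summable fun i => (W.mult i : ℂ) * cexp (-s * W.lam i) := by
  refine Summable.of_norm ((hW.summable hs).congr fun i => ?_)
  rw [norm_mul, Complex.norm_exp, Complex.norm_natCast]
  simp

open scoped Classical in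
lemma tsum_tail_eq {U u : ℝ} (h : U ≤ u) (s : ℂ) :
    ∑' i, (if i ∈ W.level U then 0 else (W.mult i : ℂ) * ((max 0 (u - W.lam i) : ℝ) * cexp (-s * u))) =
      (W.jensen u : ℂ) * cexp (-s * u) - ((W.jensen U : ℂ) + W.count U * (u - U : ℝ)) * cexp (-s * u) := by
  have h1 : W.jensen u = (∑ i ∈ W.level u, if i ∈ W.level U then 0 else
      (W.mult i : ℝ) * max 0 (u - W.lam i)) + (W.jensen U + W.count U * (u - U)) := by
    have h2 : W.jensen U + W.count U * (u - U) =
        ∑ i ∈ W.level u, if i ∈ W.level U then (W.mult i : ℝ) * max 0 (u - W.lam i) else 0 := by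
      rw [← Finset.sum_filter, Finset.filter_mem_eq_inter, Finset.inter_eq_right.2 (level_mono h),
        jensen_eq_sum le_rfl, count, Finset.sum_mul, ← Finset.sum_add_distrib]
      refine Finset.sum_congr rfl fun i hi => ?_
      rw [mem_level] at hi
      rw [max_eq_right (by linarith), max_eq_right (by linarith)]
      ring
    rw [h2, ← Finset.sum_add_distrib, jensen_eq_sum le_rfl]
    refine Finset.sum_congr rfl fun i hi => ?_
    split_ifs <;> simp
  rw [tsum_eq_sum (s := W.level u)]
  · rw [← sub_mul, h1]
    push_cast
    rw [add_sub_cancel_right, Finset.sum_mul]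
    refine Finset.sum_congr rfl fun i _ => ?_
    split_ifs
    · simp
    · push_cast; ring
  · intro i hi
    rw [mem_level, not_le] at hi
    rw [max_eq_left (by linarith)]
    simp

lemma HasMainTerm.tsum_eq (hW : W.HasMainTerm A B C D) {s : ℂ} (hs : 1 < s.re) {U : ℝ} (hU : -1 ≤ U) :
    ∑' i, (W.mult i : ℂ) * cexp (-s * W.lam i) = W.partialSum U s
      + cexp (-s * U) * W.boundary A B C D U s
      + s ^ 2 * ∫ u in Ioi U, (W.err A B C D u : ℂ) * cexp (-s * u) := by
  classical
  have := W.countable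
  have hs0 : 0 < s.re := by linarith
  have hsne : s ≠ 0 := by rintro rfl; simp at hs0
  have hs1 : s - 1 ≠ 0 := by
    intro h
    have := congrArg Complex.re h
    simp at this
    linarith
  set F : ι → ℝ → ℂ := fun i u => if i ∈ W.level U then 0 else
    (W.mult i : ℂ) * ((max 0 (u - W.lam i) : ℝ) * cexp (-s * u)) with hF
  have hFint : ∀ i, Integrable (F i) (volume.restrict (Ioi U)) := by
    intro i
    by_cases hi : i ∈ W.level U
    · simp only [hF, hi, if_true]
      exact integrable_zero _ _ _
    · simp only [hF, hi, if_false]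
      exact (integrableOn_max_mul_exp hs0 _ _).const_mul _
  have hFsum : Summable fun i => ∫ u in Ioi U, ‖F i u‖ := by
    refine Summable.of_nonneg_of_le (fun i => integral_nonneg fun u => norm_nonneg _) (fun i => ?_)
      ((hW.summable hs).div_const (s.re ^ 2))
    by_cases hi : i ∈ W.level U
    · simp only [hF, hi, if_true, norm_zero, integral_zero]
      positivity
    · simp only [hF, hi, if_false, norm_mul _ (_ * _), integral_const_mul]
      rw [mem_level, not_le] at hi
      rw [integral_norm_max_mul_exp hs0 hi.le, Complex.norm_natCast, mul_div_assoc]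
  have hsum := hasSum_integral_of_summable_integral_norm hFint hFsum
  have hval : ∀ i, ∫ u in Ioi U, F i u = (if i ∈ W.level U then 0 else
      (W.mult i : ℂ) * cexp (-s * W.lam i)) / s ^ 2 := by
    intro i
    by_cases hi : i ∈ W.level U
    · simp only [hF, hi, if_true, integral_zero, zero_div]
    · simp only [hF, hi, if_false, integral_const_mul]
      rw [mem_level, not_le] at hi
      rw [integral_max_mul_exp hs0 hi.le, mul_div_assoc]
  have hlin : IntegrableOn (fun u : ℝ => ((W.jensen U : ℂ) + W.count U * (u - U : ℝ)) * cexp (-s * u))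
      (Ioi U) := by
    simp only [linear_mul_exp_shift]
    exact (integrableOn_linear_mul_exp hs0 U _ _).const_mul _
  have herr := hW.integrableOn_err (s := s) (by linarith) hU
  have hm := integrableOn_mainTerm (A := A) (B := B) (C := C) (D := D) hs U
  have htail : ∫ u in Ioi U, ∑' i, F i u =
      (∫ u in Ioi U, (W.err A B C D u : ℂ) * cexp (-s * u)) +
      cexp (-s * U) * (cexp U * ((A * U + B : ℝ) / (s - 1) + A / (s - 1) ^ 2)
        + ((C * U + D : ℝ) / s + C / s ^ 2)) -
      cexp (-s * U) * (W.jensen U / s + W.count U / s ^ 2) := by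
    rw [← integral_mainTerm hs U, ← integral_linear_mul_exp hs0 U, ← integral_const_mul,
      ← integral_add herr hm]
    simp only [← linear_mul_exp_shift]
    have hadd : IntegrableOn (fun u : ℝ => (W.err A B C D u : ℂ) * cexp (-s * u) +
      (mainTerm A B C D u : ℂ) * cexp (-s * u)) (Ioi U) := herr.add hm
    rw [← integral_sub hadd hlin]
    refine setIntegral_congr_fun measurableSet_Ioi fun u hu => ?_
    simp only [hF]
    rw [tsum_tail_eq (le_of_lt hu)]
    simp only [err]
    push_cast
    ring
  have hsplit : ∑' i, (W.mult i : ℂ) * cexp (-s * W.lam i) = W.partialSum U s +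
      ∑' i, (if i ∈ W.level U then 0 else (W.mult i : ℂ) * cexp (-s * W.lam i)) := by
    have h1 : W.partialSum U s =
        ∑' i, (if i ∈ W.level U then (W.mult i : ℂ) * cexp (-s * W.lam i) else 0) := by
      rw [tsum_eq_sum (s := W.level U) (fun i hi => if_neg hi)]
      exact Finset.sum_congr rfl fun i hi => (if_pos hi).symm
    have hA : Summable fun i => (if i ∈ W.level U then (W.mult i : ℂ) * cexp (-s * W.lam i) else 0) :=
      summable_of_ne_finset_zero (s := W.level U) fun i hi => if_neg hi
    have hB : Summable fun i => (if i ∈ W.level U then 0 else (W.mult i : ℂ) * cexp (-s * W.lam i)) := by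
      refine ((hW.summable_complex hs).sub hA).congr fun i => ?_
      split_ifs <;> simp
    rw [h1, ← hA.tsum_add hB]
    refine tsum_congr fun i => ?_
    split_ifs <;> simp
  have h2 := hsum.tsum_eq
  simp only [hval] at h2
  rw [tsum_div_const, htail, div_eq_iff (pow_ne_zero 2 hsne)] at h2
  rw [hsplit, h2, add_assoc]
  congr 1
  generalize (∫ u in Ioi U, (W.err A B C D u : ℂ) * cexp (-s * u)) = X
  simp only [boundary, err, mainTerm, countMain]
  push_cast
  generalize cexp (-s * U) = Y
  generalize cexp (U : ℂ) = Z
  field_simp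
  ring

variable (W A B C D) in
/-- The Laplace transform of the error term over `(U, ∞)`. -/
def tail (U : ℝ) (s : ℂ) : ℂ := ∫ u in Ioi U, (W.err A B C D u : ℂ) * cexp (-s * u)

lemma HasMainTerm.differentiableAt_tail (hW : W.HasMainTerm A B C D) {s : ℂ} (hs : -1 < s.re) {U : ℝ}
    (hU : 0 ≤ U) : DifferentiableAt ℂ (W.tail A B C D U) s := by
  set η := (1 + s.re) / 4 with hη
  have hη0 : 0 < η := by rw [hη]; linarith
  obtain ⟨K, hK0, hK⟩ := hW η hη0
  have hm : ∀ z : ℂ, AEStronglyMeasurable (fun u : ℝ => (W.err A B C D u : ℂ) * cexp (-z * u))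
      (volume.restrict (Ioi U)) := fun z =>
    ((Complex.measurable_ofReal.comp measurable_err).mul (by fun_prop)).aestronglyMeasurable
  have h := hasDerivAt_integral_of_dominated_loc_of_deriv_le (μ := volume.restrict (Ioi U))
    (F := fun (z : ℂ) (u : ℝ) => (W.err A B C D u : ℂ) * cexp (-z * u))
    (F' := fun (z : ℂ) (u : ℝ) => (W.err A B C D u : ℂ) * (cexp (-z * u) * -u))
    (bound := fun u => K / η * Real.exp (-η * u)) (x₀ := s) (s := Metric.ball s η)
    (Metric.ball_mem_nhds s hη0) (Eventually.of_forall hm)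
    (hW.integrableOn_err hs (by linarith))
    ((Complex.measurable_ofReal.comp measurable_err).mul (by fun_prop)).aestronglyMeasurable
    ?_ ((integrableOn_exp_mul_Ioi (by linarith) U).const_mul _) ?_
  · exact h.2.differentiableAt
  · filter_upwards [ae_restrict_mem measurableSet_Ioi] with u hu z hz
    have hu0 : 0 ≤ u := hU.trans (le_of_lt hu)
    have h1 := norm_err_mul_exp_le hK z (show -1 ≤ u by linarith)
    have hz1 : s.re - η ≤ z.re := by
      have := (Complex.abs_re_le_norm (z - s)).trans_lt (mem_ball_iff_norm.1 hz)
      rw [sub_re, abs_lt] at this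
      linarith [this.1]
    rw [← mul_assoc, norm_mul, norm_neg, Complex.norm_real, Real.norm_of_nonneg hu0]
    calc _ ≤ K * Real.exp ((η - 1 - z.re) * u) * (Real.exp (η * u) / η) := by
          gcongr
          exact le_exp_mul_div hη0 u
      _ ≤ K * Real.exp ((-2 * η) * u) * (Real.exp (η * u) / η) := by
          gcongr
          linarith
      _ = K / η * (Real.exp ((-2 * η) * u) * Real.exp (η * u)) := by ring
      _ = _ := by rw [← Real.exp_add]; ring_nf
  · filter_upwards with u z _
    have h0 : HasDerivAt (fun z : ℂ => -z * u) (-(u : ℂ)) z := by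
      simpa using (hasDerivAt_id z).neg.mul_const (u : ℂ)
    exact h0.cexp.const_mul _

variable (W) in
lemma differentiable_partialSum (U : ℝ) : Differentiable ℂ (W.partialSum U) := by
  unfold partialSum
  fun_prop

/-- The truncated formula for the analytic continuation of the Dirichlet series. -/
lemma HasMainTerm.continuation_eq (hW : W.HasMainTerm A B C D) {R : ℂ → ℂ}
    (hser : ∀ s : ℂ, 1 < s.re → R s = ∑' i, (W.mult i : ℂ) * cexp (-s * W.lam i))
    (hR : ∀ s : ℂ, -1 < s.re → s ≠ 1 → DifferentiableAt ℂ R s) {U : ℝ} (hU : 0 ≤ U) {s : ℂ}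
    (hs : -1 < s.re) (hs' : 0 < s.im) :
    R s = W.partialSum U s + cexp (-s * U) * W.boundary A B C D U s + s ^ 2 * W.tail A B C D U s := by
  set Ω : Set ℂ := {s | -1 < s.re} ∩ {s | 0 < s.im} with hΩ
  have hopen : IsOpen Ω := (isOpen_lt continuous_const Complex.continuous_re).inter
    (isOpen_lt continuous_const Complex.continuous_im)
  have hconv : Convex ℝ Ω := (convex_halfSpace_re_gt _).inter (convex_halfSpace_im_gt _)
  have hne : ∀ z ∈ Ω, z ≠ 1 := by
    rintro z hz rfl
    simpa using hz.2
  have h1 : DifferentiableOn ℂ R Ω := fun z hz =>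
    (hR z hz.1 (hne z hz)).differentiableWithinAt
  have h2 : DifferentiableOn ℂ (fun s => W.partialSum U s + cexp (-s * U) * W.boundary A B C D U s
      + s ^ 2 * W.tail A B C D U s) Ω := by
    intro z hz
    have hz1 : z - 1 ≠ 0 := sub_ne_zero.2 (hne z hz)
    have hd := hW.differentiableAt_tail hz.1 hU
    have hp := W.differentiable_partialSum U z
    have hb : DifferentiableAt ℂ (W.boundary A B C D U) z := by
      unfold boundary
      fun_prop (disch := simpa using hz1)
    exact DifferentiableAt.differentiableWithinAt (by fun_prop)
  have hmem : (2 + I : ℂ) ∈ Ω := by simp [hΩ]; norm_num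
  have hev : R =ᶠ[nhds (2 + I : ℂ)] fun s => W.partialSum U s + cexp (-s * U) * W.boundary A B C D U s
      + s ^ 2 * W.tail A B C D U s := by
    have : {s : ℂ | 1 < s.re} ∈ nhds (2 + I : ℂ) :=
      (isOpen_lt continuous_const Complex.continuous_re).mem_nhds (by simp)
    filter_upwards [this] with z hz
    rw [hser z hz, hW.tsum_eq hz (by linarith : -1 ≤ U), tail]
  exact (h1.analyticOnNhd hopen).eqOn_of_preconnected_of_eventuallyEq (h2.analyticOnNhd hopen)
    hconv.isPreconnected hmem hev ⟨hs, hs'⟩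

end WeightedSeq

/-! ### A mean square estimate -/

lemma integral_gaussian_mul_cexp {T : ℝ} (hT : 0 < T) (d : ℝ) :
    ∫ t : ℝ, (Real.exp (-(1 / T ^ 2) * t ^ 2) : ℂ) * cexp (-(t * d : ℝ) * I) =
      ((√π * T * Real.exp (-(T ^ 2 * d ^ 2 / 4)) : ℝ) : ℂ) := by
  have hb : 0 < ((1 / T ^ 2 : ℝ) : ℂ).re := by rw [ofReal_re]; positivity
  have h := fourierIntegral_gaussian hb (-(d : ℂ))
  have e1 : ((π : ℂ) / ((1 / T ^ 2 : ℝ) : ℂ)) ^ (1 / 2 : ℂ) = ((√π * T : ℝ) : ℂ) := by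
    have : (π : ℂ) / ((1 / T ^ 2 : ℝ) : ℂ) = ((π * T ^ 2 : ℝ) : ℂ) := by
      push_cast; field_simp
    rw [this, show (1 / 2 : ℂ) = ((1 / 2 : ℝ) : ℂ) by push_cast; rfl,
      ← Complex.ofReal_cpow (by positivity), ← Real.sqrt_eq_rpow, Real.sqrt_mul Real.pi_pos.le,
      Real.sqrt_sq hT.le]
  rw [e1] at h
  push_cast at h ⊢
  convert h using 1
  · refine integral_congr_ae (Eventually.of_forall fun t => ?_)
    simp only
    rw [mul_comm]
    congr 2
    ring
  · congr 2
    have : (T : ℂ) ≠ 0 := by exact_mod_cast hT.ne'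
    field_simp

lemma lintegral_mul_gaussian_le {μ : Measure ℝ} [SFinite μ] {f : ℝ → ℝ} (hf : Measurable f)
    {G : ℝ × ℝ → ℝ} (hG : Measurable G) (hG0 : ∀ p, 0 ≤ G p)
    (hGs : ∀ x y, G (x, y) = G (y, x)) {κ : ENNReal}
    (hκ : ∀ x, ∫⁻ y, ENNReal.ofReal (G (x, y)) ∂μ ≤ κ) :
    ∫⁻ p, ENNReal.ofReal (f p.1 * f p.2 * G p) ∂(μ.prod μ) ≤
      κ * ∫⁻ x, ENNReal.ofReal (f x ^ 2) ∂μ := by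
  have hm1 : Measurable fun p : ℝ × ℝ => ENNReal.ofReal (f p.1 ^ 2 / 2) * ENNReal.ofReal (G p) :=
    (((hf.comp measurable_fst).pow_const 2).div_const 2).ennreal_ofReal.mul hG.ennreal_ofReal
  have hm2 : Measurable fun p : ℝ × ℝ => ENNReal.ofReal (f p.2 ^ 2 / 2) * ENNReal.ofReal (G p) :=
    (((hf.comp measurable_snd).pow_const 2).div_const 2).ennreal_ofReal.mul hG.ennreal_ofReal
  have h1 : ∫⁻ p, ENNReal.ofReal (f p.1 ^ 2 / 2) * ENNReal.ofReal (G p) ∂(μ.prod μ) ≤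
      κ * ∫⁻ x, ENNReal.ofReal (f x ^ 2 / 2) ∂μ := by
    rw [lintegral_prod _ hm1.aemeasurable, ← lintegral_const_mul _
      ((hf.pow_const 2).div_const 2).ennreal_ofReal]
    refine lintegral_mono fun x => ?_
    dsimp only
    rw [lintegral_const_mul' _ _ ENNReal.ofReal_ne_top, mul_comm]
    gcongr
    exact hκ x
  have h2 : ∫⁻ p, ENNReal.ofReal (f p.2 ^ 2 / 2) * ENNReal.ofReal (G p) ∂(μ.prod μ) =
      ∫⁻ p, ENNReal.ofReal (f p.1 ^ 2 / 2) * ENNReal.ofReal (G p) ∂(μ.prod μ) := by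
    rw [← lintegral_prod_swap]
    refine lintegral_congr fun p => ?_
    rw [show G p.swap = G p from hGs _ _]
    rfl
  calc _ ≤ ∫⁻ p, (ENNReal.ofReal (f p.1 ^ 2 / 2) * ENNReal.ofReal (G p) +
        ENNReal.ofReal (f p.2 ^ 2 / 2) * ENNReal.ofReal (G p)) ∂(μ.prod μ) := by
        refine lintegral_mono fun p => ?_
        rw [← add_mul, ← ENNReal.ofReal_add (by positivity) (by positivity),
          ← ENNReal.ofReal_mul (by positivity)]
        apply ENNReal.ofReal_le_ofReal
        refine mul_le_mul_of_nonneg_right ?_ (hG0 p)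
        nlinarith [sq_nonneg (f p.1 - f p.2)]
    _ ≤ κ * ∫⁻ x, ENNReal.ofReal (f x ^ 2 / 2) ∂μ + κ * ∫⁻ x, ENNReal.ofReal (f x ^ 2 / 2) ∂μ := by
        rw [lintegral_add_left hm1, h2]
        gcongr
    _ = _ := by
        rw [← mul_add, ← lintegral_add_left ((hf.pow_const 2).div_const 2).ennreal_ofReal]
        congr 1
        refine lintegral_congr fun x => ?_
        rw [← ENNReal.ofReal_add (by positivity) (by positivity), add_halves]

lemma integral_norm_sq_le {μ : Measure ℝ} [SFinite μ] {φ : ℝ → ℂ} (hφm : Measurable φ)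
    (hφ : Integrable φ μ) (hφ2 : Integrable (fun x => ‖φ x‖ ^ 2) μ) {T κ : ℝ} (hT : 1 ≤ T)
    (hκ0 : 0 ≤ κ)
    (hκ : ∀ x, ∫⁻ y, ENNReal.ofReal (Real.exp (-(T ^ 2 * (x - y) ^ 2 / 4))) ∂μ ≤ ENNReal.ofReal κ) :
    ∫ t in (1 : ℝ)..T, ‖∫ x, φ x * cexp (-(t * x : ℝ) * I) ∂μ‖ ^ 2 ≤
      Real.exp 1 * (√π * T * (κ * ∫ x, ‖φ x‖ ^ 2 ∂μ)) := by
  have hT0 : 0 < T := by linarith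
  set F : ℝ → ℂ := fun t => ∫ x, φ x * cexp (-(t * x : ℝ) * I) ∂μ with hF
  set w : ℝ → ℝ := fun t => Real.exp (-(1 / T ^ 2) * t ^ 2) with hw
  set Φ : ℝ × ℝ → ℂ := fun p => φ p.1 * (starRingEnd ℂ) (φ p.2) with hΦ
  have hφc : Integrable (fun x => (starRingEnd ℂ) (φ x)) μ :=
    hφ.mono (Complex.continuous_conj.measurable.comp hφm).aestronglyMeasurable
      (Eventually.of_forall fun x => by simp)
  have hΦi : Integrable Φ (μ.prod μ) := hφ.mul_prod hφc
  have hwi : Integrable (fun t => (w t : ℂ)) :=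
    (integrable_exp_neg_mul_sq (by positivity : 0 < 1 / T ^ 2)).ofReal
  set H : ℝ → ℝ × ℝ → ℂ := fun t p => cexp (-(t * (p.1 - p.2) : ℝ) * I) * ((w t : ℂ) * Φ p) with hH
  have hHi : Integrable (Function.uncurry H) (volume.prod (μ.prod μ)) := by
    refine Integrable.bdd_mul (c := 1) (hwi.mul_prod hΦi) ?_ ?_
    · exact Continuous.aestronglyMeasurable (by fun_prop)
    · refine Eventually.of_forall fun q => ?_
      rw [show (-((q.1 * (q.2.1 - q.2.2) : ℝ) : ℂ) * I) = ((-(q.1 * (q.2.1 - q.2.2)) : ℝ) : ℂ) * I by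
        push_cast; ring, Complex.norm_exp_ofReal_mul_I]
  have hFsq : ∀ t, ∫ p, H t p ∂(μ.prod μ) = ((w t * ‖F t‖ ^ 2 : ℝ) : ℂ) := by
    intro t
    have h1 : ((‖F t‖ ^ 2 : ℝ) : ℂ) = F t * (starRingEnd ℂ) (F t) := by
      rw [Complex.mul_conj, Complex.normSq_eq_norm_sq]
    rw [ofReal_mul, h1, hF, ← integral_conj, ← integral_prod_mul, ← integral_const_mul]
    refine integral_congr_ae (Eventually.of_forall fun p => ?_)
    simp only [hH, hΦ, map_mul, ← Complex.exp_conj, map_neg, conj_ofReal, conj_I]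
    have : cexp (-(t * (p.1 - p.2) : ℝ) * I) = cexp (-(t * p.1 : ℝ) * I) * cexp (-(t * p.2 : ℝ) * -I) := by
      rw [← Complex.exp_add]; congr 1; push_cast; ring
    rw [this]
    ring
  have hwF : Integrable fun t => w t * ‖F t‖ ^ 2 := by
    have := hHi.integral_prod_left
    simp only [Function.uncurry_apply_pair, hFsq] at this
    exact this.re
  have hswap : ((∫ t, w t * ‖F t‖ ^ 2 : ℝ) : ℂ) =
      ∫ p, Φ p * ((√π * T * Real.exp (-(T ^ 2 * (p.1 - p.2) ^ 2 / 4)) : ℝ) : ℂ) ∂(μ.prod μ) := by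
    rw [← integral_complex_ofReal]
    simp only [← hFsq]
    rw [integral_integral_swap hHi]
    refine integral_congr_ae (Eventually.of_forall fun p => ?_)
    simp only
    rw [← integral_gaussian_mul_cexp hT0, ← integral_const_mul]
    refine integral_congr_ae (Eventually.of_forall fun t => ?_)
    simp only [hH, hw]
    ring
  set G : ℝ × ℝ → ℝ := fun p => Real.exp (-(T ^ 2 * (p.1 - p.2) ^ 2 / 4)) with hG
  have hbound : ∫ t, w t * ‖F t‖ ^ 2 ≤ √π * T * (κ * ∫ x, ‖φ x‖ ^ 2 ∂μ) := by
    have hInt0 : 0 ≤ ∫ t, w t * ‖F t‖ ^ 2 := integral_nonneg fun t => by positivity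
    have h2 : ENNReal.ofReal (κ * ∫ x, ‖φ x‖ ^ 2 ∂μ) =
        ENNReal.ofReal κ * ∫⁻ x, ENNReal.ofReal (‖φ x‖ ^ 2) ∂μ := by
      rw [ENNReal.ofReal_mul hκ0, ofReal_integral_eq_lintegral_ofReal hφ2
        (Eventually.of_forall fun x => by positivity)]
    have h3 := lintegral_mul_gaussian_le (μ := μ) (f := fun x => ‖φ x‖) hφm.norm
      (G := G) (by fun_prop) (fun p => (Real.exp_pos _).le)
      (fun x y => by simp only [hG]; ring_nf) hκ
    calc ∫ t, w t * ‖F t‖ ^ 2 = ‖((∫ t, w t * ‖F t‖ ^ 2 : ℝ) : ℂ)‖ := by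
          rw [Complex.norm_real, Real.norm_of_nonneg hInt0]
      _ ≤ (∫⁻ p, ENNReal.ofReal ‖Φ p * ((√π * T * G p : ℝ) : ℂ)‖ ∂(μ.prod μ)).toReal := by
          rw [hswap]; exact norm_integral_le_lintegral_norm _
      _ = (∫⁻ p, ENNReal.ofReal (√π * T) * ENNReal.ofReal (‖φ p.1‖ * ‖φ p.2‖ * G p)
            ∂(μ.prod μ)).toReal := by
          congr 1
          refine lintegral_congr fun p => ?_
          rw [← ENNReal.ofReal_mul (by positivity)]
          congr 1
          have : 0 ≤ √π * T * G p := by positivity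
          rw [norm_mul, Complex.norm_real, Real.norm_of_nonneg this, hΦ, norm_mul, RCLike.norm_conj]
          ring
      _ ≤ (ENNReal.ofReal (√π * T) * ENNReal.ofReal (κ * ∫ x, ‖φ x‖ ^ 2 ∂μ)).toReal := by
          rw [lintegral_const_mul' _ _ ENNReal.ofReal_ne_top, h2]
          refine ENNReal.toReal_mono ?_ (mul_le_mul_right h3 _)
          rw [← h2]
          exact ENNReal.mul_ne_top ENNReal.ofReal_ne_top ENNReal.ofReal_ne_top
      _ = _ := by
          have : 0 ≤ ∫ x, ‖φ x‖ ^ 2 ∂μ := integral_nonneg fun x => by positivity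
          rw [ENNReal.toReal_mul, ENNReal.toReal_ofReal (by positivity),
            ENNReal.toReal_ofReal (by positivity)]
  calc ∫ t in (1 : ℝ)..T, ‖F t‖ ^ 2 = ∫ t in Ioc 1 T, ‖F t‖ ^ 2 := intervalIntegral.integral_of_le hT
    _ ≤ ∫ t in Ioc 1 T, Real.exp 1 * (w t * ‖F t‖ ^ 2) := by
        refine integral_mono_of_nonneg (Eventually.of_forall fun t => by positivity)
          (hwF.const_mul _).integrableOn ?_
        filter_upwards [ae_restrict_mem measurableSet_Ioc] with t ht
        rw [← mul_assoc, hw, ← Real.exp_add]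
        refine le_mul_of_one_le_left (by positivity) (Real.one_le_exp ?_)
        have : t ^ 2 ≤ T ^ 2 := by
          have := ht.1
          exact pow_le_pow_left₀ (by linarith) ht.2 2
        have : 1 / T ^ 2 * t ^ 2 ≤ 1 := by
          rw [div_mul_eq_mul_div, one_mul]; exact div_le_one_of_le₀ this (by positivity)
        linarith
    _ ≤ ∫ t, Real.exp 1 * (w t * ‖F t‖ ^ 2) :=
        setIntegral_le_integral (hwF.const_mul _) (Eventually.of_forall fun t => by positivity)
    _ ≤ _ := by
        rw [integral_const_mul]
        gcongr

namespace WeightedSeq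

variable {ι : Type*} {W : WeightedSeq ι} {A B C D : ℝ}

lemma abs_countMain_sub_le {U v v' : ℝ} (h0 : 0 ≤ v') (h1 : v' ≤ v) (h2 : v ≤ U) :
    |countMain A B C v - countMain A B C v'| ≤
      (|A| * U + |2 * A + B|) * Real.exp U * (v - v') := by
  have hd : ∀ u ∈ Icc 0 U, HasDerivWithinAt (countMain A B C)
      ((A * u + (2 * A + B)) * Real.exp u) (Icc 0 U) u := by
    intro u _
    have h := (((((hasDerivAt_id u).const_mul A).add_const (A + B)).mul (Real.hasDerivAt_exp u)).add_const C)
    refine HasDerivAt.hasDerivWithinAt (h.congr_deriv ?_)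
    simp only [id]
    ring
  have hb : ∀ u ∈ Icc 0 U, ‖(A * u + (2 * A + B)) * Real.exp u‖ ≤
      (|A| * U + |2 * A + B|) * Real.exp U := by
    intro u hu
    rw [norm_mul, Real.norm_of_nonneg (Real.exp_pos u).le]
    refine mul_le_mul ?_ (Real.exp_le_exp.2 hu.2) (Real.exp_pos u).le
      (add_nonneg (mul_nonneg (abs_nonneg _) (hu.1.trans hu.2)) (abs_nonneg _))
    refine (norm_add_le _ _).trans (add_le_add ?_ le_rfl)
    rw [norm_mul, Real.norm_of_nonneg hu.1]
    exact mul_le_mul_of_nonneg_left hu.2 (abs_nonneg _)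
  have := (convex_Icc 0 U).norm_image_sub_le_of_norm_hasDerivWithin_le hd hb
    ⟨h0, h1.trans h2⟩ ⟨h0.trans h1, h2⟩
  rwa [Real.norm_eq_abs, Real.norm_of_nonneg (sub_nonneg.2 h1)] at this

lemma HasMainTerm.exists_count_sub_le (hW : W.HasMainTerm A B C D) {ε : ℝ} (hε : 0 < ε) :
    ∃ K : ℝ, 0 ≤ K ∧ ∀ U v v' : ℝ, 0 ≤ v' → v' ≤ v → v ≤ U → v - v' ≤ 3 * Real.exp ((ε - 1) * U) →
      W.count v - W.count v' ≤ K * Real.exp (2 * ε * U) := by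
  obtain ⟨K, hK, hc⟩ := hW.exists_abs_count_sub_le hε
  refine ⟨3 * (|A| / ε + |2 * A + B|) + 2 * K, by positivity, fun U v v' h0 h1 h2 h3 => ?_⟩
  have hU : 0 ≤ U := by linarith
  have hE1 : 1 ≤ Real.exp (ε * U) := Real.one_le_exp (by positivity)
  have a1 := (abs_le.1 (hc v (h0.trans h1))).2
  have a2 := (abs_le.1 (hc v' h0)).1
  have a3 := (abs_le.1 (abs_countMain_sub_le (A := A) (B := B) (C := C) h0 h1 h2)).2
  have a4 : K * Real.exp (ε * v) ≤ K * Real.exp (ε * U) := by gcongr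
  have a5 : K * Real.exp (ε * v') ≤ K * Real.exp (ε * U) := by
    gcongr
    linarith
  have a6 : Real.exp (ε * U) ≤ Real.exp (2 * ε * U) := by
    apply Real.exp_le_exp.2; nlinarith
  have a7 : (|A| * U + |2 * A + B|) * Real.exp U * (v - v') ≤
      3 * (|A| / ε + |2 * A + B|) * Real.exp (2 * ε * U) := by
    calc _ ≤ (|A| * (Real.exp (ε * U) / ε) + |2 * A + B| * Real.exp (ε * U)) * Real.exp U *
          (3 * Real.exp ((ε - 1) * U)) := by
          gcongr
          · exact le_exp_mul_div hε U
          · exact le_mul_of_one_le_right (abs_nonneg _) hE1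
      _ = 3 * (|A| / ε + |2 * A + B|) *
          (Real.exp (ε * U) * Real.exp U * Real.exp ((ε - 1) * U)) := by ring
      _ = _ := by rw [← Real.exp_add, ← Real.exp_add]; ring_nf
  have a8 := mul_le_mul_of_nonneg_left a6 hK
  linarith

lemma exists_exp_mul_exp_neg_le {ε : ℝ} (hε : 0 < ε) : ∃ c : ℝ, 0 ≤ c ∧ ∀ U : ℝ, 0 ≤ U →
    Real.exp (2 * U) * Real.exp (-(Real.exp (2 * ε * U) / 4)) ≤ c := by
  set n := ⌈1 / ε⌉₊
  have hn : 1 ≤ ε * n := by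
    have := Nat.le_ceil (1 / ε)
    rwa [div_le_iff₀ hε, mul_comm] at this
  refine ⟨4 ^ n * n.factorial, by positivity, fun U hU => ?_⟩
  have h := Real.pow_div_factorial_le_exp (Real.exp (2 * ε * U) / 4) (by positivity) n
  rw [div_le_iff₀ (by positivity), div_pow, div_le_iff₀ (by positivity), ← Real.exp_nat_mul] at h
  rw [Real.exp_neg, ← div_eq_mul_inv, div_le_iff₀ (Real.exp_pos _)]
  calc Real.exp (2 * U) ≤ Real.exp (n * (2 * ε * U)) := by
        apply Real.exp_le_exp.2; nlinarith
    _ ≤ _ := by linarith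

lemma HasMainTerm.exists_count_le (hW : W.HasMainTerm A B C D) :
    ∃ K : ℝ, 0 ≤ K ∧ ∀ U : ℝ, 0 ≤ U → W.count U ≤ K * Real.exp (2 * U) := by
  obtain ⟨K, hK, hc⟩ := hW.exists_abs_count_sub_le one_pos
  refine ⟨|A| + |A + B| + |C| + K, by positivity, fun U hU => ?_⟩
  have a1 := (abs_le.1 (hc U hU)).2
  have h1 : 1 ≤ Real.exp U := Real.one_le_exp hU
  have h2 : U ≤ Real.exp U := by linarith [Real.add_one_le_exp U]
  have h3 : Real.exp (2 * U) = Real.exp U * Real.exp U := by rw [← Real.exp_add]; ring_nf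
  have h4 : countMain A B C U ≤ (|A| * Real.exp U + |A + B| * Real.exp U) * Real.exp U +
      |C| * (Real.exp U * Real.exp U) := by
    unfold countMain
    gcongr ?_ * _ + ?_
    · gcongr ?_ + ?_
      · exact mul_le_mul (le_abs_self A) h2 hU (abs_nonneg _)
      · exact (le_abs_self _).trans (le_mul_of_one_le_right (abs_nonneg _) h1)
    · exact (le_abs_self _).trans (le_mul_of_one_le_right (abs_nonneg _) (by nlinarith))
  have h5 : K * Real.exp (1 * U) ≤ K * (Real.exp U * Real.exp U) := by
    rw [one_mul]
    gcongr
    nlinarith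
  rw [h3]
  linarith

/-- With Gaussian weights of width `exp (-U)`, few terms not exceeding `U` are near a given point. -/
lemma HasMainTerm.exists_gaussian_sum_le (hW : W.HasMainTerm A B C D) {ε : ℝ} (hε : 0 < ε)
    (hε1 : ε ≤ 1) : ∃ K : ℝ, 0 ≤ K ∧ ∀ U : ℝ, 0 ≤ U → ∀ x : ℝ,
    ∑ i ∈ W.level U, (W.mult i : ℝ) * Real.exp (-(Real.exp U ^ 2 * (x - W.lam i) ^ 2 / 4)) ≤
      K * Real.exp (2 * ε * U) := by
  classical
  obtain ⟨K₁, hK₁, h1⟩ := hW.exists_count_sub_le hε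
  obtain ⟨K₂, hK₂, h2⟩ := hW.exists_count_le
  obtain ⟨c, hc, h3⟩ := exists_exp_mul_exp_neg_le hε
  have hc3 : 0 ≤ W.count 3 := count_nonneg 3
  refine ⟨K₁ + W.count 3 + K₂ * c, by positivity, fun U hU x => ?_⟩
  have hE1 : 1 ≤ Real.exp (2 * ε * U) := Real.one_le_exp (by positivity)
  set δ := Real.exp ((ε - 1) * U) with hδ
  have hδ0 : 0 < δ := Real.exp_pos _
  have hδ1 : δ ≤ 1 := Real.exp_le_one_iff.2 (by nlinarith)
  have hδ2 : Real.exp U ^ 2 * δ ^ 2 = Real.exp (2 * ε * U) := by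
    rw [hδ, ← Real.exp_nat_mul, ← Real.exp_nat_mul, ← Real.exp_add]; push_cast; ring_nf
  have hnear : ∑ i ∈ (W.level U).filter (fun i => |x - W.lam i| ≤ δ), (W.mult i : ℝ) ≤
      (K₁ + W.count 3) * Real.exp (2 * ε * U) := by
    set v := min (x + δ) U with hv
    set v' := x - 2 * δ with hv'
    rcases lt_or_ge v' 0 with hneg | hpos
    · calc _ ≤ W.count 3 := by
            refine Finset.sum_le_sum_of_subset_of_nonneg (fun i hi => ?_) fun _ _ _ => by positivity
            rw [Finset.mem_filter, abs_le] at hi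
            rw [mem_level]
            linarith [hi.2.1]
        _ ≤ W.count 3 * Real.exp (2 * ε * U) := le_mul_of_one_le_right hc3 hE1
        _ ≤ _ := by gcongr; linarith
    · rcases le_or_gt v' v with hle | hlt
      · have hlev := level_mono (W := W) hle
        calc _ ≤ ∑ i ∈ W.level v \ W.level v', (W.mult i : ℝ) := by
              refine Finset.sum_le_sum_of_subset_of_nonneg (fun i hi => ?_) fun _ _ _ => by positivity
              rw [Finset.mem_filter, abs_le, mem_level] at hi
              rw [Finset.mem_sdiff, mem_level, mem_level, hv, le_min_iff, not_le]
              exact ⟨⟨by linarith [hi.2.1], hi.1⟩, by linarith [hi.2.2]⟩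
          _ = W.count v - W.count v' := by
              rw [eq_sub_iff_add_eq]; exact Finset.sum_sdiff hlev
          _ ≤ K₁ * Real.exp (2 * ε * U) := by
              refine h1 U v v' hpos hle (min_le_right _ _) ?_
              linarith [min_le_left (x + δ) U]
          _ ≤ _ := by gcongr; linarith
      · rw [Finset.filter_eq_empty_iff.2, Finset.sum_empty]
        · positivity
        · intro i hi hi'
          rw [mem_level] at hi
          rw [abs_le] at hi'
          have : W.lam i ≤ v := le_min (by linarith [hi'.1]) hi
          linarith [hi'.2]
  have hfar : ∑ i ∈ W.level U, (W.mult i : ℝ) * Real.exp (-(Real.exp (2 * ε * U) / 4)) ≤ K₂ * c := by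
    rw [← Finset.sum_mul]
    calc _ ≤ K₂ * Real.exp (2 * U) * Real.exp (-(Real.exp (2 * ε * U) / 4)) := by
          gcongr
          exact h2 U hU
      _ ≤ _ := by rw [mul_assoc]; gcongr; exact h3 U hU
  calc _ ≤ ∑ i ∈ W.level U, ((if |x - W.lam i| ≤ δ then (W.mult i : ℝ) else 0) +
        (W.mult i : ℝ) * Real.exp (-(Real.exp (2 * ε * U) / 4))) := by
        refine Finset.sum_le_sum fun i _ => ?_
        split_ifs with h
        · have : Real.exp (-(Real.exp U ^ 2 * (x - W.lam i) ^ 2 / 4)) ≤ 1 :=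
            Real.exp_le_one_iff.2 (by rw [neg_nonpos]; positivity)
          have : (W.mult i : ℝ) * Real.exp (-(Real.exp U ^ 2 * (x - W.lam i) ^ 2 / 4)) ≤ W.mult i :=
            mul_le_of_le_one_right (by positivity) this
          have : 0 ≤ (W.mult i : ℝ) * Real.exp (-(Real.exp (2 * ε * U) / 4)) := by positivity
          linarith
        · rw [zero_add]
          refine mul_le_mul_of_nonneg_left (Real.exp_le_exp.2 ?_) (by positivity)
          rw [← hδ2]
          have : δ ^ 2 ≤ (x - W.lam i) ^ 2 := by
            rw [← sq_abs (x - W.lam i)]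
            exact pow_le_pow_left₀ hδ0.le (not_le.1 h).le 2
          have := mul_le_mul_of_nonneg_left this (sq_nonneg (Real.exp U))
          linarith
    _ ≤ (K₁ + W.count 3) * Real.exp (2 * ε * U) + K₂ * c := by
        rw [Finset.sum_add_distrib, ← Finset.sum_filter]
        exact add_le_add hnear hfar
    _ ≤ _ := by nlinarith [mul_nonneg hK₂ hc]

lemma HasMainTerm.exists_sum_exp_le (hW : W.HasMainTerm A B C D) (σ : ℝ) {ε : ℝ} (hε : 0 < ε) :
    ∃ K : ℝ, 0 ≤ K ∧ ∀ U : ℝ, 0 ≤ U →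
    ∑ i ∈ W.level U, (W.mult i : ℝ) * Real.exp (-(2 * σ) * W.lam i) ≤
      K * Real.exp (max 0 (1 + ε - 2 * σ) * U) := by
  rcases le_or_gt (2 * σ) (1 + ε) with h | h
  · have hs := hW.summable (show 1 < 1 + ε by linarith)
    refine ⟨∑' i, (W.mult i : ℝ) * Real.exp (-(1 + ε) * W.lam i),
      tsum_nonneg fun i => by positivity, fun U hU => ?_⟩
    rw [max_eq_right (by linarith)]
    calc _ ≤ ∑ i ∈ W.level U, (W.mult i : ℝ) * Real.exp (-(1 + ε) * W.lam i) *
          Real.exp ((1 + ε - 2 * σ) * U) := by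
          refine Finset.sum_le_sum fun i hi => ?_
          rw [mem_level] at hi
          rw [mul_assoc, ← Real.exp_add]
          gcongr
          nlinarith
      _ ≤ _ := by
          rw [← Finset.sum_mul]
          gcongr
          exact hs.sum_le_tsum _ fun i _ => by positivity
  · have hs := hW.summable (show 1 < 2 * σ by linarith)
    refine ⟨∑' i, (W.mult i : ℝ) * Real.exp (-(2 * σ) * W.lam i),
      tsum_nonneg fun i => by positivity, fun U hU => ?_⟩
    rw [max_eq_left (by linarith), zero_mul, Real.exp_zero, mul_one]
    exact hs.sum_le_tsum _ fun i _ => by positivity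

variable (W) in
/-- The sum of the point masses at the terms not exceeding `U`. -/
def levelMeasure (U : ℝ) : Measure ℝ :=
  ∑ i ∈ W.level U, (W.mult i : ENNReal) • Measure.dirac (W.lam i)

instance (U : ℝ) : IsFiniteMeasure (W.levelMeasure U) := by
  constructor
  simp only [levelMeasure, Measure.coe_finsetSum, Finset.sum_apply, Measure.smul_apply, measure_univ,
    smul_eq_mul, mul_one]
  exact ENNReal.sum_lt_top.2 fun i _ => ENNReal.natCast_lt_top _

lemma integrable_levelMeasure {E : Type*} [NormedAddCommGroup E] {U : ℝ} (f : ℝ → E) :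
    Integrable f (W.levelMeasure U) := by
  refine integrable_finsetSum_measure.2 fun i _ => ?_
  exact Integrable.smul_measure (integrable_dirac (by simp)) (ENNReal.natCast_ne_top _)

lemma integral_levelMeasure {E : Type*} [NormedAddCommGroup E] [NormedSpace ℝ E] [CompleteSpace E]
    {U : ℝ} (f : ℝ → E) :
    ∫ x, f x ∂(W.levelMeasure U) = ∑ i ∈ W.level U, (W.mult i : ℝ) • f (W.lam i) := by
  rw [levelMeasure, integral_finsetSum_measure]
  · simp [integral_smul_measure]
  · exact fun i _ => Integrable.smul_measure (integrable_dirac (by simp)) (ENNReal.natCast_ne_top _)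

lemma HasMainTerm.exists_partialSum_le (hW : W.HasMainTerm A B C D) (σ : ℝ) {ε : ℝ} (hε : 0 < ε)
    (hε1 : ε ≤ 1) : ∃ K : ℝ, 0 ≤ K ∧ ∀ U : ℝ, 0 ≤ U →
    ∫ t in (1 : ℝ)..Real.exp U, ‖W.partialSum U (σ + t * I)‖ ^ 2 ≤
      K * Real.exp ((max 1 (2 - 2 * σ) + 3 * ε) * U) := by
  obtain ⟨K₁, hK₁, h1⟩ := hW.exists_gaussian_sum_le hε hε1
  obtain ⟨K₂, hK₂, h2⟩ := hW.exists_sum_exp_le σ hε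
  refine ⟨Real.exp 1 * √π * (K₁ * K₂), by positivity, fun U hU => ?_⟩
  set μ := W.levelMeasure U with hμ
  set φ : ℝ → ℂ := fun x => cexp (-(σ * x : ℝ)) with hφ
  have hφn : ∀ x, ‖φ x‖ ^ 2 = Real.exp (-(2 * σ) * x) := fun x => by
    simp only [hφ, Complex.norm_exp, ← Real.exp_nat_mul]
    congr 1
    rw [neg_re, ofReal_re]
    push_cast
    ring
  have hκ : ∀ x, ∫⁻ y, ENNReal.ofReal (Real.exp (-(Real.exp U ^ 2 * (x - y) ^ 2 / 4))) ∂μ ≤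
      ENNReal.ofReal (K₁ * Real.exp (2 * ε * U)) := by
    intro x
    rw [← ofReal_integral_eq_lintegral_ofReal (integrable_levelMeasure _)
      (Eventually.of_forall fun y => (Real.exp_pos _).le), integral_levelMeasure]
    exact ENNReal.ofReal_le_ofReal (h1 U hU x)
  have key := integral_norm_sq_le (μ := μ) (φ := φ) (by fun_prop) (integrable_levelMeasure _)
    (integrable_levelMeasure _) (Real.one_le_exp hU) (by positivity) hκ
  have hsum : ∀ t : ℝ, ∫ x, φ x * cexp (-(t * x : ℝ) * I) ∂μ = W.partialSum U (σ + t * I) := by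
    intro t
    rw [integral_levelMeasure, partialSum]
    refine Finset.sum_congr rfl fun i _ => ?_
    rw [Complex.real_smul, ofReal_natCast, hφ, ← Complex.exp_add]
    congr 2
    push_cast
    ring
  simp only [hsum, hφn] at key
  rw [integral_levelMeasure] at key
  refine key.trans ?_
  have hd : max 0 (1 + ε - 2 * σ) ≤ max 1 (2 - 2 * σ) + ε - 1 := by
    refine max_le ?_ ?_
    · linarith [le_max_left 1 (2 - 2 * σ)]
    · linarith [le_max_right 1 (2 - 2 * σ)]
  calc _ ≤ Real.exp 1 * (√π * Real.exp U * (K₁ * Real.exp (2 * ε * U) *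
        (K₂ * Real.exp (max 0 (1 + ε - 2 * σ) * U)))) := by
        gcongr
        exact h2 U hU
    _ ≤ Real.exp 1 * (√π * Real.exp U * (K₁ * Real.exp (2 * ε * U) *
        (K₂ * Real.exp ((max 1 (2 - 2 * σ) + ε - 1) * U)))) := by
        gcongr
    _ = Real.exp 1 * √π * (K₁ * K₂) * (Real.exp U * Real.exp (2 * ε * U) *
        Real.exp ((max 1 (2 - 2 * σ) + ε - 1) * U)) := by ring
    _ = _ := by
        rw [← Real.exp_add, ← Real.exp_add]
        ring_nf

lemma lintegral_gaussian_le {T : ℝ} (hT : 0 < T) (S : Set ℝ) (x : ℝ) :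
    ∫⁻ y in S, ENNReal.ofReal (Real.exp (-(T ^ 2 * (x - y) ^ 2 / 4))) ≤
      ENNReal.ofReal (2 * √π / T) := by
  have hb : 0 < T ^ 2 / 4 := by positivity
  refine (setLIntegral_le_lintegral _ _).trans (le_of_eq ?_)
  rw [lintegral_sub_left_eq_self (fun y => ENNReal.ofReal (Real.exp (-(T ^ 2 * y ^ 2 / 4)))) x]
  have e : ∀ y : ℝ, -(T ^ 2 * y ^ 2 / 4) = -(T ^ 2 / 4) * y ^ 2 := fun y => by ring
  simp only [e]
  rw [← ofReal_integral_eq_lintegral_ofReal (integrable_exp_neg_mul_sq hb)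
    (Eventually.of_forall fun y => (Real.exp_pos _).le), integral_gaussian]
  congr 1
  rw [Real.sqrt_div Real.pi_pos.le, Real.sqrt_div (sq_nonneg T), Real.sqrt_sq hT.le,
    show (4 : ℝ) = 2 ^ 2 by norm_num, Real.sqrt_sq zero_le_two]
  field_simp

lemma HasMainTerm.exists_tail_le (hW : W.HasMainTerm A B C D) {σ ε : ℝ} (hε : 0 < ε)
    (hεσ : ε < 1 + σ) : ∃ K : ℝ, 0 ≤ K ∧ ∀ U : ℝ, 0 ≤ U →
    ∫ t in (1 : ℝ)..Real.exp U, ‖W.tail A B C D U (σ + t * I)‖ ^ 2 ≤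
      K * Real.exp (-(2 + 2 * σ - 2 * ε) * U) := by
  obtain ⟨K, hK, hj⟩ := hW ε hε
  refine ⟨Real.exp 1 * π * 2 * (K ^ 2 / (2 + 2 * σ - 2 * ε)), ?_, fun U hU => ?_⟩
  · have : 0 < 2 + 2 * σ - 2 * ε := by linarith
    positivity
  have ha : 0 < 2 + 2 * σ - 2 * ε := by linarith
  set μ := volume.restrict (Ioi U) with hμ
  set φ : ℝ → ℂ := fun u => (W.err A B C D u : ℂ) * cexp (-(σ : ℂ) * u) with hφ
  have hφm : Measurable φ := (Complex.measurable_ofReal.comp measurable_err).mul (by fun_prop)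
  have hφi : Integrable φ μ := hW.integrableOn_err (by rw [ofReal_re]; linarith) (by linarith)
  have hφle : ∀ u, u ∈ Ioi U → ‖φ u‖ ^ 2 ≤ K ^ 2 * Real.exp (-(2 + 2 * σ - 2 * ε) * u) := by
    intro u hu
    have h := norm_err_mul_exp_le hj (σ : ℂ) (show -1 ≤ u by linarith [mem_Ioi.1 hu])
    rw [ofReal_re] at h
    calc _ ≤ (K * Real.exp ((ε - 1 - σ) * u)) ^ 2 := pow_le_pow_left₀ (norm_nonneg _) h 2
      _ = _ := by rw [mul_pow, ← Real.exp_nat_mul]; push_cast; ring_nf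
  have hbi : IntegrableOn (fun u => K ^ 2 * Real.exp (-(2 + 2 * σ - 2 * ε) * u)) (Ioi U) :=
    (integrableOn_exp_mul_Ioi (by linarith) U).const_mul _
  have hφ2 : Integrable (fun u => ‖φ u‖ ^ 2) μ := by
    refine Integrable.mono' hbi (hφm.norm.pow_const 2).aestronglyMeasurable ?_
    filter_upwards [ae_restrict_mem measurableSet_Ioi] with u hu
    rw [Real.norm_of_nonneg (by positivity)]
    exact hφle u hu
  have hφ2le : ∫ u, ‖φ u‖ ^ 2 ∂μ ≤
      K ^ 2 / (2 + 2 * σ - 2 * ε) * Real.exp (-(2 + 2 * σ - 2 * ε) * U) := by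
    refine (setIntegral_mono_on hφ2 hbi measurableSet_Ioi hφle).trans (le_of_eq ?_)
    rw [integral_const_mul, integral_exp_mul_Ioi (by linarith)]
    field_simp
  have key := integral_norm_sq_le hφm hφi hφ2 (Real.one_le_exp hU)
    (κ := 2 * √π / Real.exp U) (by positivity) (lintegral_gaussian_le (Real.exp_pos U) (Ioi U))
  have htail : ∀ t : ℝ, ∫ x, φ x * cexp (-(t * x : ℝ) * I) ∂μ = W.tail A B C D U (σ + t * I) := by
    intro t
    rw [tail]
    refine integral_congr_ae (Eventually.of_forall fun u => ?_)
    simp only [hφ]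
    rw [mul_assoc, ← Complex.exp_add]
    congr 2
    push_cast
    ring
  simp only [htail] at key
  refine key.trans ?_
  calc _ = Real.exp 1 * (√π * √π) * 2 * (∫ u, ‖φ u‖ ^ 2 ∂μ) := by
        field_simp
    _ ≤ Real.exp 1 * (√π * √π) * 2 *
        (K ^ 2 / (2 + 2 * σ - 2 * ε) * Real.exp (-(2 + 2 * σ - 2 * ε) * U)) := by gcongr
    _ = _ := by rw [Real.mul_self_sqrt Real.pi_pos.le]; ring

lemma norm_re_add_im_le {σ t U : ℝ} (hU : 0 ≤ U) (ht : t ∈ Icc 1 (Real.exp U)) :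
    ‖(σ + t * I : ℂ)‖ ≤ (|σ| + 1) * Real.exp U := by
  have h1 : 1 ≤ Real.exp U := Real.one_le_exp hU
  have ht0 : 0 ≤ t := by linarith [ht.1]
  calc _ ≤ ‖(σ : ℂ)‖ + ‖(t * I : ℂ)‖ := norm_add_le _ _
    _ = |σ| + t := by simp [abs_of_nonneg ht0]
    _ ≤ |σ| * Real.exp U + Real.exp U := add_le_add (le_mul_of_one_le_right (abs_nonneg _) h1) ht.2
    _ = _ := by ring

lemma HasMainTerm.exists_boundary_le (hW : W.HasMainTerm A B C D) (σ : ℝ) {ε : ℝ} (hε : 0 < ε) :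
    ∃ K : ℝ, 0 ≤ K ∧ ∀ U : ℝ, 0 ≤ U → ∀ t ∈ Icc 1 (Real.exp U),
    ‖W.boundary A B C D U (σ + t * I)‖ ≤
      K * (Real.exp ((1 + ε) * U) * t⁻¹ + Real.exp (ε * U)) := by
  obtain ⟨K₁, hK₁, hj⟩ := hW ε hε
  obtain ⟨K₂, hK₂, hc⟩ := hW.exists_abs_count_sub_le hε
  refine ⟨(|A| / ε + |B| + 3 * |A|) + (K₂ + (|σ| + 1) * K₁), by positivity, fun U hU t ht => ?_⟩
  have ht0 : 0 < t := by linarith [ht.1]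
  have hti0 : 0 < t⁻¹ := inv_pos.2 ht0
  have hti : t⁻¹ ≤ 1 := inv_le_one_of_one_le₀ ht.1
  have hE1 : 1 ≤ Real.exp (ε * U) := Real.one_le_exp (by positivity)
  set s : ℂ := σ + t * I with hs
  have hs1 : ‖(s - 1)⁻¹‖ ≤ t⁻¹ := by
    rw [norm_inv]
    refine inv_anti₀ ht0 ?_
    have := Complex.abs_im_le_norm (s - 1)
    have h2 : (s - 1).im = t := by simp [hs]
    rwa [h2, abs_of_pos ht0] at this
  have hs0 : s - 1 ≠ 0 := by
    intro h
    have h2 : (s - 1).im = t := by simp [hs]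
    rw [h, zero_im] at h2
    linarith
  have hq : ‖(2 * s - 1) / (s - 1) ^ 2‖ ≤ 3 * t⁻¹ := by
    have : (2 * s - 1) / (s - 1) ^ 2 = 2 * (s - 1)⁻¹ + (s - 1)⁻¹ * (s - 1)⁻¹ := by
      field_simp; ring
    rw [this]
    calc _ ≤ ‖2 * (s - 1)⁻¹‖ + ‖(s - 1)⁻¹ * (s - 1)⁻¹‖ := norm_add_le _ _
      _ = 2 * ‖(s - 1)⁻¹‖ + ‖(s - 1)⁻¹‖ * ‖(s - 1)⁻¹‖ := by rw [norm_mul, norm_mul]; norm_num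
      _ ≤ 2 * t⁻¹ + t⁻¹ * 1 := by
          gcongr
          exact hs1.trans hti
      _ = _ := by ring
  have hAB : |A * U + B| ≤ (|A| / ε + |B|) * Real.exp (ε * U) := by
    calc _ ≤ |A * U| + |B| := abs_add_le _ _
      _ = |A| * U + |B| := by rw [abs_mul, abs_of_nonneg hU]
      _ ≤ |A| * (Real.exp (ε * U) / ε) + |B| * Real.exp (ε * U) := by
          refine add_le_add (mul_le_mul_of_nonneg_left (le_exp_mul_div hε U) (abs_nonneg _))
            (le_mul_of_one_le_right (abs_nonneg _) hE1)
      _ = _ := by ring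
  have eU : Real.exp (ε * U) * Real.exp U = Real.exp ((1 + ε) * U) := by
    rw [← Real.exp_add]; ring_nf
  have b1 : ‖(((A * U + B) * Real.exp U : ℝ) : ℂ) / (s - 1)‖ ≤
      (|A| / ε + |B|) * (Real.exp ((1 + ε) * U) * t⁻¹) := by
    rw [div_eq_mul_inv, norm_mul, Complex.norm_real, norm_mul, Real.norm_of_nonneg (Real.exp_pos U).le,
      Real.norm_eq_abs, ← eU]
    calc _ ≤ (|A| / ε + |B|) * Real.exp (ε * U) * Real.exp U * t⁻¹ := by gcongr
      _ = _ := by ring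
  have b2 : ‖((A * Real.exp U : ℝ) : ℂ) * ((2 * s - 1) / (s - 1) ^ 2)‖ ≤
      3 * |A| * (Real.exp ((1 + ε) * U) * t⁻¹) := by
    rw [norm_mul, Complex.norm_real, norm_mul, Real.norm_of_nonneg (Real.exp_pos U).le,
      Real.norm_eq_abs]
    calc _ ≤ |A| * Real.exp ((1 + ε) * U) * (3 * t⁻¹) := by
          gcongr
          nlinarith
      _ = _ := by ring
  have b3 : ‖((W.count U - countMain A B C U : ℝ) : ℂ)‖ ≤ K₂ * Real.exp (ε * U) := by
    rw [Complex.norm_real]; exact hc U hU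
  have b4 : ‖s * (W.err A B C D U : ℂ)‖ ≤ (|σ| + 1) * K₁ * Real.exp (ε * U) := by
    rw [norm_mul, Complex.norm_real]
    calc _ ≤ (|σ| + 1) * Real.exp U * (K₁ * Real.exp ((ε - 1) * U)) := by
          gcongr
          · exact norm_re_add_im_le hU ht
          · exact hj U (by linarith)
      _ = (|σ| + 1) * K₁ * (Real.exp U * Real.exp ((ε - 1) * U)) := by ring
      _ = _ := by rw [← Real.exp_add]; ring_nf
  have hX : 0 ≤ Real.exp ((1 + ε) * U) * t⁻¹ := by positivity
  calc _ ≤ _ + _ + _ + _ := (norm_sub_le _ _).trans (add_le_add ((norm_sub_le _ _).trans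
          (add_le_add (norm_add_le _ _) le_rfl)) le_rfl)
    _ ≤ (|A| / ε + |B|) * (Real.exp ((1 + ε) * U) * t⁻¹) + 3 * |A| * (Real.exp ((1 + ε) * U) * t⁻¹)
        + K₂ * Real.exp (ε * U) + (|σ| + 1) * K₁ * Real.exp (ε * U) := by
        gcongr
    _ ≤ _ := by
        have h1 : 0 ≤ (|A| / ε + |B| + 3 * |A|) * Real.exp (ε * U) := by positivity
        have h2 : 0 ≤ (K₂ + (|σ| + 1) * K₁) * (Real.exp ((1 + ε) * U) * t⁻¹) := by positivity
        linarith

lemma integral_inv_sq_le {T : ℝ} (hT : 1 ≤ T) : ∫ t in (1 : ℝ)..T, (t⁻¹) ^ 2 ≤ 1 := by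
  have h0 : (0 : ℝ) ∉ uIcc 1 T := by
    rw [uIcc_of_le hT]
    exact fun h => by linarith [h.1]
  have e : ∀ t : ℝ, (t⁻¹) ^ 2 = t ^ (-2 : ℤ) := fun t => by
    rw [zpow_neg, inv_pow]; rfl
  simp only [e]
  rw [integral_zpow (Or.inr ⟨by norm_num, h0⟩)]
  have : 0 ≤ T⁻¹ := by positivity
  norm_num
  rw [div_neg, div_one]
  linarith

lemma norm_add_add_sq_le (a b c : ℂ) : ‖a + b + c‖ ^ 2 ≤ 3 * ‖a‖ ^ 2 + 3 * ‖b‖ ^ 2 + 3 * ‖c‖ ^ 2 := by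
  have h := norm_add₃_le (a := a) (b := b) (c := c)
  have := pow_le_pow_left₀ (norm_nonneg _) h 2
  nlinarith [sq_nonneg (‖a‖ - ‖b‖), sq_nonneg (‖a‖ - ‖c‖), sq_nonneg (‖b‖ - ‖c‖)]

/-- The mean square of the continued Dirichlet series on vertical lines. -/
lemma HasMainTerm.exists_integral_norm_sq_le (hW : W.HasMainTerm A B C D) {R : ℂ → ℂ}
    (hser : ∀ s : ℂ, 1 < s.re → R s = ∑' i, (W.mult i : ℂ) * cexp (-s * W.lam i))
    (hR : ∀ s : ℂ, -1 < s.re → s ≠ 1 → DifferentiableAt ℂ R s) {σ ε : ℝ} (hσ : -1 < σ) (hε : 0 < ε)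
    (hε1 : ε ≤ 1) (hεσ : ε < 1 + σ) : ∃ K : ℝ, 0 ≤ K ∧ ∀ U : ℝ, 0 ≤ U →
    ∫ t in (1 : ℝ)..Real.exp U, ‖R (σ + t * I)‖ ^ 2 ≤
      K * Real.exp ((max 1 (2 - 2 * σ) + 3 * ε) * U) := by
  obtain ⟨K₁, hK₁, h1⟩ := hW.exists_partialSum_le σ hε hε1
  obtain ⟨K₂, hK₂, h2⟩ := hW.exists_boundary_le σ hε
  obtain ⟨K₃, hK₃, h3⟩ := hW.exists_tail_le hε hεσ
  refine ⟨3 * K₁ + 12 * K₂ ^ 2 + 3 * (|σ| + 1) ^ 4 * K₃, by positivity, fun U hU => ?_⟩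
  set T := Real.exp U with hT
  have hT1 : 1 ≤ T := Real.one_le_exp hU
  set E := Real.exp ((max 1 (2 - 2 * σ) + 3 * ε) * U) with hE
  set b : ℝ := 6 * K₂ ^ 2 * Real.exp (-(2 * σ) * U) with hb
  have hre : ∀ t : ℝ, (σ + t * I : ℂ).re = σ := fun t => by simp
  have him : ∀ t : ℝ, (σ + t * I : ℂ).im = t := fun t => by simp
  have hpt : ∀ t ∈ Icc 1 T, ‖R (σ + t * I)‖ ^ 2 ≤ 3 * ‖W.partialSum U (σ + t * I)‖ ^ 2 +
      (b * Real.exp ((2 + 2 * ε) * U) * (t⁻¹) ^ 2 + b * Real.exp (2 * ε * U)) +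
      3 * ((|σ| + 1) * T) ^ 4 * ‖W.tail A B C D U (σ + t * I)‖ ^ 2 := by
    intro t ht
    have ht0 : 0 < t := by linarith [ht.1]
    rw [hW.continuation_eq hser hR hU (by rw [hre]; exact hσ) (by rw [him]; exact ht0)]
    refine (norm_add_add_sq_le _ _ _).trans ?_
    refine add_le_add (add_le_add le_rfl ?_) ?_
    · rw [norm_mul, mul_pow, Complex.norm_exp, ← Real.exp_nat_mul]
      have e : ((2 : ℕ) : ℝ) * (-(σ + t * I : ℂ) * U).re = -(2 * σ) * U := by
        simp; ring
      rw [e]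
      have e1 : Real.exp ((2 + 2 * ε) * U) = Real.exp ((1 + ε) * U) ^ 2 := by
        rw [← Real.exp_nat_mul]; push_cast; ring_nf
      have e2 : Real.exp (2 * ε * U) = Real.exp (ε * U) ^ 2 := by
        rw [← Real.exp_nat_mul]; push_cast; ring_nf
      calc _ ≤ 3 * (Real.exp (-(2 * σ) * U) *
            (K₂ * (Real.exp ((1 + ε) * U) * t⁻¹ + Real.exp (ε * U))) ^ 2) := by
            gcongr
            exact h2 U hU t ht
        _ = 3 * K₂ ^ 2 * Real.exp (-(2 * σ) * U) *
            (Real.exp ((1 + ε) * U) * t⁻¹ + Real.exp (ε * U)) ^ 2 := by ring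
        _ ≤ 3 * K₂ ^ 2 * Real.exp (-(2 * σ) * U) *
            (2 * ((Real.exp ((1 + ε) * U) * t⁻¹) ^ 2 + Real.exp (ε * U) ^ 2)) := by
            gcongr
            exact add_sq_le
        _ = _ := by rw [hb, e1, e2]; ring
    · rw [norm_mul, mul_pow, norm_pow, ← pow_mul, mul_assoc]
      gcongr
      exact norm_re_add_im_le hU ht
  have hline : Continuous fun t : ℝ => (σ + t * I : ℂ) := by fun_prop
  have hRc : ContinuousOn (fun t : ℝ => ‖R (σ + t * I)‖ ^ 2) (uIcc 1 T) := by
    rw [uIcc_of_le hT1]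
    refine ContinuousOn.pow (ContinuousOn.norm fun t ht => ?_) 2
    have hd : ContinuousAt R (σ + t * I) := (hR _ (by rw [hre]; exact hσ) (fun h => by
      have := congrArg Complex.im h
      rw [him, one_im] at this
      linarith [ht.1])).continuousAt
    exact (ContinuousAt.comp (f := fun t : ℝ => (σ + t * I : ℂ)) hd
      hline.continuousAt).continuousWithinAt
  have hPc : Continuous fun t : ℝ => 3 * ‖W.partialSum U (σ + t * I)‖ ^ 2 :=
    ((((W.differentiable_partialSum U).continuous.comp hline).norm).pow 2).const_mul 3
  have hIc' : ContinuousOn (fun t : ℝ => b * Real.exp ((2 + 2 * ε) * U) * (t⁻¹) ^ 2) (uIcc 1 T) := by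
    rw [uIcc_of_le hT1]
    refine continuousOn_const.mul ((continuousOn_inv₀.mono ?_).pow 2)
    intro t ht h
    rw [mem_singleton_iff] at h
    linarith [ht.1]
  have hIc : ContinuousOn (fun t : ℝ => b * Real.exp ((2 + 2 * ε) * U) * (t⁻¹) ^ 2 +
      b * Real.exp (2 * ε * U)) (uIcc 1 T) := hIc'.add continuousOn_const
  have hQc : Continuous fun t : ℝ => 3 * ((|σ| + 1) * T) ^ 4 * ‖W.tail A B C D U (σ + t * I)‖ ^ 2 := by
    refine Continuous.const_mul (Continuous.pow (Continuous.norm ?_) 2) _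
    refine continuous_iff_continuousAt.2 fun t => ?_
    exact ContinuousAt.comp (f := fun t : ℝ => (σ + t * I : ℂ))
      (hW.differentiableAt_tail (by rw [hre]; exact hσ) hU).continuousAt hline.continuousAt
  have hPi := hPc.intervalIntegrable (μ := volume) 1 T
  have hIi := hIc.intervalIntegrable (μ := volume)
  have hQi := hQc.intervalIntegrable (μ := volume) 1 T
  have hb0 : 0 ≤ b := by positivity
  have hmain : 2 - 2 * σ ≤ max 1 (2 - 2 * σ) := le_max_right _ _
  have hP : 3 * ∫ t in (1 : ℝ)..T, ‖W.partialSum U (σ + t * I)‖ ^ 2 ≤ 3 * K₁ * E := by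
    rw [mul_assoc]
    exact mul_le_mul_of_nonneg_left (h1 U hU) (by norm_num)
  have hI : (∫ t in (1 : ℝ)..T, (b * Real.exp ((2 + 2 * ε) * U) * (t⁻¹) ^ 2 +
      b * Real.exp (2 * ε * U))) ≤ 12 * K₂ ^ 2 * E := by
    rw [intervalIntegral.integral_add hIc'.intervalIntegrable intervalIntegrable_const,
      intervalIntegral.integral_const_mul, intervalIntegral.integral_const, smul_eq_mul]
    have i1 : b * Real.exp ((2 + 2 * ε) * U) * (∫ t in (1 : ℝ)..T, (t⁻¹) ^ 2) ≤ 6 * K₂ ^ 2 * E := by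
      calc _ ≤ b * Real.exp ((2 + 2 * ε) * U) * 1 :=
            mul_le_mul_of_nonneg_left (integral_inv_sq_le hT1) (by positivity)
        _ = 6 * K₂ ^ 2 * Real.exp ((2 - 2 * σ + 2 * ε) * U) := by
            rw [hb, mul_one, mul_assoc, ← Real.exp_add]; ring_nf
        _ ≤ _ := by
            rw [hE]
            gcongr
            linarith
    have i2 : (T - 1) * (b * Real.exp (2 * ε * U)) ≤ 6 * K₂ ^ 2 * E := by
      calc _ ≤ T * (b * Real.exp (2 * ε * U)) := by
            gcongr
            linarith
        _ = 6 * K₂ ^ 2 * Real.exp ((1 - 2 * σ + 2 * ε) * U) := by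
            rw [hb, hT]
            calc _ = 6 * K₂ ^ 2 * (Real.exp U * Real.exp (-(2 * σ) * U) * Real.exp (2 * ε * U)) := by ring
              _ = _ := by rw [← Real.exp_add, ← Real.exp_add]; ring_nf
        _ ≤ _ := by
            refine mul_le_mul_of_nonneg_left (Real.exp_le_exp.2
              (mul_le_mul_of_nonneg_right ?_ hU)) (by positivity)
            linarith
    linarith
  have hQ : 3 * ((|σ| + 1) * T) ^ 4 * ∫ t in (1 : ℝ)..T, ‖W.tail A B C D U (σ + t * I)‖ ^ 2 ≤
      3 * (|σ| + 1) ^ 4 * K₃ * E := by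
    calc _ ≤ 3 * ((|σ| + 1) * T) ^ 4 * (K₃ * Real.exp (-(2 + 2 * σ - 2 * ε) * U)) := by
          gcongr
          exact h3 U hU
      _ = 3 * (|σ| + 1) ^ 4 * K₃ * (T ^ 4 * Real.exp (-(2 + 2 * σ - 2 * ε) * U)) := by ring
      _ = 3 * (|σ| + 1) ^ 4 * K₃ * Real.exp ((2 - 2 * σ + 2 * ε) * U) := by
          rw [hT, ← Real.exp_nat_mul, ← Real.exp_add]; push_cast; ring_nf
      _ ≤ _ := by
          rw [hE]
          gcongr
          linarith
  have hPIi := hPi.add hIi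
  calc _ ≤ _ := intervalIntegral.integral_mono_on hT1 hRc.intervalIntegrable (hPIi.add hQi) hpt
    _ = 3 * (∫ t in (1 : ℝ)..T, ‖W.partialSum U (σ + t * I)‖ ^ 2) +
        (∫ t in (1 : ℝ)..T, (b * Real.exp ((2 + 2 * ε) * U) * (t⁻¹) ^ 2 +
          b * Real.exp (2 * ε * U))) +
        3 * ((|σ| + 1) * T) ^ 4 * ∫ t in (1 : ℝ)..T, ‖W.tail A B C D U (σ + t * I)‖ ^ 2 := by
        rw [← intervalIntegral.integral_const_mul, ← intervalIntegral.integral_const_mul,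
          ← intervalIntegral.integral_add hPi hIi]
        exact intervalIntegral.integral_add hPIi hQi
    _ ≤ _ := by linarith

end WeightedSeq

theorem statement12
    (R : ℂ → ℂ)
    (hRser : ∀ s : ℂ, 1 < s.re →
      R s = ∑' ρ : {ρ : ℂ // IsNontrivialZero ρ},
        (zetaMult ρ.1 : ℂ) * (‖ρ.1‖ : ℂ) ^ (-s))
    (hRan : ∀ s : ℂ, -1 < s.re → s ≠ 1 → DifferentiableAt ℂ R s)
    : ∀ ε : ℝ, 0 < ε → ∀ σ : ℝ,
      ((-1 < σ ∧ σ ≤ 1/2) → ∃ C : ℝ, ∀ T : ℝ, 2 ≤ T →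
        (∫ t in (1:ℝ)..T, ‖R (σ + t * I)‖ ^ 2) ≤ C * T ^ (2 - 2 * σ + ε)) ∧
      (1/2 ≤ σ → ∃ C : ℝ, ∀ T : ℝ, 2 ≤ T →
        (∫ t in (1:ℝ)..T, ‖R (σ + t * I)‖ ^ 2) ≤ C * T ^ (1 + ε)) := by
  have hser : ∀ s : ℂ, 1 < s.re →
      R s = ∑' ρ, (zetaSeq.mult ρ : ℂ) * cexp (-s * zetaSeq.lam ρ) := by
    intro s hs
    rw [hRser s hs]
    refine tsum_congr fun ρ => ?_
    have hρ : 0 < ‖ρ.1‖ := ρ.2.norm_pos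
    rw [Complex.cpow_def_of_ne_zero (by exact_mod_cast hρ.ne'), ← Complex.ofReal_log hρ.le, mul_comm _ (-s)]
    rfl
  have key : ∀ ε : ℝ, 0 < ε → ∀ σ : ℝ, -1 < σ → ∃ C : ℝ, ∀ T : ℝ, 2 ≤ T →
      (∫ t in (1:ℝ)..T, ‖R (σ + t * I)‖ ^ 2) ≤ C * T ^ (max 1 (2 - 2 * σ) + ε) := by
    intro ε hε σ hσ
    set η := min (ε / 3) (min 1 ((1 + σ) / 2)) with hη
    have hη0 : 0 < η := lt_min (by positivity) (lt_min one_pos (by linarith))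
    have hη1 : η ≤ ε / 3 := min_le_left _ _
    have hη2 : η ≤ 1 := (min_le_right _ _).trans (min_le_left _ _)
    have hη3 : η ≤ (1 + σ) / 2 := (min_le_right _ _).trans (min_le_right _ _)
    obtain ⟨K, hK, h⟩ := zetaSeq_hasMainTerm.exists_integral_norm_sq_le hser hRan hσ hη0 hη2
      (by linarith)
    refine ⟨K, fun T hT => ?_⟩
    have hT0 : 0 < T := by linarith
    have hU : 0 ≤ Real.log T := Real.log_nonneg (by linarith)
    have := h (Real.log T) hU
    rw [Real.exp_log hT0] at this
    refine this.trans ?_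
    rw [Real.rpow_def_of_pos hT0, mul_comm (Real.log T)]
    gcongr
    linarith
  refine fun ε hε σ => ⟨fun hσ => ?_, fun hσ => ?_⟩
  · have := key ε hε σ hσ.1
    rwa [max_eq_right (by linarith [hσ.2])] at this
  · have := key ε hε σ (by linarith)
    rwa [max_eq_left (by linarith)] at this
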